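/- (i) H_{n+1}^f is a free right H_n^f-module with basis {X̃_j^a C̃_j^b T̃_j T̃_{j+1}⋯T̃_n : 0 ≤ a < d, b ∈ {0,1}, 1 ≤ j ≤ n+1} (the product of T̃'s being empty when j = n+1). (ii) As an (H_n^f, H_n^f)-bimodule, H_{n+1}^f = H_n^f T̃_n H_n^f ⊕ ⊕_{0 ≤ a < d, b ∈ {0,1}} X̃_{n+1}^a C̃_{n+1}^b H_n^f. (iii) For each 0 ≤ a < d there are even (H_n^f, H_n^f)-bimodule isomorphisms X̃_{n+1}^a H_n^f ≅ H_n^f, X̃_{n+1}^a C̃_{n+1} H_n^f ≅ Π H_n^f, and H_n^f T̃_n H_n^f ≅ H_n^f ⊗_{H_{n−1}^f} H_n^f. -/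

import Mathlib

set_option maxHeartbeats 1000000

namespace HC

/-- Generators of the affine Hecke–Clifford superalgebra `H_n`. -/
inductive Gen (n : ℕ) : Type
  | X : Fin n → Gen n
  | Xinv : Fin n → Gen n
  | C : Fin n → Gen n
  | T : Fin (n - 1) → Gen n

/-- The node `i` of `Fin n`, for `i : Fin (n-1)` (1-based: the node `i`). -/
def lo {n : ℕ} (i : Fin (n - 1)) : Fin n :=
  ⟨i.val, by have := i.isLt; omega⟩

/-- The node `i+1` of `Fin n`, for `i : Fin (n-1)`. -/
def hi {n : ℕ} (i : Fin (n - 1)) : Fin n :=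
  ⟨i.val + 1, by have := i.isLt; omega⟩

variable (F : Type) [Field F]

/-- The free algebra on the generators. -/
abbrev FA (n : ℕ) : Type := FreeAlgebra F (Gen n)

noncomputable def fx {n : ℕ} (i : Fin n) : FA F n := FreeAlgebra.ι F (Gen.X i)
noncomputable def fxinv {n : ℕ} (i : Fin n) : FA F n := FreeAlgebra.ι F (Gen.Xinv i)
noncomputable def fc {n : ℕ} (i : Fin n) : FA F n := FreeAlgebra.ι F (Gen.C i)
noncomputable def ft {n : ℕ} (i : Fin (n - 1)) : FA F n := FreeAlgebra.ι F (Gen.T i)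

/-- The defining relations of the affine Hecke–Clifford superalgebra, with parameter
`q` and `ξ = q - q⁻¹`. -/
inductive Rel (q : F) (n : ℕ) : FA F n → FA F n → Prop
  | XXinv (i : Fin n) : Rel q n (fx F i * fxinv F i) 1
  | XinvX (i : Fin n) : Rel q n (fxinv F i * fx F i) 1
  | XX (i j : Fin n) : Rel q n (fx F i * fx F j) (fx F j * fx F i)
  | XiXi (i j : Fin n) : Rel q n (fxinv F i * fxinv F j) (fxinv F j * fxinv F i)
  | XXi (i j : Fin n) (h : i ≠ j) : Rel q n (fx F i * fxinv F j) (fxinv F j * fx F i)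
  | CC (i : Fin n) : Rel q n (fc F i * fc F i) 1
  | Canti (i j : Fin n) (h : i ≠ j) : Rel q n (fc F i * fc F j) (-(fc F j * fc F i))
  | CX (i : Fin n) : Rel q n (fc F i * fx F i) (fxinv F i * fc F i)
  | CXi (i : Fin n) : Rel q n (fc F i * fxinv F i) (fx F i * fc F i)
  | CXo (i j : Fin n) (h : i ≠ j) : Rel q n (fc F i * fx F j) (fx F j * fc F i)
  | CXio (i j : Fin n) (h : i ≠ j) : Rel q n (fc F i * fxinv F j) (fxinv F j * fc F i)
  | Tquad (i : Fin (n - 1)) : Rel q n (ft F i * ft F i) ((q - q⁻¹) • ft F i + 1)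
  | Tbraid (i j : Fin (n - 1)) (h : (j : ℕ) = (i : ℕ) + 1) :
      Rel q n (ft F i * ft F j * ft F i) (ft F j * ft F i * ft F j)
  | TTfar (i j : Fin (n - 1)) (h : (i : ℕ) + 1 < (j : ℕ)) :
      Rel q n (ft F i * ft F j) (ft F j * ft F i)
  | TC (i : Fin (n - 1)) : Rel q n (ft F i * fc F (lo i)) (fc F (hi i) * ft F i)
  | TCo (i : Fin (n - 1)) (j : Fin n) (h1 : j ≠ lo i) (h2 : j ≠ hi i) :
      Rel q n (ft F i * fc F j) (fc F j * ft F i)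
  | TXo (i : Fin (n - 1)) (j : Fin n) (h1 : j ≠ lo i) (h2 : j ≠ hi i) :
      Rel q n (ft F i * fx F j) (fx F j * ft F i)
  | TXio (i : Fin (n - 1)) (j : Fin n) (h1 : j ≠ lo i) (h2 : j ≠ hi i) :
      Rel q n (ft F i * fxinv F j) (fxinv F j * ft F i)
  | cross (i : Fin (n - 1)) :
      Rel q n ((ft F i + (q - q⁻¹) • (fc F (lo i) * fc F (hi i))) * fx F (lo i) * ft F i)
        (fx F (hi i))

/-- The affine Hecke–Clifford superalgebra `H_n` over `F` with parameter `q`. -/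
abbrev H (q : F) (n : ℕ) : Type := RingQuot (Rel F q n)

noncomputable def X (q : F) {n : ℕ} (i : Fin n) : H F q n :=
  RingQuot.mkAlgHom F (Rel F q n) (fx F i)

noncomputable def Xinv (q : F) {n : ℕ} (i : Fin n) : H F q n :=
  RingQuot.mkAlgHom F (Rel F q n) (fxinv F i)

noncomputable def C (q : F) {n : ℕ} (i : Fin n) : H F q n :=
  RingQuot.mkAlgHom F (Rel F q n) (fc F i)

noncomputable def T (q : F) {n : ℕ} (i : Fin (n - 1)) : H F q n :=
  RingQuot.mkAlgHom F (Rel F q n) (ft F i)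

/-- `q` is either a primitive root of unity of odd order (including `q = 1`)
or not a root of unity at all (and `q ≠ 0`). -/
def GoodParam (q : F) : Prop :=
  q ≠ 0 ∧ ((∃ m : ℕ, Odd m ∧ IsPrimitiveRoot q m) ∨ ∀ m : ℕ, 0 < m → q ^ m ≠ 1)

/-- `X_i^a` for an integer exponent `a ∈ ℤ`. -/
noncomputable def XZ (q : F) {n : ℕ} (i : Fin n) (a : ℤ) : H F q n :=
  if 0 ≤ a then X F q i ^ a.toNat else Xinv F q i ^ (-a).toNat

/-- The monomial `X^α = X_1^{α_1} ⋯ X_n^{α_n}` for `α ∈ ℤ^n`. -/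
noncomputable def Xmon (q : F) {n : ℕ} (α : Fin n → ℤ) : H F q n :=
  ((List.finRange n).map fun i => XZ F q i (α i)).prod

/-- The monomial `C^β = C_1^{β_1} ⋯ C_n^{β_n}` for `β ∈ {0,1}^n`. -/
noncomputable def Cmon (q : F) {n : ℕ} (β : Fin n → Bool) : H F q n :=
  ((List.finRange n).map fun i => if β i then C F q i else 1).prod

/-- The basic transposition `s_i = (i, i+1)` of `S_n`. -/
def s {n : ℕ} (i : Fin (n - 1)) : Equiv.Perm (Fin n) := Equiv.swap (lo i) (hi i)

/-- The Coxeter length (number of inversions) of a permutation of `Fin n`. -/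
def len {n : ℕ} (w : Equiv.Perm (Fin n)) : ℕ :=
  ((Finset.univ : Finset (Fin n × Fin n)).filter fun p => p.1 < p.2 ∧ w p.2 < w p.1).card

/-- `Tw` is the family of standard basis elements `T_w`, `w ∈ S_n`: it satisfies
`T_1 = 1`, `T_{s_i} = T_i`, and `T_{s_i w} = T_i T_w` whenever `ℓ(s_i w) = ℓ(w) + 1`.
These conditions determine the family uniquely. -/
def IsTFam (q : F) {n : ℕ} (Tw : Equiv.Perm (Fin n) → H F q n) : Prop :=
  Tw 1 = 1 ∧ (∀ i : Fin (n - 1), Tw (s i) = T F q i) ∧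
    ∀ (i : Fin (n - 1)) (w : Equiv.Perm (Fin n)),
      len (s i * w) = len w + 1 → Tw (s i * w) = T F q i * Tw w

/-- `h` is the quantum characteristic of `q`:  the smallest positive integer with
`q^{1-h} + q^{3-h} + ⋯ + q^{h-1} = 0`. -/
def qcharEq (q : F) (h : ℕ) : Prop :=
  0 < h ∧ (∑ k ∈ Finset.range h, q ^ (1 - (h : ℤ) + 2 * (k : ℤ))) = 0 ∧
    ∀ h' : ℕ, 0 < h' → h' < h →
      (∑ k ∈ Finset.range h', q ^ (1 - (h' : ℤ) + 2 * (k : ℤ))) ≠ 0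

/-- `i ∈ I = {0, 1, …, ℓ}` where `ℓ = (h-1)/2` (no condition if the quantum
characteristic is infinite). -/
def memI (q : F) (i : ℕ) : Prop := ∀ h : ℕ, qcharEq F q h → 2 * i + 1 ≤ h

/-- `q(i) = 2(q^{2i+1} + q^{-2i-1})/(q + q⁻¹)`. -/
noncomputable def qres (q : F) (i : ℕ) : F :=
  2 * (q ^ (2 * i + 1) + q⁻¹ ^ (2 * i + 1)) / (q + q⁻¹)

/-- Index of the block containing position `k` (0-based), for a composition given as a
list of parts. -/
def blk : List ℕ → ℕ → ℕ
  | [], _ => 0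
  | a :: rest, k => if k < a then 0 else blk rest (k - a) + 1

/-- Membership in the Young subgroup `S_μ ⊆ S_n`. -/
def InYoung {n : ℕ} (μ : List ℕ) (w : Equiv.Perm (Fin n)) : Prop :=
  ∀ k : Fin n, blk μ (w k).val = blk μ k.val

/-- `μ` is a composition of `n`. -/
def IsComposition (μ : List ℕ) (n : ℕ) : Prop := (∀ a ∈ μ, 0 < a) ∧ μ.sum = n

/-- The parabolic subalgebra generated by all `X_i^{±1}`, `C_i`, and the `T_j` with
`j` in a set `J` of admissible indices. -/
def parabolicJ (q : F) {n : ℕ} (J : Set (Fin (n - 1))) : Subalgebra F (H F q n) :=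
  Algebra.adjoin F
    ((Set.range fun i : Fin n => X F q i) ∪ (Set.range fun i : Fin n => Xinv F q i) ∪
      (Set.range fun i : Fin n => C F q i) ∪ {h | ∃ j ∈ J, h = T F q j})

/-- The parabolic subalgebra `H_μ` for a composition `μ`. -/
def parabolicC (q : F) {n : ℕ} (μ : List ℕ) : Subalgebra F (H F q n) :=
  parabolicJ F q {j | InYoung μ (s j)}

/-- The classical parabolic subalgebra `H^cl_μ`, generated by the `T_j` with `s_j ∈ S_μ`. -/
def clparC (q : F) {n : ℕ} (μ : List ℕ) : Subalgebra F (H F q n) :=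
  Algebra.adjoin F {h | ∃ j : Fin (n - 1), InYoung μ (s j) ∧ h = T F q j}

/-- The finite Hecke–Clifford subalgebra `H^fn_n`, generated by all `C_i` and `T_j`. -/
def Hfin (q : F) (n : ℕ) : Subalgebra F (H F q n) :=
  Algebra.adjoin F
    ((Set.range fun i : Fin n => C F q i) ∪ {h | ∃ j : Fin (n - 1), h = T F q j})

/-- `x` is a minimal length `(S_μ, S_ν)`-double coset representative. -/
def IsMinDC {n : ℕ} (μ ν : List ℕ) (x : Equiv.Perm (Fin n)) : Prop :=
  ∀ u v : Equiv.Perm (Fin n), InYoung μ u → InYoung ν v → len x ≤ len (u * x * v)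

/-- `w ∈ S_μ x S_ν`. -/
def InDC {n : ℕ} (μ ν : List ℕ) (x w : Equiv.Perm (Fin n)) : Prop :=
  ∃ u v : Equiv.Perm (Fin n), InYoung μ u ∧ InYoung ν v ∧ w = u * x * v

/-- A covering step in the Bruhat order: multiplication by a reflection increasing length. -/
def BruhatStep {n : ℕ} (v w : Equiv.Perm (Fin n)) : Prop :=
  ∃ a b : Fin n, a ≠ b ∧ w = Equiv.swap a b * v ∧ len v < len w

/-- The Bruhat order on `S_n`. -/
def BruhatLE {n : ℕ} : Equiv.Perm (Fin n) → Equiv.Perm (Fin n) → Prop :=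
  Relation.ReflTransGen BruhatStep

/-- The space of `A`-equivariant linear maps between two representations of the
`F`-algebra `A`. -/
def eqvHoms {A : Type} [Ring A] [Algebra F A] {M N : Type}
    [AddCommGroup M] [Module F M] [AddCommGroup N] [Module F N]
    (ρM : A →ₐ[F] Module.End F M) (ρN : A →ₐ[F] Module.End F N) :
    Submodule F (M →ₗ[F] N) where
  carrier := {f | ∀ (x : A) (m : M), f (ρM x m) = ρN x (f m)}
  add_mem' := by
    intro f g hf hg x m
    simp only [LinearMap.add_apply, hf x m, hg x m, map_add]
  zero_mem' := by
    intro x m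
    simp only [LinearMap.zero_apply, map_zero]
  smul_mem' := by
    intro c f hf x m
    simp only [LinearMap.smul_apply, hf x m, map_smul]

/-- `(E, ρE, ι)` is the module induced along the algebra morphism `φ : B →ₐ A` from
the `B`-representation `(M, ρ)`, i.e. `E = A ⊗_B M`, characterized by its universal
property. -/
def IsInducedAlong {A B : Type} [Ring A] [Ring B] [Algebra F A] [Algebra F B]
    (φ : B →ₐ[F] A) {M : Type} [AddCommGroup M] [Module F M]
    (ρ : B →ₐ[F] Module.End F M) {E : Type} [AddCommGroup E] [Module F E]
    (ρE : A →ₐ[F] Module.End F E) (ι : M →ₗ[F] E) : Prop :=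
  (∀ (b : B) (m : M), ι (ρ b m) = ρE (φ b) (ι m)) ∧
    ∀ (P : Type) [AddCommGroup P] [Module F P],
      ∀ (ρP : A →ₐ[F] Module.End F P) (f : M →ₗ[F] P),
        (∀ (b : B) (m : M), f (ρ b m) = ρP (φ b) (f m)) →
        ∃! g : E →ₗ[F] P,
          (∀ (x : A) (e : E), g (ρE x e) = ρP x (g e)) ∧ ∀ m : M, g (ι m) = f m

/-- `δ` is the grading automorphism of the superalgebra `H_n`
(identity on even generators, `-1` on the odd generators `C_i`). -/
def IsGradingAut (q : F) {n : ℕ} (δ : H F q n →ₐ[F] H F q n) : Prop :=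
  (∀ i : Fin n, δ (X F q i) = X F q i) ∧ (∀ i : Fin n, δ (Xinv F q i) = Xinv F q i) ∧
    (∀ i : Fin n, δ (C F q i) = -C F q i) ∧ ∀ i : Fin (n - 1), δ (T F q i) = T F q i

/-- `τ` is the antiautomorphism of `H_n` with `τ(T_i) = T_i + ξ C_i C_{i+1}`,
`τ(C_j) = C_j`, `τ(X_j) = X_j`. -/
def IsTauAntiAut (q : F) {n : ℕ} (τ : H F q n →ₗ[F] H F q n) : Prop :=
  Function.Bijective τ ∧ (∀ a b : H F q n, τ (a * b) = τ b * τ a) ∧ τ 1 = 1 ∧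
    (∀ i : Fin (n - 1),
      τ (T F q i) = T F q i + (q - q⁻¹) • (C F q (lo i) * C F q (hi i))) ∧
    (∀ j : Fin n, τ (C F q j) = C F q j) ∧ (∀ j : Fin n, τ (X F q j) = X F q j) ∧
    ∀ j : Fin n, τ (Xinv F q j) = Xinv F q j

/-- `ρ'` is the representation of the subalgebra `B` obtained from the
`H_ν`-representation `ρν` by twisting with the isomorphism `φ_{x⁻¹}`
(determined by `X_i ↦ X_{x⁻¹ i}`, `C_i ↦ C_{x⁻¹ i}`, `T_w ↦ T_{x⁻¹ w x}`). -/
def IsTwistedRep (q : F) {n : ℕ} (ν : List ℕ) (x : Equiv.Perm (Fin n))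
    (B : Subalgebra F (H F q n)) {M : Type} [AddCommGroup M] [Module F M]
    (ρν : ↥(parabolicC F q (n := n) ν) →ₐ[F] Module.End F M)
    (ρ' : ↥B →ₐ[F] Module.End F M) : Prop :=
  (∀ (i : Fin n) (a : ↥B) (b : ↥(parabolicC F q (n := n) ν)),
      (a : H F q n) = X F q i → (b : H F q n) = X F q (x⁻¹ i) → ρ' a = ρν b) ∧
  (∀ (i : Fin n) (a : ↥B) (b : ↥(parabolicC F q (n := n) ν)),
      (a : H F q n) = Xinv F q i → (b : H F q n) = Xinv F q (x⁻¹ i) → ρ' a = ρν b) ∧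
  (∀ (i : Fin n) (a : ↥B) (b : ↥(parabolicC F q (n := n) ν)),
      (a : H F q n) = C F q i → (b : H F q n) = C F q (x⁻¹ i) → ρ' a = ρν b) ∧
  ∀ (j j' : Fin (n - 1)) (a : ↥B) (b : ↥(parabolicC F q (n := n) ν)),
      lo j' = x⁻¹ (lo j) → (a : H F q n) = T F q j → (b : H F q n) = T F q j' → ρ' a = ρν b

/-- The element `f = a_d X_1^d + ⋯ + a_1 X_1 + a_0` of `H_n`. -/
noncomputable def felem (q : F) (n d : ℕ) (aa : ℕ → F) : H F q n :=
  if h : 0 < n then ∑ i ∈ Finset.range (d + 1), aa i • X F q (⟨0, h⟩ : Fin n) ^ i else 0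

/-- The conditions on the coefficients of `f`: degree `d ≥ 1`, monic, and
`a_i = a_0 a_{d-i}`. -/
def GoodPoly (d : ℕ) (aa : ℕ → F) : Prop :=
  1 ≤ d ∧ aa d = 1 ∧ (∀ i ≤ d, aa i = aa 0 * aa (d - i)) ∧ ∀ i : ℕ, d < i → aa i = 0

/-- The relation generating the two-sided ideal `I_f` of `H_n`. -/
inductive CycRel (q : F) (n d : ℕ) (aa : ℕ → F) : H F q n → H F q n → Prop
  | rel : CycRel q n d aa (felem F q n d aa) 0

/-- The cyclotomic Hecke–Clifford superalgebra `H_n^f = H_n / I_f`. -/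
abbrev Hf (q : F) (n d : ℕ) (aa : ℕ → F) : Type := RingQuot (CycRel F q n d aa)

/-- The canonical quotient map `H_n → H_n^f`. -/
noncomputable def cyc (q : F) (n d : ℕ) (aa : ℕ → F) : H F q n →ₐ[F] Hf F q n d aa :=
  RingQuot.mkAlgHom F (CycRel F q n d aa)

noncomputable def Xf (q : F) (n d : ℕ) (aa : ℕ → F) (i : Fin n) : Hf F q n d aa :=
  cyc F q n d aa (X F q i)
noncomputable def Xinvf (q : F) (n d : ℕ) (aa : ℕ → F) (i : Fin n) : Hf F q n d aa :=
  cyc F q n d aa (Xinv F q i)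
noncomputable def Cf (q : F) (n d : ℕ) (aa : ℕ → F) (i : Fin n) : Hf F q n d aa :=
  cyc F q n d aa (C F q i)
noncomputable def Tf (q : F) (n d : ℕ) (aa : ℕ → F) (i : Fin (n - 1)) : Hf F q n d aa :=
  cyc F q n d aa (T F q i)

/-- `e` is the canonical embedding `H_k^f → H_N^f` (shifting all indices by `sh`;
for `sh = 0` this is the standard identification of `H_k^f` with a subalgebra of
`H_N^f`). -/
def IsCycEmb (q : F) (k N d : ℕ) (aa : ℕ → F) (sh : ℕ)
    (e : Hf F q k d aa →ₐ[F] Hf F q N d aa) : Prop :=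
  (∀ (i : Fin k) (i' : Fin N), (i' : ℕ) = sh + (i : ℕ) →
      e (Xf F q k d aa i) = Xf F q N d aa i') ∧
  (∀ (i : Fin k) (i' : Fin N), (i' : ℕ) = sh + (i : ℕ) →
      e (Xinvf F q k d aa i) = Xinvf F q N d aa i') ∧
  (∀ (i : Fin k) (i' : Fin N), (i' : ℕ) = sh + (i : ℕ) →
      e (Cf F q k d aa i) = Cf F q N d aa i') ∧
  ∀ (j : Fin (k - 1)) (j' : Fin (N - 1)), (j' : ℕ) = sh + (j : ℕ) →
      e (Tf F q k d aa j) = Tf F q N d aa j'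

/-- `δ` is the grading automorphism of the superalgebra `H_n^f`. -/
def IsCycGrading (q : F) (n d : ℕ) (aa : ℕ → F)
    (δ : Hf F q n d aa →ₐ[F] Hf F q n d aa) : Prop :=
  (∀ i : Fin n, δ (Xf F q n d aa i) = Xf F q n d aa i) ∧
  (∀ i : Fin n, δ (Xinvf F q n d aa i) = Xinvf F q n d aa i) ∧
  (∀ i : Fin n, δ (Cf F q n d aa i) = -Cf F q n d aa i) ∧
  ∀ j : Fin (n - 1), δ (Tf F q n d aa j) = Tf F q n d aa j

/-- The elements `f_1 = f`, `f_{i+1} = (T_i + ξ C_i C_{i+1}) f_i T_i` of `H_n`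
(0-based indexing: `fseq k = f_{k+1}`). -/
noncomputable def fseq (q : F) (n d : ℕ) (aa : ℕ → F) : ℕ → H F q n
  | 0 => felem F q n d aa
  | k + 1 =>
    if h : k < n - 1 then
      (T F q (⟨k, h⟩ : Fin (n - 1)) +
          (q - q⁻¹) • (C F q (lo (⟨k, h⟩ : Fin (n - 1))) *
            C F q (hi (⟨k, h⟩ : Fin (n - 1))))) *
        fseq q n d aa k * T F q (⟨k, h⟩ : Fin (n - 1))
    else 0

/-- `f_Z = f_{z_1} ⋯ f_{z_u}` for `Z = {z_1 < ⋯ < z_u} ⊆ {1,…,n}` (0-based). -/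
noncomputable def fZ (q : F) (n d : ℕ) (aa : ℕ → F) (Z : Finset (Fin n)) : H F q n :=
  ((Z.sort (· ≤ ·)).map fun z => fseq F q n d aa (z : ℕ)).prod

/-- The element `X̃_j^a C̃_j^b T̃_j T̃_{j+1} ⋯ T̃_n` of `H_{n+1}^f` (0-based `j`;
the product of `T̃`'s is empty when `j = n+1`). -/
noncomputable def stdElt (F : Type) [Field F] (q : F) (n d : ℕ) (aa : ℕ → F)
    (p : Fin d × Bool × Fin (n + 1)) : Hf F q (n + 1) d aa :=
  Xf F q (n + 1) d aa p.2.2 ^ (p.1 : ℕ) *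
    (if p.2.1 then Cf F q (n + 1) d aa p.2.2 else 1) *
    (((List.finRange n).filter fun k : Fin n => (p.2.2 : ℕ) ≤ (k : ℕ)).map
      fun k => Tf F q (n + 1) d aa k).prod

/-- The summands in the `(H_n^f, H_n^f)`-bimodule decomposition of `H_{n+1}^f`:
`none` indexes `H_n^f T̃_n H_n^f`, and `some (a, b)` indexes
`X̃_{n+1}^a C̃_{n+1}^b H_n^f`. -/
noncomputable def piece (F : Type) [Field F] (q : F) (n d : ℕ) (hn : 0 < n) (aa : ℕ → F)
    (en : Hf F q n d aa →ₐ[F] Hf F q (n + 1) d aa) :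
    Option (Fin d × Bool) → Submodule F (Hf F q (n + 1) d aa)
  | none => Submodule.span F {h | ∃ u v : Hf F q n d aa,
      h = en u * Tf F q (n + 1) d aa ⟨n - 1, Nat.sub_lt hn one_pos⟩ * en v}
  | some p => Submodule.span F {h | ∃ v : Hf F q n d aa,
      h = Xf F q (n + 1) d aa ⟨n, n.lt_succ_self⟩ ^ (p.1 : ℕ) *
        (if p.2 then Cf F q (n + 1) d aa ⟨n, n.lt_succ_self⟩ else 1) * en v}

section Relations

variable {F} {R : Type*} [Ring R] [Algebra F R]

/-- The defining relations of `H_N` for families indexed by `ℕ`, only indices below `N` mattering. -/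
structure Fwd (ξ : F) (N : ℕ) (T C X Y : ℕ → R) : Prop where
  XY : ∀ i < N, X i * Y i = 1
  YX : ∀ i < N, Y i * X i = 1
  XX : ∀ i < N, ∀ j < N, Commute (X i) (X j)
  CC : ∀ i < N, C i * C i = 1
  anti : ∀ i < N, ∀ j < N, i ≠ j → C i * C j = -(C j * C i)
  CX : ∀ i < N, C i * X i = Y i * C i
  CXo : ∀ i < N, ∀ j < N, i ≠ j → Commute (C i) (X j)
  quad : ∀ i, i + 1 < N → T i * T i = ξ • T i + 1
  braid : ∀ i, i + 2 < N → T i * T (i + 1) * T i = T (i + 1) * T i * T (i + 1)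
  far : ∀ i j, i + 1 < j → j + 1 < N → Commute (T i) (T j)
  TC : ∀ i, i + 1 < N → T i * C i = C (i + 1) * T i
  TCo : ∀ i, i + 1 < N → ∀ j < N, j ≠ i → j ≠ i + 1 → Commute (T i) (C j)
  TXo : ∀ i, i + 1 < N → ∀ j < N, j ≠ i → j ≠ i + 1 → Commute (T i) (X j)
  cross : ∀ i, i + 1 < N → (T i + ξ • (C i * C (i + 1))) * X i * T i = X (i + 1)

/-- The relations of `H_N` with the strands numbered from the last one: strand `0` is the top
strand, and `T k` links the upper strand `k` with the lower strand `k + 1`. -/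
structure Rev (ξ : F) (N : ℕ) (T C X Y : ℕ → R) : Prop where
  XY : ∀ i < N, X i * Y i = 1
  YX : ∀ i < N, Y i * X i = 1
  XX : ∀ i < N, ∀ j < N, Commute (X i) (X j)
  CC : ∀ i < N, C i * C i = 1
  anti : ∀ i < N, ∀ j < N, i ≠ j → C i * C j = -(C j * C i)
  CX : ∀ i < N, C i * X i = Y i * C i
  CXo : ∀ i < N, ∀ j < N, i ≠ j → Commute (C i) (X j)
  quad : ∀ i, i + 1 < N → T i * T i = ξ • T i + 1
  braid : ∀ i, i + 2 < N → T i * T (i + 1) * T i = T (i + 1) * T i * T (i + 1)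
  far : ∀ i j, i + 1 < j → j + 1 < N → Commute (T i) (T j)
  TC : ∀ i, i + 1 < N → T i * C (i + 1) = C i * T i
  TCo : ∀ i, i + 1 < N → ∀ j < N, j ≠ i → j ≠ i + 1 → Commute (T i) (C j)
  TXo : ∀ i, i + 1 < N → ∀ j < N, j ≠ i → j ≠ i + 1 → Commute (T i) (X j)
  cross : ∀ i, i + 1 < N → (T i + ξ • (C (i + 1) * C i)) * X (i + 1) * T i = X i

theorem Fwd.rev {ξ : F} {N : ℕ} {T C X Y : ℕ → R} (h : Fwd ξ N T C X Y) :
    Rev ξ N (fun k => T (N - 2 - k)) (fun k => C (N - 1 - k)) (fun k => X (N - 1 - k))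
      (fun k => Y (N - 1 - k)) where
  XY i hi := h.XY _ (by omega)
  YX i hi := h.YX _ (by omega)
  XX i hi j hj := h.XX _ (by omega) _ (by omega)
  CC i hi := h.CC _ (by omega)
  anti i hi j hj hij := h.anti _ (by omega) _ (by omega) (by omega)
  CX i hi := h.CX _ (by omega)
  CXo i hi j hj hij := h.CXo _ (by omega) _ (by omega) (by omega)
  quad i hi := h.quad _ (by omega)
  braid i hi := by
    have e : N - 2 - i = N - 2 - (i + 1) + 1 := by omega
    have := h.braid (N - 2 - (i + 1)) (by omega)
    simp only [e]
    exact this.symm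
  far i j hij hj := (h.far _ _ (by omega) (by omega)).symm
  TC i hi := by
    have e : N - 1 - i = N - 2 - i + 1 := by omega
    have e' : N - 1 - (i + 1) = N - 2 - i := by omega
    simp only [e, e']
    exact h.TC _ (by omega)
  TCo i hi j hj h1 h2 := h.TCo _ (by omega) _ (by omega) (by omega) (by omega)
  TXo i hi j hj h1 h2 := h.TXo _ (by omega) _ (by omega) (by omega) (by omega)
  cross i hi := by
    have e : N - 1 - i = N - 2 - i + 1 := by omega
    have e' : N - 1 - (i + 1) = N - 2 - i := by omega
    simp only [e, e']
    exact h.cross _ (by omega)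

theorem Rev.fwd {ξ : F} {N : ℕ} {T C X Y : ℕ → R} (h : Rev ξ N T C X Y) :
    Fwd ξ N (fun k => T (N - 2 - k)) (fun k => C (N - 1 - k)) (fun k => X (N - 1 - k))
      (fun k => Y (N - 1 - k)) where
  XY i hi := h.XY _ (by omega)
  YX i hi := h.YX _ (by omega)
  XX i hi j hj := h.XX _ (by omega) _ (by omega)
  CC i hi := h.CC _ (by omega)
  anti i hi j hj hij := h.anti _ (by omega) _ (by omega) (by omega)
  CX i hi := h.CX _ (by omega)
  CXo i hi j hj hij := h.CXo _ (by omega) _ (by omega) (by omega)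
  quad i hi := h.quad _ (by omega)
  braid i hi := by
    have e : N - 2 - i = N - 2 - (i + 1) + 1 := by omega
    have := h.braid (N - 2 - (i + 1)) (by omega)
    simp only [e]
    exact this.symm
  far i j hij hj := (h.far _ _ (by omega) (by omega)).symm
  TC i hi := by
    have e : N - 1 - i = N - 2 - i + 1 := by omega
    have e' : N - 1 - (i + 1) = N - 2 - i := by omega
    simp only [e, e']
    exact h.TC _ (by omega)
  TCo i hi j hj h1 h2 := h.TCo _ (by omega) _ (by omega) (by omega) (by omega)
  TXo i hi j hj h1 h2 := h.TXo _ (by omega) _ (by omega) (by omega) (by omega)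
  cross i hi := by
    have e : N - 1 - i = N - 2 - i + 1 := by omega
    have e' : N - 1 - (i + 1) = N - 2 - i := by omega
    simp only [e, e']
    exact h.cross _ (by omega)

/-- The image of a family satisfying the relations under an algebra morphism. -/
theorem Rev.map {S : Type*} [Ring S] [Algebra F S] (g : R →ₐ[F] S) {ξ : F} {N : ℕ}
    {T C X Y : ℕ → R} (h : Rev ξ N T C X Y) :
    Rev ξ N (fun k => g (T k)) (fun k => g (C k)) (fun k => g (X k)) (fun k => g (Y k)) where
  XY i hi := by rw [← map_mul, h.XY i hi, map_one]
  YX i hi := by rw [← map_mul, h.YX i hi, map_one]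
  XX i hi j hj := (h.XX i hi j hj).map g
  CC i hi := by rw [← map_mul, h.CC i hi, map_one]
  anti i hi j hj hij := by rw [← map_mul, ← map_mul, h.anti i hi j hj hij, map_neg]
  CX i hi := by rw [← map_mul, ← map_mul, h.CX i hi]
  CXo i hi j hj hij := (h.CXo i hi j hj hij).map g
  quad i hi := by rw [← map_mul, h.quad i hi, map_add, map_smul, map_one]
  braid i hi := by simp only [← map_mul, h.braid i hi]
  far i j hij hj := (h.far i j hij hj).map g
  TC i hi := by simp only [← map_mul, h.TC i hi]
  TCo i hi j hj h1 h2 := (h.TCo i hi j hj h1 h2).map g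
  TXo i hi j hj h1 h2 := (h.TXo i hi j hj h1 h2).map g
  cross i hi := by simp only [← map_mul, ← map_smul, ← map_add, h.cross i hi]

/-- The relations between `T` and the Clifford generators `c` (lower) and `C` (upper) of the two
strands it links. -/
structure Pair (ξ : F) (T c C : R) : Prop where
  quad : T * T = ξ • T + 1
  Tc : T * c = C * T
  CC : C * C = 1
  anti : c * C = -(C * c)

namespace Pair

variable {ξ : F} {T c C : R}

theorem mul_inv (h : T * T = ξ • T + 1) : T * (T - ξ • 1) = 1 := by
  rw [mul_sub, h, mul_smul_comm, mul_one]; abel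

theorem inv_mul (h : T * T = ξ • T + 1) : (T - ξ • 1) * T = 1 := by
  rw [sub_mul, h, smul_mul_assoc, one_mul]; abel

theorem cTi (h : Pair ξ T c C) : c * (T - ξ • 1) = (T - ξ • 1) * C := by
  calc c * (T - ξ • 1) = ((T - ξ • 1) * T) * c * (T - ξ • 1) := by rw [inv_mul h.quad, one_mul]
    _ = (T - ξ • 1) * C * (T * (T - ξ • 1)) := by
        rw [mul_assoc _ T c, h.Tc]; simp only [mul_assoc]
    _ = _ := by rw [mul_inv h.quad, mul_one]

theorem TC (h : Pair ξ T c C) : T * C = c * T - ξ • c + ξ • C := by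
  have := h.cTi
  simp only [mul_sub, sub_mul, mul_smul_comm, smul_mul_assoc, mul_one, one_mul] at this
  rw [this]; abel

theorem cc (h : Pair ξ T c C) : c * c = 1 := by
  calc c * c = c * ((T - ξ • 1) * T) * c := by rw [inv_mul h.quad, mul_one]
    _ = (c * (T - ξ • 1)) * (T * c) := by simp only [mul_assoc]
    _ = (T - ξ • 1) * (C * C) * T := by rw [h.cTi, h.Tc]; simp only [mul_assoc]
    _ = 1 := by rw [h.CC, mul_one, inv_mul h.quad]

theorem sq (h : Pair ξ T c C) : (c * C) * (c * C) = -1 := by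
  calc (c * C) * (c * C) = c * (C * c) * C := by simp only [mul_assoc]
    _ = -((c * c) * (C * C)) := by
        rw [show C * c = -(c * C) by rw [h.anti, neg_neg]]; simp [mul_assoc]
    _ = -1 := by rw [h.cc, h.CC, mul_one]

theorem TcC (h : Pair ξ T c C) : T * (c * C) + c * C * T = ξ • 1 + ξ • (c * C) := by
  have e : C * c = -(c * C) := by rw [h.anti, neg_neg]
  rw [← mul_assoc, h.Tc, mul_assoc, h.TC]
  simp only [mul_add, mul_sub, mul_smul_comm, ← mul_assoc, e, h.CC]
  simp only [neg_mul, smul_neg]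
  abel

theorem Th_sq (h : Pair ξ T c C) :
    (T + ξ • (c * C)) * (T + ξ • (c * C)) = ξ • (T + ξ • (c * C)) + 1 := by
  have h1 := h.TcC
  have h2 := h.sq
  have h3 := h.quad
  calc _ = T * T + ξ • (T * (c * C) + c * C * T) + (ξ * ξ) • ((c * C) * (c * C)) := by
        simp only [mul_add, add_mul, mul_smul_comm, smul_mul_assoc, smul_smul, smul_add]; abel
    _ = _ := by rw [h1, h2, h3]; module

theorem Thi_eq : T - ξ • 1 + ξ • (c * C) = (T + ξ • (c * C)) - ξ • 1 := by abel

theorem Th_Thi (h : Pair ξ T c C) : (T + ξ • (c * C)) * (T - ξ • 1 + ξ • (c * C)) = 1 := by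
  rw [Thi_eq, mul_inv h.Th_sq]

theorem Thi_Th (h : Pair ξ T c C) : (T - ξ • 1 + ξ • (c * C)) * (T + ξ • (c * C)) = 1 := by
  rw [Thi_eq, inv_mul h.Th_sq]

theorem ThC (h : Pair ξ T c C) : (T + ξ • (c * C)) * C = c * (T + ξ • (c * C)) := by
  rw [add_mul, mul_add, h.TC]
  simp only [mul_smul_comm, smul_mul_assoc, ← mul_assoc c c, h.cc, one_mul, mul_assoc, h.CC,
    mul_one]
  abel

theorem CThi (h : Pair ξ T c C) :
    C * (T - ξ • 1 + ξ • (c * C)) = (T - ξ • 1 + ξ • (c * C)) * c := by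
  calc _ = ((T - ξ • 1 + ξ • (c * C)) * (T + ξ • (c * C))) * C *
        (T - ξ • 1 + ξ • (c * C)) := by rw [h.Thi_Th, one_mul]
    _ = (T - ξ • 1 + ξ • (c * C)) * c * ((T + ξ • (c * C)) * (T - ξ • 1 + ξ • (c * C))) := by
        rw [mul_assoc _ _ C, h.ThC]; simp only [mul_assoc]
    _ = _ := by rw [h.Th_Thi, mul_one]

theorem cThi (h : Pair ξ T c C) : c * (T - ξ • 1 + ξ • (c * C)) = T * C := by
  rw [h.TC]
  simp only [mul_add, mul_sub, mul_smul_comm, ← mul_assoc, h.cc, one_mul, mul_one]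

theorem Thc (h : Pair ξ T c C) : (T + ξ • (c * C)) * c = C * (T - ξ • 1) := by
  have e : C * c = -(c * C) := by rw [h.anti, neg_neg]
  rw [add_mul, h.Tc, smul_mul_assoc, mul_assoc, e, mul_neg, ← mul_assoc, h.cc, one_mul, mul_sub,
    mul_smul_comm, mul_one, smul_neg]
  abel

/-- Over a pair, the upper `X` determines the lower one. -/
theorem lower_eq (h : Pair ξ T c C) {x X : R} (hx : (T + ξ • (c * C)) * x * T = X) :
    x = (T - ξ • 1 + ξ • (c * C)) * X * (T - ξ • 1) := by
  calc x = ((T - ξ • 1 + ξ • (c * C)) * (T + ξ • (c * C))) * x * (T * (T - ξ • 1)) := by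
        rw [h.Thi_Th, mul_inv h.quad, one_mul, mul_one]
    _ = _ := by rw [← hx]; simp only [mul_assoc]

theorem xT (h : Pair ξ T c C) {x X : R} (hx : (T + ξ • (c * C)) * x * T = X) :
    x * T = (T - ξ • 1 + ξ • (c * C)) * X := by
  rw [h.lower_eq hx, mul_assoc, inv_mul h.quad, mul_one]

end Pair

/-- Part of the relations of `H_N` (numbered from the top strand) that implies all of them:
the Hecke relations together with the ones that involve the two top strands. -/
structure MinRev (ξ : F) (N : ℕ) (T : ℕ → R) (C X Y : R) : Prop where
  XY : X * Y = 1
  YX : Y * X = 1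
  CC : C * C = 1
  CX : C * X = Y * C
  quad : ∀ i, i + 1 < N → T i * T i = ξ • T i + 1
  braid : ∀ i, i + 2 < N → T i * T (i + 1) * T i = T (i + 1) * T i * T (i + 1)
  far : ∀ i j, i + 1 < j → j + 1 < N → Commute (T i) (T j)
  TC : ∀ i, 0 < i → i + 1 < N → Commute (T i) C
  TX : ∀ i, 0 < i → i + 1 < N → Commute (T i) X
  two : 1 < N → ∃ c x : R, T 0 * c = C * T 0 ∧ (T 0 + ξ • (c * C)) * x * T 0 = X ∧
    c * C = -(C * c) ∧ Commute c X ∧ Commute x X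

end Relations

section Minimal

variable {F} {R : Type*} [Ring R] [Algebra F R] {ξ : F}

theorem commute_inv {T a : R} (h : Commute T a) : Commute (T - ξ • 1) a :=
  h.sub_left ((Commute.one_left a).smul_left ξ)

theorem commute_mul_of_anti {a b z : R} (ha : a * z = -(z * a)) (hb : b * z = -(z * b)) :
    Commute (a * b) z := by
  show a * b * z = z * (a * b)
  rw [mul_assoc, hb, mul_neg, ← mul_assoc, ha, neg_mul, neg_neg, mul_assoc]

theorem anti_symm {a b : R} (h : a * b = -(b * a)) : b * a = -(a * b) := by rw [h, neg_neg]

theorem anti_conj {T Ti c C : R} (h1 : Commute T C) (h2 : Commute Ti C)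
    (h : c * C = -(C * c)) : (Ti * c * T) * C = -(C * (Ti * c * T)) := by
  rw [mul_assoc, h1.eq, ← mul_assoc, mul_assoc Ti, h, mul_neg, neg_mul, ← mul_assoc, ← mul_assoc,
    ← mul_assoc, h2.eq]

/-- The two braid generators and a Clifford generator of the top strand of three. -/
structure Triple (ξ : F) (T S C : R) : Prop where
  quadT : T * T = ξ • T + 1
  quadS : S * S = ξ • S + 1
  braid : T * S * T = S * T * S
  SC : Commute S C

namespace Triple

variable {T S C c : R}

theorem braid_inv (h : Triple ξ T S C) :
    T * (S - ξ • 1) * (T - ξ • 1) = (S - ξ • 1) * (T - ξ • 1) * S := by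
  calc T * (S - ξ • 1) * (T - ξ • 1)
      = ((S - ξ • 1) * ((T - ξ • 1) * T) * S) * T * (S - ξ • 1) * (T - ξ • 1) := by
        rw [Pair.inv_mul h.quadT, mul_one, Pair.inv_mul h.quadS, one_mul]
    _ = (S - ξ • 1) * (T - ξ • 1) * (T * S * T) * (S - ξ • 1) * (T - ξ • 1) := by
        simp only [mul_assoc]
    _ = (S - ξ • 1) * (T - ξ • 1) * S * (T * (S * (S - ξ • 1)) * (T - ξ • 1)) := by
        rw [h.braid]; simp only [mul_assoc]
    _ = _ := by rw [Pair.mul_inv h.quadS, mul_one, Pair.mul_inv h.quadT, mul_one]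

theorem braid_inv' (h : Triple ξ T S C) :
    S * (T - ξ • 1) * (S - ξ • 1) = (T - ξ • 1) * (S - ξ • 1) * T := by
  calc S * (T - ξ • 1) * (S - ξ • 1)
      = ((T - ξ • 1) * ((S - ξ • 1) * S) * T) * S * (T - ξ • 1) * (S - ξ • 1) := by
        rw [Pair.inv_mul h.quadS, mul_one, Pair.inv_mul h.quadT, one_mul]
    _ = (T - ξ • 1) * (S - ξ • 1) * (S * T * S) * (T - ξ • 1) * (S - ξ • 1) := by
        simp only [mul_assoc]
    _ = (T - ξ • 1) * (S - ξ • 1) * T * (S * (T * (T - ξ • 1)) * (S - ξ • 1)) := by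
        rw [← h.braid]; simp only [mul_assoc]
    _ = _ := by rw [Pair.mul_inv h.quadT, mul_one, Pair.mul_inv h.quadS, mul_one]

theorem c_eq (h : Triple ξ T S C) (hc : T * c = C * T) : c = (T - ξ • 1) * C * T := by
  rw [mul_assoc, ← hc, ← mul_assoc, Pair.inv_mul h.quadT, one_mul]

/-- The Clifford generator of the third strand commutes with the first braid generator. -/
theorem commute_third (h : Triple ξ T S C) (hc : T * c = C * T) :
    Commute T ((S - ξ • 1) * c * S) := by
  rw [h.c_eq hc]
  show T * ((S - ξ • 1) * ((T - ξ • 1) * C * T) * S) = (S - ξ • 1) * ((T - ξ • 1) * C * T) * S * T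
  calc _ = (T * (S - ξ • 1) * (T - ξ • 1)) * C * (T * S) := by simp only [mul_assoc]
    _ = (S - ξ • 1) * (T - ξ • 1) * (S * C) * (T * S) := by
        rw [h.braid_inv]; simp only [mul_assoc]
    _ = (S - ξ • 1) * (T - ξ • 1) * C * (S * T * S) := by rw [h.SC.eq]; simp only [mul_assoc]
    _ = _ := by rw [← h.braid]; simp only [mul_assoc]

/-- Conjugation by `S * T` carries the first pair of strands to the second. -/
theorem anti_third (h : Triple ξ T S C) (hc : T * c = C * T) (anti : c * C = -(C * c)) :
    ((S - ξ • 1) * c * S) * c = -(c * ((S - ξ • 1) * c * S)) := by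
  set u := S * T with hu
  set v := (T - ξ • 1) * (S - ξ • 1) with hv
  have huv : u * v = 1 := by
    calc u * v = S * (T * (T - ξ • 1)) * (S - ξ • 1) := by simp only [hu, hv, mul_assoc]
      _ = 1 := by rw [Pair.mul_inv h.quadT, mul_one, Pair.mul_inv h.quadS]
  have h1 : c = v * C * u := by
    rw [h.c_eq hc]
    calc (T - ξ • 1) * C * T = (T - ξ • 1) * ((S - ξ • 1) * S) * C * T := by
          rw [Pair.inv_mul h.quadS, mul_one]
      _ = (T - ξ • 1) * (S - ξ • 1) * (S * C) * T := by simp only [mul_assoc]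
      _ = _ := by rw [h.SC.eq]; simp only [hu, hv, mul_assoc]
  have h2 : (S - ξ • 1) * c * S = v * c * u := by
    conv_lhs => rw [h1]
    conv_rhs => rw [h.c_eq hc]
    calc (S - ξ • 1) * (v * C * u) * S
        = ((S - ξ • 1) * (T - ξ • 1) * (S - ξ • 1)) * C * (S * T * S) := by
          simp only [hu, hv, mul_assoc]
      _ = ((T - ξ • 1) * (S - ξ • 1) * (T - ξ • 1)) * C * (T * S * T) := by
          rw [h.braid]
          congr 2
          calc (S - ξ • 1) * (T - ξ • 1) * (S - ξ • 1)
              = ((T - ξ • 1) * T) * (S - ξ • 1) * (T - ξ • 1) * (S - ξ • 1) := by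
                rw [Pair.inv_mul h.quadT, one_mul]
            _ = (T - ξ • 1) * (T * (S - ξ • 1) * (T - ξ • 1)) * (S - ξ • 1) := by
                simp only [mul_assoc]
            _ = (T - ξ • 1) * (S - ξ • 1) * (T - ξ • 1) * (S * (S - ξ • 1)) := by
                rw [h.braid_inv]; simp only [mul_assoc]
            _ = _ := by rw [Pair.mul_inv h.quadS, mul_one]
      _ = ((T - ξ • 1) * (S - ξ • 1) * (T - ξ • 1)) * C * (S * T * S) := by rw [h.braid]
      _ = _ := by rw [← h.braid]; simp only [hu, hv, mul_assoc]
  have h3 : ∀ a b : R, v * a * u * (v * b * u) = v * (a * b) * u := by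
    intro a b
    calc v * a * u * (v * b * u) = v * a * (u * v) * b * u := by simp only [mul_assoc]
      _ = _ := by rw [huv, mul_one]; simp only [mul_assoc]
  rw [h2]
  nth_rw 2 [h1]
  nth_rw 2 [h1]
  rw [h3, h3, anti, mul_neg, neg_mul]

/-- The mixed braid relation. -/
theorem mixed_braid (h : Triple ξ T S C) (hp : Pair ξ T c C) {b : R}
    (hbT : Commute T b) (hbS : b * (S - ξ • 1) = (S - ξ • 1) * c) :
    T * (S - ξ • 1 + ξ • (b * c)) * (T - ξ • 1 + ξ • (c * C)) =
      (S - ξ • 1 + ξ • (b * c)) * (T - ξ • 1 + ξ • (c * C)) * S := by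
  have e1 := h.braid_inv
  have e2 : T * (S - ξ • 1) * (c * C) = b * (T * S * C) - ξ • (b * (T * C)) := by
    calc T * (S - ξ • 1) * (c * C) = T * ((S - ξ • 1) * c) * C := by simp only [mul_assoc]
      _ = (T * b) * (S - ξ • 1) * C := by rw [← hbS]; simp only [mul_assoc]
      _ = b * (T * (S - ξ • 1) * C) := by rw [hbT.eq]; simp only [mul_assoc]
      _ = _ := by
        simp only [mul_sub, sub_mul, mul_smul_comm, smul_mul_assoc, mul_one]
  have e3 : T * (b * c) * (T - ξ • 1) = b * C := by
    calc T * (b * c) * (T - ξ • 1) = (T * b) * (c * (T - ξ • 1)) := by simp only [mul_assoc]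
      _ = b * (T * (T - ξ • 1)) * C := by rw [hbT.eq, hp.cTi]; simp only [mul_assoc]
      _ = _ := by rw [Pair.mul_inv h.quadT, mul_one]
  have e4 : T * (b * c) * (c * C) = b * (T * C) := by
    calc T * (b * c) * (c * C) = (T * b) * (c * c) * C := by simp only [mul_assoc]
      _ = _ := by rw [hp.cc, hbT.eq, mul_one, mul_assoc]
  have f2 : (S - ξ • 1) * (c * C) * S = b * C := by
    calc (S - ξ • 1) * (c * C) * S = ((S - ξ • 1) * c) * (C * S) := by simp only [mul_assoc]
      _ = b * ((S - ξ • 1) * S) * C := by rw [← hbS, ← h.SC.eq]; simp only [mul_assoc]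
      _ = _ := by rw [Pair.inv_mul h.quadS, mul_one]
  have f3 : (b * c) * (T - ξ • 1) * S = b * (T * S * C) - ξ • (b * (S * C)) := by
    calc (b * c) * (T - ξ • 1) * S = b * (c * (T - ξ • 1)) * S := by simp only [mul_assoc]
      _ = b * ((T - ξ • 1) * (C * S)) := by rw [hp.cTi]; simp only [mul_assoc]
      _ = _ := by
        rw [← h.SC.eq]
        simp only [mul_sub, sub_mul, mul_smul_comm, smul_mul_assoc, one_mul, mul_assoc]
  have f4 : (b * c) * (c * C) * S = b * (S * C) := by
    calc (b * c) * (c * C) * S = b * (c * c) * (C * S) := by simp only [mul_assoc]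
      _ = _ := by rw [hp.cc, mul_one, ← h.SC.eq]
  calc T * (S - ξ • 1 + ξ • (b * c)) * (T - ξ • 1 + ξ • (c * C))
      = T * (S - ξ • 1) * (T - ξ • 1) + ξ • (T * (S - ξ • 1) * (c * C))
        + ξ • (T * (b * c) * (T - ξ • 1)) + (ξ * ξ) • (T * (b * c) * (c * C)) := by
        simp only [mul_add, add_mul, mul_smul_comm, smul_mul_assoc, smul_add, smul_smul]
        abel
    _ = (S - ξ • 1) * (T - ξ • 1) * S + ξ • ((S - ξ • 1) * (c * C) * S)
        + ξ • ((b * c) * (T - ξ • 1) * S) + (ξ * ξ) • ((b * c) * (c * C) * S) := by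
        rw [e1, e2, e3, e4, f2, f3, f4]
        module
    _ = _ := by
        simp only [mul_add, add_mul, mul_smul_comm, smul_mul_assoc, smul_add, smul_smul]
        abel

end Triple

end Minimal

section MinimalToFull

variable {F} {R : Type*} [Ring R] [Algebra F R] {ξ : F}

/-- A pair of strands together with the generators `x` (lower) and `X` (upper), the relations
between `c` and `X` and between `x` and `X` included. -/
structure XPair (ξ : F) (T c C x X Y : R) : Prop extends Pair ξ T c C where
  XY : X * Y = 1
  YX : Y * X = 1
  CX : C * X = Y * C
  cross : (T + ξ • (c * C)) * x * T = X
  cX : Commute c X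
  xX : Commute x X

namespace XPair

variable {T c C x X Y : R}

theorem xy (h : XPair ξ T c C x X Y) : x * (T * Y * (T + ξ • (c * C))) = 1 := by
  rw [h.lower_eq h.cross]
  calc _ = (T - ξ • 1 + ξ • (c * C)) * (X * ((T - ξ • 1) * T) * Y) * (T + ξ • (c * C)) := by
        simp only [mul_assoc]
    _ = 1 := by rw [Pair.inv_mul h.quad, mul_one, h.XY, mul_one, h.Thi_Th]

theorem yx (h : XPair ξ T c C x X Y) : (T * Y * (T + ξ • (c * C))) * x = 1 := by
  rw [h.lower_eq h.cross]
  calc _ = T * (Y * ((T + ξ • (c * C)) * (T - ξ • 1 + ξ • (c * C))) * X) * (T - ξ • 1) := by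
        simp only [mul_assoc]
    _ = 1 := by rw [h.Th_Thi, mul_one, h.YX, mul_one, Pair.mul_inv h.quad]

theorem cx (h : XPair ξ T c C x X Y) : c * x = (T * Y * (T + ξ • (c * C))) * c := by
  calc c * x = (c * (T - ξ • 1 + ξ • (c * C))) * X * (T - ξ • 1) := by
        conv_lhs => rw [h.lower_eq h.cross]
        simp only [mul_assoc]
    _ = T * (C * X) * (T - ξ • 1) := by rw [h.cThi]; simp only [mul_assoc]
    _ = T * Y * (C * (T - ξ • 1)) := by rw [h.CX]; simp only [mul_assoc]
    _ = _ := by rw [← h.Thc]; simp only [mul_assoc]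

theorem Cx (h : XPair ξ T c C x X Y) : Commute C x := by
  have e := h.lower_eq h.cross
  calc C * x = (C * (T - ξ • 1 + ξ • (c * C))) * X * (T - ξ • 1) := by
        conv_lhs => rw [e]
        simp only [mul_assoc]
    _ = (T - ξ • 1 + ξ • (c * C)) * (c * X) * (T - ξ • 1) := by
        rw [h.CThi]; simp only [mul_assoc]
    _ = (T - ξ • 1 + ξ • (c * C)) * X * (c * (T - ξ • 1)) := by
        rw [h.cX.eq]; simp only [mul_assoc]
    _ = (T - ξ • 1 + ξ • (c * C)) * X * (T - ξ • 1) * C := by rw [h.cTi]; simp only [mul_assoc]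
    _ = x * C := by rw [← e]

theorem c_eq (h : XPair ξ T c C x X Y) : c = (T - ξ • 1) * C * T := by
  rw [mul_assoc, ← h.Tc, ← mul_assoc, Pair.inv_mul h.quad, one_mul]

theorem commute_c (h : XPair ξ T c C x X Y) {S : R} (h1 : Commute S T) (h2 : Commute S C) :
    Commute S c := by
  rw [h.c_eq]
  exact ((commute_inv h1.symm).symm.mul_right h2).mul_right h1

theorem commute_x (h : XPair ξ T c C x X Y) {S : R} (h1 : Commute S T) (h2 : Commute S X)
    (h3 : Commute S (c * C)) : Commute S x := by
  rw [h.lower_eq h.cross]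
  have hi := (commute_inv (ξ := ξ) h1.symm).symm
  exact ((hi.add_right (h3.smul_right ξ)).mul_right h2).mul_right hi

end XPair

theorem MinRev.xpair {N : ℕ} {T : ℕ → R} {C X Y : R} (h : MinRev ξ (N + 2) T C X Y) :
    ∃ c x, XPair ξ (T 0) c C x X Y := by
  obtain ⟨c, x, h1, h2, h3, h4, h5⟩ := h.two (by omega)
  exact ⟨c, x, ⟨⟨h.quad 0 (by omega), h1, h.CC, h3⟩, h.XY, h.YX, h.CX, h2, h4, h5⟩⟩

theorem MinRev.third {N : ℕ} {T : ℕ → R} {C X Y c x : R} (h : MinRev ξ (N + 3) T C X Y)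
    (hp : XPair ξ (T 0) c C x X Y) :
    ∃ b z, XPair ξ (T 1) b c z x (T 0 * Y * (T 0 + ξ • (c * C))) ∧ Commute (T 0) b ∧
      Commute (T 0) z := by
  have h3 : Triple ξ (T 0) (T 1) C :=
    ⟨h.quad 0 (by omega), h.quad 1 (by omega), h.braid 0 (by omega),
      h.TC 1 (by omega) (by omega)⟩
  have hi := Pair.mul_inv h3.quadS
  have hX1 : Commute (T 1) X := h.TX 1 (by omega) (by omega)
  set S := T 1 with hS
  set b := (S - ξ • 1) * c * S with hb
  have hSb : S * b = c * S := by
    rw [hb, ← mul_assoc, ← mul_assoc, hi, one_mul]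
  have hbS : b * (S - ξ • 1) = (S - ξ • 1) * c := by rw [hb, mul_assoc _ S, hi, mul_one]
  have hTb : Commute (T 0) b := h3.commute_third hp.Tc
  have hpair : Pair ξ S b c := ⟨h3.quadS, hSb, hp.cc, h3.anti_third hp.Tc hp.anti⟩
  have hbC : b * C = -(C * b) := anti_conj h3.SC (commute_inv h3.SC) hp.anti
  have hbX : Commute b X := ((commute_inv hX1).mul_left hp.cX).mul_left hX1
  have hbcC : Commute b (c * C) :=
    (commute_mul_of_anti (anti_symm hpair.anti) (anti_symm hbC)).symm
  have hbx : Commute b x := hp.commute_x hTb.symm hbX hbcC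
  set z := (S - ξ • 1 + ξ • (b * c)) * x * (S - ξ • 1) with hz
  have hTz : Commute (T 0) z := by
    have mb := h3.mixed_braid hp.toPair hTb hbS
    have e := hp.lower_eq hp.cross
    show T 0 * z = z * T 0
    rw [hz]
    conv_lhs => rw [e]
    conv_rhs => rw [e]
    calc T 0 * ((S - ξ • 1 + ξ • (b * c)) *
          ((T 0 - ξ • 1 + ξ • (c * C)) * X * (T 0 - ξ • 1)) * (S - ξ • 1))
        = (T 0 * (S - ξ • 1 + ξ • (b * c)) * (T 0 - ξ • 1 + ξ • (c * C))) * X *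
          ((T 0 - ξ • 1) * (S - ξ • 1)) := by simp only [mul_assoc]
      _ = (S - ξ • 1 + ξ • (b * c)) * (T 0 - ξ • 1 + ξ • (c * C)) * (S * X) *
          ((T 0 - ξ • 1) * (S - ξ • 1)) := by rw [mb]; simp only [mul_assoc]
      _ = (S - ξ • 1 + ξ • (b * c)) * (T 0 - ξ • 1 + ξ • (c * C)) * X *
          (S * (T 0 - ξ • 1) * (S - ξ • 1)) := by rw [hX1.eq]; simp only [mul_assoc]
      _ = _ := by rw [h3.braid_inv']; simp only [mul_assoc]
  have hcross : (S + ξ • (b * c)) * z * S = x := by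
    rw [hz]
    calc _ = ((S + ξ • (b * c)) * (S - ξ • 1 + ξ • (b * c))) * x * ((S - ξ • 1) * S) := by
          simp only [mul_assoc]
      _ = x := by rw [hpair.Th_Thi, Pair.inv_mul h3.quadS, one_mul, mul_one]
  have hthi : ∀ {w : R}, Commute S w → Commute (b * c) w → Commute x w → Commute z w := by
    intro w h1 h2 h3
    have h4 := commute_inv (ξ := ξ) h1
    exact ((h4.add_left (h2.smul_left ξ)).mul_left h3).mul_left h4
  have hzX : Commute z X := hthi hX1 (hbX.mul_left hp.cX) hp.xX
  have hzC : Commute z C := hthi h3.SC (commute_mul_of_anti hbC hp.anti) hp.Cx.symm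
  have hzc : Commute z c := hp.commute_c hTz.symm hzC
  exact ⟨b, z, ⟨hpair, hp.xy, hp.yx, hp.cx, hcross, hbx,
    hp.commute_x hTz.symm hzX (hzc.mul_right hzC)⟩, hTb, hTz⟩

theorem MinRev.shift {N : ℕ} {T : ℕ → R} {C X Y c x : R} (h : MinRev ξ (N + 2) T C X Y)
    (hp : XPair ξ (T 0) c C x X Y) :
    MinRev ξ (N + 1) (fun k => T (k + 1)) c x (T 0 * Y * (T 0 + ξ • (c * C))) where
  XY := hp.xy
  YX := hp.yx
  CC := hp.cc
  CX := hp.cx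
  quad i hi := h.quad _ (by omega)
  braid i hi := h.braid _ (by omega)
  far i j hij hj := h.far _ _ (by omega) (by omega)
  TC i h0 hi := hp.commute_c (h.far 0 _ (by omega) (by omega)).symm (h.TC _ (by omega) (by omega))
  TX i h0 hi := by
    have h1 := (h.far 0 (i + 1) (by omega) (by omega)).symm
    have h2 := h.TC (i + 1) (by omega) (by omega)
    exact hp.commute_x h1 (h.TX _ (by omega) (by omega)) ((hp.commute_c h1 h2).mul_right h2)
  two hN := by
    obtain ⟨M, rfl⟩ : ∃ M, N = M + 1 := ⟨N - 1, by omega⟩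
    obtain ⟨b, z, hbz, -, -⟩ := h.third hp
    exact ⟨b, z, hbz.Tc, hbz.cross, hbz.anti, hbz.cX, hbz.xX⟩

/-- The pair of neighbouring strands `k`, `k + 1`. -/
theorem Rev.xpair {N : ℕ} {T C X Y : ℕ → R} (h : Rev ξ N T C X Y) (k : ℕ) (hk : k + 1 < N) :
    XPair ξ (T k) (C (k + 1)) (C k) (X (k + 1)) (X k) (Y k) where
  quad := h.quad k hk
  Tc := h.TC k hk
  CC := h.CC k (by omega)
  anti := h.anti _ hk _ (by omega) (by omega)
  XY := h.XY k (by omega)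
  YX := h.YX k (by omega)
  CX := h.CX k (by omega)
  cross := h.cross k hk
  cX := h.CXo _ hk _ (by omega) (by omega)
  xX := h.XX _ hk _ (by omega)

theorem MinRev.exists_rev (N : ℕ) : ∀ {T : ℕ → R} {C X Y : R}, MinRev ξ (N + 1) T C X Y →
    ∃ C' X' Y' : ℕ → R, C' 0 = C ∧ X' 0 = X ∧ Y' 0 = Y ∧ Rev ξ (N + 1) T C' X' Y' := by
  induction N with
  | zero =>
    intro T C X Y h
    refine ⟨fun _ => C, fun _ => X, fun _ => Y, rfl, rfl, rfl, ?_⟩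
    constructor
    · intro i hi; exact h.XY
    · intro i hi; exact h.YX
    · intro i hi j hj; exact Commute.refl _
    · intro i hi; exact h.CC
    · intro i hi j hj hij; omega
    · intro i hi; exact h.CX
    all_goals intros; omega
  | succ N ih =>
    intro T C X Y h
    obtain ⟨c, x, hp⟩ := h.xpair
    obtain ⟨C', X', Y', hC, hX, hY, hr⟩ := ih (h.shift hp)
    have antiC : ∀ k < N + 1, C' k * C = -(C * C' k) := by
      intro k
      induction k with
      | zero => intro _; rw [hC]; exact hp.anti
      | succ k ihk =>
        intro hk
        have hS := h.TC (k + 1) (by omega) (by omega)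
        rw [(hr.xpair k hk).c_eq]
        exact anti_conj hS (commute_inv hS) (ihk (by omega))
    have comX : ∀ k < N + 1, Commute (C' k) X ∧ Commute (X' k) X ∧ Commute (X' k) C := by
      intro k
      induction k with
      | zero => intro _; rw [hC, hX]; exact ⟨hp.cX, hp.xX, hp.Cx.symm⟩
      | succ k ihk =>
        intro hk
        obtain ⟨i1, i2, i3⟩ := ihk (by omega)
        have hk' := hr.xpair k hk
        have hSX := (h.TX (k + 1) (by omega) (by omega)).symm
        have hSC := (h.TC (k + 1) (by omega) (by omega)).symm
        have j1 := hk'.commute_c hSX i1.symm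
        exact ⟨j1.symm, (hk'.commute_x hSX i2.symm (j1.mul_right i1.symm)).symm,
          (hk'.commute_x hSC i3.symm
            (commute_mul_of_anti (antiC _ hk) (antiC _ (by omega))).symm).symm⟩
    have comT : ∀ k, k + 1 < N + 1 → Commute (T 0) (C' (k + 1)) ∧ Commute (T 0) (X' (k + 1)) := by
      intro k
      induction k with
      | zero =>
        intro hk
        obtain ⟨M, rfl⟩ : ∃ M, N = M + 1 := ⟨N - 1, by omega⟩
        obtain ⟨b, z, hbz, hb, hz⟩ := h.third hp
        have h1 := hr.xpair 0 hk
        simp only [zero_add, hC, hX, hY] at h1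
        have eb : C' 1 = b := by rw [h1.c_eq, hbz.c_eq]
        have ez : X' 1 = z := by rw [h1.lower_eq h1.cross, hbz.lower_eq hbz.cross, eb]
        simp only [zero_add, eb, ez]
        exact ⟨hb, hz⟩
      | succ k ihk =>
        intro hk
        obtain ⟨i1, i2⟩ := ihk (by omega)
        have hk' := hr.xpair (k + 1) hk
        have hT : Commute (T 0) (T (k + 1 + 1)) := h.far _ _ (by omega) (by omega)
        have j1 := hk'.commute_c hT i1
        exact ⟨j1, hk'.commute_x hT i2 (j1.mul_right i1)⟩
    refine ⟨fun k => Nat.casesOn k C C', fun k => Nat.casesOn k X X',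
      fun k => Nat.casesOn k Y Y', rfl, rfl, rfl, ?_⟩
    constructor
    · rintro (_ | i) hi
      exacts [h.XY, hr.XY i (by omega)]
    · rintro (_ | i) hi
      exacts [h.YX, hr.YX i (by omega)]
    · rintro (_ | i) hi (_ | j) hj
      exacts [Commute.refl _, (comX j (by omega)).2.1.symm, (comX i (by omega)).2.1,
        hr.XX i (by omega) j (by omega)]
    · rintro (_ | i) hi
      exacts [h.CC, hr.CC i (by omega)]
    · rintro (_ | i) hi (_ | j) hj hij
      exacts [absurd rfl hij, anti_symm (antiC j (by omega)), antiC i (by omega),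
        hr.anti i (by omega) j (by omega) (by omega)]
    · rintro (_ | i) hi
      exacts [h.CX, hr.CX i (by omega)]
    · rintro (_ | i) hi (_ | j) hj hij
      exacts [absurd rfl hij, (comX j (by omega)).2.2.symm, (comX i (by omega)).1,
        hr.CXo i (by omega) j (by omega) (by omega)]
    · exact h.quad
    · exact h.braid
    · exact h.far
    · rintro (_ | i) hi
      · show T 0 * C' 0 = C * T 0
        rw [hC]; exact hp.Tc
      · exact hr.TC i (by omega)
    · rintro (_ | i) hi (_ | j) hj h1 h2
      · omega
      · obtain ⟨l, rfl⟩ : ∃ l, j = l + 1 := ⟨j - 1, by omega⟩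
        exact (comT l (by omega)).1
      · exact h.TC _ (by omega) (by omega)
      · exact hr.TCo i (by omega) j (by omega) (by omega) (by omega)
    · rintro (_ | i) hi (_ | j) hj h1 h2
      · omega
      · obtain ⟨l, rfl⟩ : ∃ l, j = l + 1 := ⟨j - 1, by omega⟩
        exact (comT l (by omega)).2
      · exact h.TX _ (by omega) (by omega)
      · exact hr.TXo i (by omega) j (by omega) (by omega) (by omega)
    · rintro (_ | i) hi
      · show (T 0 + ξ • (C' 0 * C)) * X' 0 * T 0 = X
        rw [hC, hX]; exact hp.cross
      · exact hr.cross i (by omega)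

end MinimalToFull

section Coefficients

variable {F} {R : Type*} [Ring R] [Algebra F R] {ξ : F}

/-- A family satisfying the relations of `H_n` together with an additional commuting copy
of `H_1`, generated by `CV` and `XV`. -/
structure Coeff (ξ : F) (n : ℕ) (t c x y : ℕ → R) (CV XV XVi : R) : Prop where
  rev : Rev ξ n t c x y
  CC : CV * CV = 1
  XXi : XV * XVi = 1
  XiX : XVi * XV = 1
  CX : CV * XV = XVi * CV
  tC : ∀ k, k + 1 < n → Commute (t k) CV
  cC : ∀ k < n, c k * CV = -(CV * c k)
  xC : ∀ k < n, Commute (x k) CV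
  tX : ∀ k, k + 1 < n → Commute (t k) XV
  cX : ∀ k < n, Commute (c k) XV
  xX : ∀ k < n, Commute (x k) XV

/-- The descending product `t (k - 1) * ⋯ * t 0`. -/
def tau (t : ℕ → R) : ℕ → R
  | 0 => 1
  | k + 1 => t k * tau t k

/-- The descending product `t k * ⋯ * t 1`. -/
def tau' (t : ℕ → R) (k : ℕ) : R := tau (fun i => t (i + 1)) k

theorem tau_succ (t : ℕ → R) (k : ℕ) : tau t (k + 1) = t k * tau t k := rfl

theorem tau_commute {t : ℕ → R} {a : R} {k : ℕ} (h : ∀ i < k, Commute a (t i)) :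
    Commute a (tau t k) := by
  induction k with
  | zero => exact Commute.one_right a
  | succ k ih => exact (h k (by omega)).mul_right (ih fun i hi => h i (by omega))

theorem tau_succ' (t : ℕ → R) (k : ℕ) : tau t (k + 1) = tau' t k * t 0 := by
  induction k with
  | zero => simp [tau, tau']
  | succ k ih => rw [tau_succ, ih, tau', tau', tau_succ, mul_assoc]

theorem reassoc {a b w : R} (h : a * b = w) (z : R) : a * (b * z) = w * z := by
  rw [← mul_assoc, h]

theorem tau_braid {n : ℕ} {t c x y : ℕ → R} (h : Rev ξ n t c x y) {i m : ℕ} (hi : i + 1 < m)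
    (hm : m < n) : t i * tau t m = tau t m * t (i + 1) := by
  induction m with
  | zero => omega
  | succ m ih =>
    rcases Nat.lt_or_ge (i + 1) m with h1 | h1
    · rw [tau_succ, ← mul_assoc, (h.far i m h1 (by omega)).eq, mul_assoc, ih h1 (by omega),
        mul_assoc]
    · obtain rfl : m = i + 1 := by omega
      rw [tau_succ, tau_succ, ← mul_assoc, ← mul_assoc, h.braid i (by omega)]
      simp only [mul_assoc]
      congr 2
      exact (tau_commute fun j hj => (h.far j (i + 1) (by omega) (by omega)).symm).eq

theorem c_tau {n : ℕ} {t c x y : ℕ → R} (h : Rev ξ n t c x y) {m : ℕ} (hm : m + 1 < n) :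
    c 0 * tau t (m + 1) = tau t (m + 1) * c 1 := by
  induction m with
  | zero => simp [tau, h.TC 0 (by omega)]
  | succ m ih =>
    rw [tau_succ, ← mul_assoc, ← (h.TCo (m + 1) (by omega) 0 (by omega) (by omega) (by omega)).eq,
      mul_assoc, ih (by omega), mul_assoc]

namespace Coeff

variable {n : ℕ} {t c x y : ℕ → R} {CV XV XVi : R}

theorem C_c (h : Coeff ξ n t c x y CV XV XVi) {k : ℕ} (hk : k < n) :
    CV * c k = -(c k * CV) := anti_symm (h.cC k hk)

theorem _root_.HC.Rev.xc (h : Rev ξ n t c x y) {k : ℕ} (hk : k < n) : x k * c k = c k * y k := by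
  have e := h.CX k hk
  calc x k * c k = x k * (c k * x k) * y k := by simp only [mul_assoc, h.XY k hk, mul_one]
    _ = (x k * y k) * c k * y k := by rw [e]; simp only [mul_assoc]
    _ = _ := by rw [h.XY k hk, one_mul]

theorem _root_.HC.Rev.xcx (h : Rev ξ n t c x y) {k : ℕ} (hk : k < n) :
    x k * (c k * x k) = c k := by
  rw [h.CX k hk, ← mul_assoc, h.XY k hk, one_mul]

/-- The coefficient of the correction term in the action of the top `X`. -/
def Yc (_ : Coeff ξ n t c x y CV XV XVi) : R := XV + c 0 * x 0 * CV

theorem commute_Yc (h : Coeff ξ n t c x y CV XV XVi) (hn : 0 < n) {a : R} (h1 : Commute a XV)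
    (h2 : Commute a (x 0)) (h3 : Commute a (c 0 * CV)) : Commute a h.Yc := by
  refine h1.add_right ?_
  have : c 0 * x 0 * CV = c 0 * CV * x 0 := by
    rw [mul_assoc, (h.xC 0 hn).eq, mul_assoc]
  rw [this]
  exact h3.mul_right h2

theorem Yc_inv (h : Coeff ξ n t c x y CV XV XVi) (hn : 0 < n) :
    h.Yc * c 0 * (x 0 * c 0) + XV * CV * (h.Yc * c 0) = 0 := by
  have h1 : c 0 * (x 0 * c 0) = y 0 := by
    rw [h.rev.xc hn, ← mul_assoc, h.rev.CC 0 hn, one_mul]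
  have h2 : CV * y 0 = y 0 * CV := by
    rw [← h1, ← mul_assoc, h.C_c hn, neg_mul, mul_assoc, ← mul_assoc CV, ← (h.xC 0 hn).eq,
      mul_assoc, h.C_c hn]
    simp only [mul_neg, neg_neg, mul_assoc]
  have h3 : XV * CV * XV = CV := by rw [mul_assoc, h.CX, ← mul_assoc, h.XXi, one_mul]
  have h4 : CV * c 0 * x 0 * CV * c 0 = -y 0 := by
    rw [h.C_c hn, ← h1]
    simp only [neg_mul, mul_assoc, reassoc (h.xC 0 hn).eq.symm, reassoc h.CC, one_mul]
  calc _ = XV * (c 0 * (x 0 * c 0)) + c 0 * x 0 * (CV * (c 0 * (x 0 * c 0)))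
        + (XV * CV * XV * c 0 + XV * (CV * c 0 * x 0 * CV * c 0)) := by
        simp only [Yc]; noncomm_ring
    _ = 0 := by
        rw [h3, h4, h1, h2, h.C_c hn]
        simp only [mul_assoc, reassoc (h.rev.XY 0 hn), one_mul]
        noncomm_ring

end Coeff
end Coefficients

section Model

variable {F} {V : Type*} [AddCommGroup V] [Module F V] {ξ : F} {n : ℕ}

/-- The inclusion of the `m`-th summand, zero if `m` is out of range. -/
noncomputable def eps (F : Type) [Field F] (V : Type*) [AddCommGroup V] [Module F V] (n m : ℕ) :
    V →ₗ[F] (Fin (n + 1) → V) :=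
  if h : m < n + 1 then LinearMap.single F (fun _ => V) ⟨m, h⟩ else 0

/-- The inclusion of the `m`-th summand, preceded by an operator on `V`. -/
noncomputable def emb (n m : ℕ) (r : Module.End F V) : V →ₗ[F] (Fin (n + 1) → V) :=
  eps F V n m ∘ₗ r

/-- The operator given by prescribed columns. -/
noncomputable def colOp (n : ℕ) (g : ℕ → V →ₗ[F] (Fin (n + 1) → V)) :
    Module.End F (Fin (n + 1) → V) :=
  ∑ m : Fin (n + 1), g m ∘ₗ LinearMap.proj m

theorem emb_add (m : ℕ) (r s : Module.End F V) : emb n m (r + s) = emb n m r + emb n m s :=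
  LinearMap.comp_add _ _ _

theorem emb_sub (m : ℕ) (r s : Module.End F V) : emb n m (r - s) = emb n m r - emb n m s :=
  LinearMap.comp_sub _ _ _

theorem emb_neg (m : ℕ) (r : Module.End F V) : emb n m (-r) = -emb n m r :=
  LinearMap.comp_neg _ _

theorem emb_smul (m : ℕ) (a : F) (r : Module.End F V) : emb n m (a • r) = a • emb n m r :=
  LinearMap.comp_smul _ _ _

theorem emb_zero (m : ℕ) : emb n m (0 : Module.End F V) = 0 := LinearMap.comp_zero _

theorem colOp_smul_emb (g : ℕ → V →ₗ[F] (Fin (n + 1) → V)) {m : ℕ} (hm : m ≤ n)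
    (r : Module.End F V) : colOp n g • emb n m r = g m ∘ₗ r := by
  ext v : 1
  have hm' : m < n + 1 := by omega
  change colOp n g (eps F V n m (r v)) = g m (r v)
  simp only [colOp, eps, hm', dite_true, LinearMap.sum_apply, LinearMap.comp_apply,
    LinearMap.proj_apply, LinearMap.single_apply]
  rw [Finset.sum_eq_single (⟨m, hm'⟩ : Fin (n + 1))]
  · simp
  · intro b _ hb
    simp [hb]
  · simp

theorem op_ext {A B : Module.End F (Fin (n + 1) → V)}
    (h : ∀ m ≤ n, A • emb n m 1 = B • emb n m (1 : Module.End F V)) : A = B := by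
  refine LinearMap.pi_ext fun i v => ?_
  have h1 := LinearMap.congr_fun (h i (by omega)) v
  have h2 : eps F V n i v = Pi.single i v := by rw [eps, dif_pos i.2]; rfl
  change A (eps F V n i v) = B (eps F V n i v) at h1
  rwa [h2] at h1

/-- The action of `T k` on the model. -/
noncomputable def opT (ξ : F) (n : ℕ) (t : ℕ → Module.End F V) (k : ℕ) :
    Module.End F (Fin (n + 1) → V) :=
  colOp n fun m => if m < k then emb n m (t (k - 1)) else if m = k then emb n (k + 1) 1
    else if m = k + 1 then ξ • emb n (k + 1) 1 + emb n k 1 else emb n m (t k)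

/-- The action of the top odd generator on the model. -/
noncomputable def opC (n : ℕ) (c : ℕ → Module.End F V) (CV : Module.End F V) :
    Module.End F (Fin (n + 1) → V) :=
  colOp n fun m => if m = 0 then emb n 0 CV else emb n m (c 0)

/-- The action of the top even generator on the model. -/
noncomputable def opX (ξ : F) (n : ℕ) (t x : ℕ → Module.End F V) (XV Z : Module.End F V) :
    Module.End F (Fin (n + 1) → V) :=
  colOp n fun m => if m = 0 then emb n 0 XV else emb n m (x 0) + ξ • emb n 0 (tau t (m - 1) * Z)

section Columns

variable (t c x : ℕ → Module.End F V) (CV XV Z r : Module.End F V)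

theorem opT_lt {k m : ℕ} (h : m < k) (hk : k ≤ n) :
    opT ξ n t k • emb n m r = emb n m (t (k - 1) * r) := by
  rw [opT, colOp_smul_emb _ (by omega), if_pos h]; rfl

theorem opT_eq {k : ℕ} (hk : k ≤ n) : opT ξ n t k • emb n k r = emb n (k + 1) r := by
  rw [opT, colOp_smul_emb _ (by omega), if_neg (by omega), if_pos rfl]; rfl

theorem opT_succ {k : ℕ} (hk : k + 1 ≤ n) :
    opT ξ n t k • emb n (k + 1) r = ξ • emb n (k + 1) r + emb n k r := by
  rw [opT, colOp_smul_emb _ (by omega), if_neg (by omega), if_neg (by omega), if_pos rfl]; rfl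

theorem opT_gt {k m : ℕ} (h : k + 1 < m) (hm : m ≤ n) :
    opT ξ n t k • emb n m r = emb n m (t k * r) := by
  rw [opT, colOp_smul_emb _ hm, if_neg (by omega), if_neg (by omega), if_neg (by omega)]; rfl

theorem opC_zero : opC n c CV • emb n 0 r = emb n 0 (CV * r) := by
  rw [opC, colOp_smul_emb _ (by omega), if_pos rfl]; rfl

theorem opC_succ {m : ℕ} (hm : m + 1 ≤ n) :
    opC n c CV • emb n (m + 1) r = emb n (m + 1) (c 0 * r) := by
  rw [opC, colOp_smul_emb _ (by omega), if_neg (by omega)]; rfl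

theorem opX_zero : opX ξ n t x XV Z • emb n 0 r = emb n 0 (XV * r) := by
  rw [opX, colOp_smul_emb _ (by omega), if_pos rfl]; rfl

theorem opX_succ {m : ℕ} (hm : m + 1 ≤ n) : opX ξ n t x XV Z • emb n (m + 1) r =
    emb n (m + 1) (x 0 * r) + ξ • emb n 0 (tau t m * Z * r) := by
  rw [opX, colOp_smul_emb _ (by omega), if_neg (by omega)]; rfl

end Columns

end Model

section ModelRelations

variable {F} {V : Type*} [AddCommGroup V] [Module F V] {ξ : F} {n : ℕ}
  {t c x y : ℕ → Module.End F V} {CV XV XVi : Module.End F V}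

theorem opT_quad (h : Rev ξ n t c x y) {k : ℕ} (hk : k < n) :
    opT ξ n t k * opT ξ n t k = ξ • opT ξ n t k + 1 := by
  refine op_ext fun m hm => ?_
  rw [mul_smul, add_smul, smul_assoc, one_smul]
  rcases lt_trichotomy m k with h1 | rfl | h1
  · obtain ⟨k, rfl⟩ : ∃ j, k = j + 1 := ⟨k - 1, by omega⟩
    simp (disch := omega) only [opT_lt, Nat.add_sub_cancel, mul_one]
    rw [h.quad k (by omega), emb_add, emb_smul]
  · simp (disch := omega) only [opT_eq, opT_succ]
  · rcases eq_or_lt_of_le (Nat.succ_le_of_lt h1) with rfl | h1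
    · simp (disch := omega) only [opT_succ, smul_add, smul_comm (opT ξ n t k) ξ, opT_eq]
    · simp (disch := omega) only [opT_gt, mul_one]
      rw [h.quad k (by omega), emb_add, emb_smul]

theorem opT_far (h : Rev ξ n t c x y) {i j : ℕ} (hij : i + 1 < j) (hj : j < n) :
    Commute (opT ξ n t i) (opT ξ n t j) := by
  refine op_ext fun m hm => ?_
  rw [mul_smul, mul_smul]
  obtain ⟨j, rfl⟩ : ∃ k, j = k + 1 := ⟨j - 1, by omega⟩
  have hs := fun v : V →ₗ[F] (Fin (n + 1) → V) => smul_comm (opT ξ n t i) ξ v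
  have hs' := fun v : V →ₗ[F] (Fin (n + 1) → V) => smul_comm (opT ξ n t (j + 1)) ξ v
  have hc : ∀ i' j', i' + 1 < j' → j' + 1 < n → t i' * t j' = t j' * t i' :=
    fun i' j' h1 h2 => (h.far i' j' h1 h2).eq
  rcases lt_trichotomy m i with h1 | rfl | h1
  · obtain ⟨i, rfl⟩ : ∃ k, i = k + 1 := ⟨i - 1, by omega⟩
    simp (disch := omega) only [opT_lt, Nat.add_sub_cancel, mul_one]
    rw [hc _ _ (by omega) (by omega)]
  · simp (disch := omega) only [opT_lt, opT_eq, Nat.add_sub_cancel, mul_one]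
  rcases eq_or_lt_of_le (Nat.succ_le_of_lt h1) with rfl | h1
  · simp (disch := omega) only [Nat.succ_eq_add_one, opT_lt, opT_succ, Nat.add_sub_cancel,
      mul_one, smul_add, hs']
  rcases lt_trichotomy m (j + 1) with h2 | rfl | h2
  · have h1' : i + 1 < m := h1
    simp (disch := omega) only [opT_lt, opT_gt, Nat.add_sub_cancel, mul_one]
    rw [hc _ _ (by omega) (by omega)]
  · simp (disch := omega) only [opT_eq, opT_gt]
  rcases eq_or_lt_of_le (Nat.succ_le_of_lt h2) with rfl | h2
  · simp (disch := omega) only [Nat.succ_eq_add_one, opT_gt, opT_succ, mul_one, smul_add, hs]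
  · simp (disch := omega) only [opT_gt, mul_one]
    rw [hc _ _ (by omega) (by omega)]

theorem opT_braid (h : Rev ξ n t c x y) {k : ℕ} (hk : k + 1 < n) :
    opT ξ n t k * opT ξ n t (k + 1) * opT ξ n t k =
      opT ξ n t (k + 1) * opT ξ n t k * opT ξ n t (k + 1) := by
  refine op_ext fun m hm => ?_
  simp only [mul_smul]
  have hs := fun v : V →ₗ[F] (Fin (n + 1) → V) => smul_comm (opT ξ n t k) ξ v
  have hs' := fun v : V →ₗ[F] (Fin (n + 1) → V) => smul_comm (opT ξ n t (k + 1)) ξ v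
  have hb : ∀ i, i + 2 < n → t i * (t (i + 1) * t i) = t (i + 1) * (t i * t (i + 1)) :=
    fun i hi => by simpa only [mul_assoc] using h.braid i hi
  rcases lt_trichotomy m k with h1 | rfl | h1
  · obtain ⟨k, rfl⟩ : ∃ j, k = j + 1 := ⟨k - 1, by omega⟩
    simp (disch := omega) only [opT_lt, Nat.add_sub_cancel, mul_one]
    rw [hb _ (by omega)]
  · simp (disch := omega) only [opT_lt, opT_eq, opT_gt, Nat.add_sub_cancel]
  rcases eq_or_lt_of_le (Nat.succ_le_of_lt h1) with rfl | h1
  · simp (disch := omega) only [Nat.succ_eq_add_one, opT_lt, opT_eq, opT_gt, opT_succ,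
      Nat.add_sub_cancel, smul_add, hs, hs']
  rcases eq_or_lt_of_le (Nat.succ_le_of_lt h1) with rfl | h1
  · simp (disch := omega) only [Nat.succ_eq_add_one, opT_lt, opT_eq, opT_gt, opT_succ,
      Nat.add_sub_cancel, smul_add, hs, hs']
    simp only [mul_one, h.quad k (by omega), emb_add, emb_smul, smul_add]
    abel
  · simp (disch := omega) only [opT_gt, mul_one]
    rw [hb _ (by omega)]

end ModelRelations

section ModelTop

variable {F} {V : Type*} [AddCommGroup V] [Module F V] {ξ : F} {n : ℕ}
  {t c x y : ℕ → Module.End F V} {CV XV XVi : Module.End F V}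

theorem opC_sq (h : Coeff ξ n t c x y CV XV XVi) : opC n c CV * opC n c CV = 1 := by
  refine op_ext fun m hm => ?_
  rw [mul_smul, one_smul]
  rcases m with _ | m
  · simp only [opC_zero, mul_one, h.CC]
  · simp (disch := omega) only [opC_succ, mul_one, h.rev.CC]

theorem tau_commute_of {a : Module.End F V} {m : ℕ} (hm : m < n)
    (ha : ∀ k, k + 1 < n → Commute (t k) a) : Commute a (tau t m) :=
  tau_commute fun i hi => (ha i (by omega)).symm

theorem opXC_sq (h : Coeff ξ n t c x y CV XV XVi) :
    opX ξ n t x XV h.Yc * opC n c CV * (opX ξ n t x XV h.Yc * opC n c CV) = 1 := by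
  refine op_ext fun m hm => ?_
  simp only [mul_smul, one_smul]
  rcases m with _ | m
  · simp only [opC_zero, opX_zero, mul_one]
    rw [reassoc h.CX, mul_assoc, h.CC, mul_one, h.XXi]
  · simp (disch := omega) only [opC_succ, opC_zero, opX_succ, opX_zero, smul_add, mul_one,
      smul_comm (opX ξ n t x XV h.Yc) ξ, smul_comm (opC n c CV) ξ]
    have h0 : 0 < n := by omega
    have h1 : x 0 * (c 0 * (x 0 * c 0)) = 1 := by
      rw [← mul_assoc (c 0), reassoc (h.rev.xcx h0), h.rev.CC 0 h0]
    have h2 : XV * (CV * (tau t m * h.Yc * c 0)) = tau t m * (XV * CV * (h.Yc * c 0)) := by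
      have e := (tau_commute_of (show m < n by omega) h.tC)
      have e' := (tau_commute_of (show m < n by omega) h.tX)
      rw [mul_assoc, reassoc e.eq, mul_assoc, reassoc e'.eq]
      simp only [mul_assoc]
    have h3 := congrArg (fun z => emb n 0 (tau t m * z)) (h.Yc_inv h0)
    simp only [mul_add, emb_add, mul_zero, emb_zero] at h3
    rw [h1, h2, add_assoc, ← smul_add, mul_assoc (tau t m), ← mul_assoc h.Yc, h3, smul_zero,
      add_zero]

theorem opT_commute_opC (h : Coeff ξ n t c x y CV XV XVi) {k : ℕ} (h0 : 0 < k) (hk : k < n) :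
    Commute (opT ξ n t k) (opC n c CV) := by
  refine op_ext fun m hm => ?_
  simp only [mul_smul]
  have hs := fun v : V →ₗ[F] (Fin (n + 1) → V) => smul_comm (opC n c CV) ξ v
  obtain ⟨k, rfl⟩ : ∃ j, k = j + 1 := ⟨k - 1, by omega⟩
  rcases m with _ | m
  · simp (disch := omega) only [opC_zero, opT_lt, mul_one, Nat.add_sub_cancel]
    rw [(h.tC k (by omega)).eq]
  rcases lt_trichotomy m k with h1 | rfl | h1
  · simp (disch := omega) only [opC_succ, opT_lt, mul_one, Nat.add_sub_cancel]
    rw [(h.rev.TCo k (by omega) 0 (by omega) (by omega) (by omega)).eq]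
  · simp (disch := omega) only [opC_succ, opT_eq]
  rcases eq_or_lt_of_le (Nat.succ_le_of_lt h1) with rfl | h1
  · simp (disch := omega) only [Nat.succ_eq_add_one, opC_succ, opT_succ, smul_add, hs]
  · simp (disch := omega) only [opC_succ, opT_gt, mul_one]
    rw [(h.rev.TCo (k + 1) (by omega) 0 (by omega) (by omega) (by omega)).eq]

theorem t_commute_Yc (h : Coeff ξ n t c x y CV XV XVi) {k : ℕ} (h0 : 0 < k) (hk : k + 1 < n) :
    Commute (t k) h.Yc :=
  h.commute_Yc (by omega) (h.tX k hk)
    (h.rev.TXo k hk 0 (by omega) (by omega) (by omega))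
    ((h.rev.TCo k hk 0 (by omega) (by omega) (by omega)).mul_right (h.tC k hk))

theorem opT_commute_opX (h : Coeff ξ n t c x y CV XV XVi) {k : ℕ} (h0 : 0 < k) (hk : k < n) :
    Commute (opT ξ n t k) (opX ξ n t x XV h.Yc) := by
  refine op_ext fun m hm => ?_
  simp only [mul_smul]
  have hs := fun v : V →ₗ[F] (Fin (n + 1) → V) => smul_comm (opX ξ n t x XV h.Yc) ξ v
  have hs' := fun v : V →ₗ[F] (Fin (n + 1) → V) => smul_comm (opT ξ n t k) ξ v
  obtain ⟨k, rfl⟩ : ∃ j, k = j + 1 := ⟨k - 1, by omega⟩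
  rcases m with _ | m
  · simp (disch := omega) only [opX_zero, opT_lt, mul_one, Nat.add_sub_cancel]
    rw [(h.tX k (by omega)).eq]
  rcases lt_trichotomy m k with h1 | rfl | h1
  · simp (disch := omega) only [opX_succ, opT_lt, mul_one, Nat.add_sub_cancel, smul_add, hs']
    have e : Commute (t k) (tau t m) :=
      tau_commute fun i hi => (h.rev.far i k (by omega) (by omega)).symm
    rw [(h.rev.TXo k (by omega) 0 (by omega) (by omega) (by omega)).eq,
      reassoc e.eq, mul_assoc, (t_commute_Yc h (by omega) (by omega)).eq, mul_assoc]
  · simp (disch := omega) only [opX_succ, opT_eq, opT_lt, smul_add, hs', Nat.add_sub_cancel,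
      tau_succ, mul_assoc]
  rcases eq_or_lt_of_le (Nat.succ_le_of_lt h1) with rfl | h1
  · simp (disch := omega) only [Nat.succ_eq_add_one, opX_succ, opT_succ, smul_add, hs', hs, opT_lt,
      Nat.add_sub_cancel, tau_succ, mul_assoc]
    rw [reassoc (h.rev.quad k (by omega))]
    simp only [add_mul, smul_mul_assoc, one_mul, emb_add, emb_smul, smul_add]
    abel
  · have h1' : k + 1 < m := h1
    simp (disch := omega) only [opX_succ, opT_gt, opT_lt, mul_one, Nat.add_sub_cancel, smul_add,
      hs']
    rw [(h.rev.TXo (k + 1) (by omega) 0 (by omega) (by omega) (by omega)).eq,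
      reassoc (tau_braid h.rev h1' (by omega)), mul_assoc,
      (t_commute_Yc h (by omega) (by omega)).eq, mul_assoc]

end ModelTop

section ModelSecond

variable {F} {V : Type*} [AddCommGroup V] [Module F V] {ξ : F} {n : ℕ}
  {t c x y : ℕ → Module.End F V} {CV XV XVi : Module.End F V}

/-- The odd generator of the second strand of the model. -/
noncomputable def opc (ξ : F) (n : ℕ) (t c : ℕ → Module.End F V) (CV : Module.End F V) :
    Module.End F (Fin (n + 1) → V) :=
  (opT ξ n t 0 - ξ • 1) * opC n c CV * opT ξ n t 0

theorem op_sub_smul (A B : Module.End F (Fin (n + 1) → V)) (v : V →ₗ[F] (Fin (n + 1) → V)) :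
    (A - B) • v = A • v - B • v := rfl

theorem op_neg_smul (A : Module.End F (Fin (n + 1) → V)) (v : V →ₗ[F] (Fin (n + 1) → V)) :
    (-A) • v = -(A • v) := rfl

theorem opTi_succ {k : ℕ} (hk : k + 1 ≤ n) (r : Module.End F V) :
    (opT ξ n t k - ξ • 1) • emb n (k + 1) r = emb n k r := by
  rw [op_sub_smul, opT_succ _ _ hk, smul_assoc, one_smul]; abel

theorem opTi_eq {k : ℕ} (hk : k ≤ n) (r : Module.End F V) :
    (opT ξ n t k - ξ • 1) • emb n k r = emb n (k + 1) r - ξ • emb n k r := by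
  rw [op_sub_smul, opT_eq _ _ hk, smul_assoc, one_smul]

theorem opTi_gt {k m : ℕ} (h : k + 1 < m) (hm : m ≤ n) (r : Module.End F V) :
    (opT ξ n t k - ξ • 1) • emb n m r = emb n m ((t k - ξ • 1) * r) := by
  rw [op_sub_smul, opT_gt _ _ h hm, smul_assoc, one_smul, sub_mul, emb_sub, smul_mul_assoc, one_mul,
    emb_smul]

theorem opc_zero (hn : 0 < n) (r : Module.End F V) :
    opc ξ n t c CV • emb n 0 r = emb n 0 (c 0 * r) := by
  simp (disch := omega) only [opc, mul_smul, opT_eq, opC_succ, opTi_succ]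

theorem opc_one (hn : 0 < n) (r : Module.End F V) :
    opc ξ n t c CV • emb n 1 r =
      emb n 1 (CV * r) + ξ • emb n 0 (c 0 * r) - ξ • emb n 0 (CV * r) := by
  simp only [opc, mul_smul]
  rw [opT_succ (k := 0) _ _ hn, smul_add, smul_comm, opC_succ (m := 0) _ _ _ hn, opC_zero, smul_add,
    smul_comm, opTi_succ (k := 0) hn, opTi_eq (by omega)]
  abel

theorem opc_gt (h : Rev ξ n t c x y) {m : ℕ} (hm : m + 2 ≤ n) (r : Module.End F V) :
    opc ξ n t c CV • emb n (m + 2) r = emb n (m + 2) (c 1 * r) := by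
  simp (disch := omega) only [opc, mul_smul, opT_gt, opC_succ, opTi_gt]
  rw [(h.xpair 0 (by omega)).c_eq]
  simp only [mul_assoc]

theorem opc_pair (h : Coeff ξ n t c x y CV XV XVi) (hn : 0 < n) :
    Pair ξ (opT ξ n t 0) (opc ξ n t c CV) (opC n c CV) where
  quad := opT_quad h.rev hn
  Tc := by
    rw [opc, mul_assoc (_ - _), ← mul_assoc, Pair.mul_inv (opT_quad h.rev hn), one_mul]
  CC := opC_sq h
  anti := by
    refine op_ext fun m hm => ?_
    rw [op_neg_smul, mul_smul, mul_smul]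
    rcases m with _ | _ | m
    · simp only [opC_zero, opc_zero hn, h.cC 0 hn, ← mul_assoc, emb_neg, neg_mul]
    · simp (disch := omega) only [zero_add, opc_one, opC_succ (m := 0), smul_add, smul_sub, smul_comm (opC n c CV) ξ,
        opC_zero, mul_one, h.CC, h.rev.CC, h.C_c hn, emb_neg]
      simp only [smul_neg]
      abel
    · simp (disch := omega) only [opc_gt h.rev, opC_succ, mul_one]
      rw [h.rev.anti 1 (by omega) 0 hn (by omega), emb_neg]

theorem opc_commute_opX (h : Coeff ξ n t c x y CV XV XVi) (hn : 0 < n) :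
    Commute (opc ξ n t c CV) (opX ξ n t x XV h.Yc) := by
  refine op_ext fun m hm => ?_
  rw [mul_smul, mul_smul]
  have hs := fun v : V →ₗ[F] (Fin (n + 1) → V) => smul_comm (opX ξ n t x XV h.Yc) ξ v
  have hs' := fun v : V →ₗ[F] (Fin (n + 1) → V) => smul_comm (opc ξ n t c CV) ξ v
  rcases m with _ | _ | m
  · simp only [opX_zero, opc_zero hn, mul_one, (h.cX 0 hn).eq]
  · simp (disch := omega) only [zero_add, opc_one, opc_zero, opX_succ (m := 0), opX_zero, smul_add,
      smul_sub, hs, hs', mul_one, tau, one_mul]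
    rw [(h.xC 0 hn).eq]
    have e : c 0 * x 0 + c 0 * h.Yc = h.Yc * CV + XV * c 0 - XV * CV + CV * x 0 := by
      simp only [Coeff.Yc, mul_add, add_mul, mul_assoc, reassoc (h.rev.CC 0 hn), one_mul, h.CC,
        mul_one, ← (h.xC 0 hn).eq, (h.cX 0 hn).eq]
      abel
    have e' := congrArg (emb n 0) e
    simp only [emb_add, emb_sub] at e'
    linear_combination (norm := module) ξ • e'
  · simp (disch := omega) only [opX_succ, opc_gt h.rev, opc_zero, mul_one, smul_add, hs']
    have e : Commute (c 1) h.Yc := by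
      refine h.commute_Yc hn (h.cX 1 (by omega)) (h.rev.CXo 1 (by omega) 0 hn (by omega)) ?_
      exact (commute_mul_of_anti (h.rev.anti 0 hn 1 (by omega) (by omega))
        (h.C_c (by omega))).symm
    rw [(h.rev.CXo 1 (by omega) 0 hn (by omega)).eq, reassoc (c_tau h.rev (by omega)), mul_assoc,
      e.eq, mul_assoc]

end ModelSecond

section ModelSecondX

variable {F} {V : Type*} [AddCommGroup V] [Module F V] {ξ : F} {n : ℕ}
  {t c x y : ℕ → Module.End F V} {CV XV XVi : Module.End F V}

/-- The operator inverse to `T 0 + ξ • (c * C)` on the model. -/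
noncomputable def opThi (ξ : F) (n : ℕ) (t c : ℕ → Module.End F V) (CV : Module.End F V) :
    Module.End F (Fin (n + 1) → V) :=
  opT ξ n t 0 - ξ • 1 + ξ • (opc ξ n t c CV * opC n c CV)

/-- The even generator of the second strand of the model. -/
noncomputable def opx (h : Coeff ξ n t c x y CV XV XVi) : Module.End F (Fin (n + 1) → V) :=
  opThi ξ n t c CV * opX ξ n t x XV h.Yc * (opT ξ n t 0 - ξ • 1)

theorem opThi_zero (hn : 0 < n) (r : Module.End F V) : opThi ξ n t c CV • emb n 0 r =
    emb n 1 r - ξ • emb n 0 r + ξ • emb n 0 (c 0 * CV * r) := by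
  rw [opThi, add_smul, opTi_eq (by omega), smul_assoc, mul_smul, opC_zero, opc_zero hn, mul_assoc]

theorem opThi_one (hn : 0 < n) (r : Module.End F V) : opThi ξ n t c CV • emb n 1 r =
    emb n 0 r + ξ • (emb n 1 (CV * (c 0 * r)) + ξ • emb n 0 (c 0 * (c 0 * r)) -
      ξ • emb n 0 (CV * (c 0 * r))) := by
  rw [opThi, add_smul, opTi_succ (k := 0) hn, smul_assoc, mul_smul, opC_succ (m := 0) _ _ _ hn,
    opc_one hn]

theorem opThi_gt (h : Rev ξ n t c x y) {m : ℕ} (hm : m + 2 ≤ n) (r : Module.End F V) :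
    opThi ξ n t c CV • emb n (m + 2) r =
      emb n (m + 2) ((t 0 - ξ • 1 + ξ • (c 1 * c 0)) * r) := by
  rw [opThi, add_smul, opTi_gt (by omega) hm, smul_assoc, mul_smul, opC_succ _ _ _ hm,
    opc_gt h hm, add_mul, emb_add, smul_mul_assoc, emb_smul, mul_assoc]

theorem opx_zero (h : Coeff ξ n t c x y CV XV XVi) (hn : 0 < n) (r : Module.End F V) :
    opx h • emb n 0 r = emb n 0 (x 0 * r) := by
  simp (disch := omega) only [opx, mul_smul, opTi_eq, smul_sub, smul_add,
    smul_comm (opX ξ n t x XV h.Yc) ξ, opX_zero, opX_succ (m := 0), tau, one_mul,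
    smul_comm (opThi ξ n t c CV) ξ, opThi_one, opThi_zero, zero_add]
  have e1 : CV * (c 0 * (x 0 * r)) + (h.Yc * r - XV * r) = 0 := by
    rw [Coeff.Yc, reassoc (h.C_c hn), add_mul, add_sub_cancel_left]
    simp only [mul_assoc, neg_mul, reassoc (h.xC 0 hn).eq]
    abel
  have e2 : c 0 * (c 0 * (x 0 * r)) - CV * (c 0 * (x 0 * r)) - (h.Yc * r - XV * r) +
      c 0 * CV * (h.Yc * r - XV * r) = 0 := by
    have e3 : h.Yc * r - XV * r = c 0 * CV * (x 0 * r) := by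
      rw [Coeff.Yc, add_mul, add_sub_cancel_left, mul_assoc (c 0), (h.xC 0 hn).eq]
      simp only [mul_assoc]
    rw [e3]
    simp only [mul_assoc, reassoc (h.C_c hn), reassoc (h.rev.CC 0 hn), one_mul, neg_mul, mul_neg,
      reassoc h.CC]
    abel
  have e1' := congrArg (emb n 1) e1
  have e2' := congrArg (emb n 0) e2
  simp only [mul_sub, emb_add, emb_sub, emb_zero] at e1' e2'
  linear_combination (norm := module) ξ • e1' + (ξ * ξ) • e2'

theorem opx_one (h : Coeff ξ n t c x y CV XV XVi) (hn : 0 < n) (r : Module.End F V) :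
    opx h • emb n 1 r = opThi ξ n t c CV • emb n 0 (XV * r) := by
  rw [opx, mul_smul, mul_smul, opTi_succ (k := 0) hn, opX_zero]

theorem opx_gt (h : Coeff ξ n t c x y CV XV XVi) {m : ℕ} (hm : m + 2 ≤ n) (r : Module.End F V) :
    opx h • emb n (m + 2) r = emb n (m + 2) (x 1 * r) +
      ξ • opThi ξ n t c CV • emb n 0 (tau t (m + 1) * h.Yc * (t 0 - ξ • 1) * r) := by
  have hp := h.rev.xpair 0 (by omega)
  rw [opx, mul_smul, mul_smul, opTi_gt (by omega) hm, opX_succ _ _ _ _ _ hm, smul_add,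
    smul_comm (opThi ξ n t c CV) ξ, opThi_gt h.rev hm, hp.lower_eq hp.cross]
  simp only [zero_add, mul_assoc]

/-- The correction term of the second even generator. -/
theorem Yc_conj (h : Coeff ξ n t c x y CV XV XVi) (hn : 1 < n) :
    t 0 * h.Yc * (t 0 - ξ • 1) = XV + c 1 * x 1 * CV := by
  have hp := h.rev.xpair 0 hn
  have e1 : CV * (t 0 - ξ • 1) = (t 0 - ξ • 1) * CV :=
    ((h.tC 0 hn).symm.sub_right ((Commute.one_right CV).smul_right ξ)).eq
  calc t 0 * h.Yc * (t 0 - ξ • 1)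
      = t 0 * XV * (t 0 - ξ • 1) + t 0 * c 0 * x 0 * (CV * (t 0 - ξ • 1)) := by
        rw [Coeff.Yc]; simp only [mul_add, add_mul, mul_assoc]
    _ = XV * (t 0 * (t 0 - ξ • 1)) +
        c 1 * ((t 0 - ξ • 1 + ξ • (c 1 * c 0)) * x 0 * (t 0 - ξ • 1)) * CV := by
        rw [(h.tX 0 hn).eq, e1, ← hp.cThi]; simp only [mul_assoc]
    _ = _ := by rw [Pair.mul_inv hp.quad, mul_one, ← hp.lower_eq hp.cross]

theorem x_t_Yc (h : Coeff ξ n t c x y CV XV XVi) (hn : 1 < n) :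
    x 0 * (t 0 * h.Yc) = t 0 * h.Yc * x 1 + ξ • ((XV + c 1 * x 1 * CV) * x 0) +
      ξ • (XV * c 0 * CV * (XV + c 1 * x 1 * CV)) := by
  have hp := h.rev.xpair 0 hn
  have h0 : 0 < n := by omega
  set Z := XV + c 1 * x 1 * CV with hZ
  have e1 : t 0 * h.Yc = Z * t 0 := by
    rw [hZ, ← Yc_conj h hn, mul_assoc, Pair.inv_mul hp.quad, mul_one]
  have e2 : Commute (x 0) Z := by
    refine (h.xX 0 h0).add_right (Commute.mul_right (Commute.mul_right ?_ ?_) (h.xC 0 h0))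
    · exact (h.rev.CXo 1 hn 0 h0 (by omega)).symm
    · exact h.rev.XX 0 h0 1 hn
  have e3 : x 0 * t 0 = t 0 * x 1 + ξ • x 0 + ξ • (c 1 * c 0 * x 1) := by
    have : x 0 * (t 0 - ξ • 1) = (t 0 + ξ • (c 1 * c 0)) * x 1 := by
      rw [← hp.cross, mul_assoc, Pair.mul_inv hp.quad, mul_one]
    rw [mul_sub, mul_smul_comm, mul_one, add_mul, smul_mul_assoc] at this
    rw [sub_eq_iff_eq_add.mp this]
    abel
  have e4 : Z * (c 1 * c 0 * x 1) = XV * c 0 * CV * Z := by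
    have a1 : XV * CV * XV = CV := by rw [mul_assoc, h.CX, ← mul_assoc, h.XXi, one_mul]
    have a2 : CV * (c 1 * x 1 * CV) = -(c 1 * x 1) := by
      rw [mul_assoc, reassoc (h.C_c hn), (h.xC 1 hn).eq, neg_mul, mul_assoc, reassoc h.CC, one_mul]
    have a3 : c 0 * c 1 = -(c 1 * c 0) := h.rev.anti 0 h0 1 hn (by omega)
    have a4 : c 1 * x 1 * CV * (c 1 * c 0 * x 1) = c 0 * CV := by
      have b1 : CV * (c 1 * c 0 * x 1) = c 1 * c 0 * x 1 * CV := by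
        simp only [mul_assoc, reassoc (h.C_c hn), reassoc (h.C_c h0), mul_neg, neg_mul, neg_neg,
          (h.xC 1 hn).eq]
      rw [mul_assoc, b1]
      have b2 : c 0 * x 1 = x 1 * c 0 := (h.rev.CXo 0 h0 1 hn (by omega)).eq
      simp only [mul_assoc, reassoc b2]
      rw [← mul_assoc (c 1) (x 1) (c 0 * CV), reassoc (h.rev.xcx hn), ← mul_assoc,
        h.rev.CC 1 hn, one_mul]
    rw [hZ, add_mul, a4, mul_add, mul_assoc (XV * c 0) CV (c 1 * x 1 * CV), a2,
      ← (h.cX 0 h0).eq, mul_assoc (c 0), mul_assoc (c 0), a1, (h.cX 0 h0).eq, mul_neg,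
      mul_assoc XV, ← mul_assoc (c 0) (c 1), a3]
    simp only [neg_mul, mul_neg, neg_neg, mul_assoc]
    abel
  rw [e1, ← mul_assoc, e2.eq, mul_assoc, e3, mul_add, mul_add, mul_smul_comm, mul_smul_comm, e4]
  simp only [mul_assoc]

theorem opx_commute_opX (h : Coeff ξ n t c x y CV XV XVi) (hn : 0 < n) :
    Commute (opx h) (opX ξ n t x XV h.Yc) := by
  refine op_ext fun m hm => ?_
  rw [mul_smul, mul_smul]
  have hs := fun v : V →ₗ[F] (Fin (n + 1) → V) => smul_comm (opX ξ n t x XV h.Yc) ξ v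
  have hs' := fun v : V →ₗ[F] (Fin (n + 1) → V) => smul_comm (opx h) ξ v
  rcases m with _ | _ | m
  · simp only [opX_zero, opx_zero h hn, mul_one, (h.xX 0 hn).eq]
  · simp (disch := omega) only [zero_add, opx_one, opx_zero, opX_succ (m := 0), opX_zero, smul_add,
      smul_sub, hs, hs', mul_one, tau, one_mul, opThi_zero]
    have a1 : XV * CV * XV = CV := by rw [mul_assoc, h.CX, ← mul_assoc, h.XXi, one_mul]
    have e : c 0 * CV * (XV * x 0) + x 0 * h.Yc =
        h.Yc * XV - XV * XV + XV * (c 0 * CV * XV) + XV * x 0 := by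
      have b1 : XV * (c 0 * CV * XV) = c 0 * CV := by
        rw [mul_assoc, ← mul_assoc, ← (h.cX 0 hn).eq, mul_assoc, ← mul_assoc XV, a1]
      rw [b1, Coeff.Yc, mul_add, add_mul, ← mul_assoc (x 0), ← mul_assoc (x 0), mul_assoc (x 0),
        h.rev.xcx hn, (h.xX 0 hn).eq, ← (h.xX 0 hn).eq, mul_assoc (c 0), ← mul_assoc CV,
        mul_assoc (c 0) (x 0), (h.xC 0 hn).eq]
      simp only [mul_assoc, (h.xX 0 hn).eq]
      abel
    have e' := congrArg (emb n 0) e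
    simp only [emb_add, emb_sub] at e'
    rw [(h.xX 0 hn).eq]
    linear_combination (norm := module) ξ • e'
  · simp (disch := omega) only [opX_succ, opx_gt h, opx_zero h, mul_one, smul_add, hs, hs']
    set Z := XV + c 1 * x 1 * CV with hZ
    have h1 : 1 < n := by omega
    have ht' : ∀ {a : Module.End F V}, (∀ k, 0 < k → k + 1 < n → Commute a (t k)) →
        Commute a (tau' t m) := fun ha => tau_commute fun i hi => ha _ (by omega) (by omega)
    have hx' : Commute (x 0) (tau' t m) := ht' fun k hk hk' =>
      (h.rev.TXo k hk' 0 hn (by omega) (by omega)).symm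
    have hX' : Commute XV (tau' t m) := ht' fun k hk hk' => (h.tX k hk').symm
    have hC' : Commute CV (tau' t m) := ht' fun k hk hk' => (h.tC k hk').symm
    have hc' : Commute (c 0) (tau' t m) := ht' fun k hk hk' =>
      (h.rev.TCo k hk' 0 hn (by omega) (by omega)).symm
    have hw : tau t (m + 1) * h.Yc * (t 0 - ξ • 1) = tau' t m * Z := by
      rw [tau_succ', hZ, ← Yc_conj h h1]; simp only [mul_assoc]
    have hZx : Commute (x 0) Z := by
      refine (h.xX 0 hn).add_right (Commute.mul_right (Commute.mul_right ?_ ?_) (h.xC 0 hn))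
      · exact (h.rev.CXo 1 h1 0 hn (by omega)).symm
      · exact h.rev.XX 0 hn 1 h1
    have hWx : Commute (x 0) (tau' t m * Z) := hx'.mul_right hZx
    have key : x 0 * (tau t (m + 1) * h.Yc) = tau t (m + 1) * h.Yc * x 1 +
        ξ • (tau' t m * Z * x 0) + ξ • (XV * (c 0 * CV * (tau' t m * Z))) := by
      have k0 := x_t_Yc h h1
      rw [← hZ] at k0
      have k1 := congrArg (fun z => tau' t m * z) k0
      simp only [mul_add, mul_smul_comm] at k1
      have k2 : XV * (c 0 * CV * (tau' t m * Z)) = tau' t m * (XV * c 0 * CV * Z) := by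
        rw [← ((hX'.mul_left hc').mul_left hC').left_comm]
        simp only [mul_assoc]
      rw [k2, tau_succ', mul_assoc, hx'.left_comm, k1]
      simp only [mul_assoc]
    rw [hw, (h.rev.XX 1 h1 0 hn).eq]
    simp (disch := omega) only [opThi_zero, smul_add, smul_sub, hs, opX_zero, opX_succ (m := 0),
      tau, one_mul, zero_add]
    have k3 : c 0 * CV * (tau' t m * Z * x 0) = c 0 * x 0 * CV * (tau' t m * Z) := by
      rw [← hWx.eq, mul_assoc, ← mul_assoc CV, ← (h.xC 0 hn).eq]
      simp only [mul_assoc]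
    have k4 : h.Yc * (tau' t m * Z) = XV * (tau' t m * Z) + c 0 * x 0 * CV * (tau' t m * Z) := by
      rw [Coeff.Yc, add_mul]
    rw [k3, k4, hWx.eq]
    have e' := congrArg (emb n 0) key
    simp only [emb_add, emb_smul, tau_succ] at e' ⊢
    linear_combination (norm := module) ξ • e'

/-- The model carries an action of `H_{n+1}`. -/
theorem model_minRev (h : Coeff ξ n t c x y CV XV XVi) :
    MinRev ξ (n + 1) (opT ξ n t) (opC n c CV) (opX ξ n t x XV h.Yc)
      (opC n c CV * opX ξ n t x XV h.Yc * opC n c CV) where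
  XY := by
    have := opXC_sq h
    simpa only [mul_assoc] using this
  YX := by
    calc _ = opC n c CV * (opX ξ n t x XV h.Yc * opC n c CV *
          (opX ξ n t x XV h.Yc * opC n c CV)) * opC n c CV := by
          simp only [mul_assoc, opC_sq h, mul_one]
      _ = 1 := by rw [opXC_sq h, mul_one, opC_sq h]
  CC := opC_sq h
  CX := by rw [mul_assoc _ (opC n c CV) (opC n c CV), opC_sq h, mul_one]
  quad i hi := opT_quad h.rev (by omega)
  braid i hi := opT_braid h.rev (by omega)
  far i j hij hj := opT_far h.rev hij (by omega)
  TC i h0 hi := opT_commute_opC h h0 (by omega)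
  TX i h0 hi := opT_commute_opX h h0 (by omega)
  two hN := by
    have hn : 0 < n := by omega
    have hp := opc_pair h hn
    refine ⟨opc ξ n t c CV, opx h, hp.Tc, ?_, hp.anti, opc_commute_opX h hn,
      opx_commute_opX h hn⟩
    rw [opx, mul_assoc _ _ (opT ξ n t 0), mul_assoc _ _ (opT ξ n t 0), Pair.inv_mul hp.quad,
      mul_one, ← mul_assoc, opThi, hp.Th_Thi, one_mul]

end ModelSecondX

section Filtration

variable {F} {V : Type*} [AddCommGroup V] [Module F V] {ξ : F} {n : ℕ}
  {t c x y : ℕ → Module.End F V} {CV XV XVi : Module.End F V}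

theorem opT_eps_lt {k m : ℕ} (h : m < k) (hk : k ≤ n) (v : V) :
    opT ξ n t k (eps F V n m v) = eps F V n m (t (k - 1) v) :=
  LinearMap.congr_fun (opT_lt t 1 h hk) v

theorem opT_eps_eq {k : ℕ} (hk : k ≤ n) (v : V) :
    opT ξ n t k (eps F V n k v) = eps F V n (k + 1) v :=
  LinearMap.congr_fun (opT_eq t 1 hk) v

theorem opT_eps_succ {k : ℕ} (hk : k + 1 ≤ n) (v : V) :
    opT ξ n t k (eps F V n (k + 1) v) = ξ • eps F V n (k + 1) v + eps F V n k v :=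
  LinearMap.congr_fun (opT_succ t 1 hk) v

theorem opT_eps_gt {k m : ℕ} (h : k + 1 < m) (hm : m ≤ n) (v : V) :
    opT ξ n t k (eps F V n m v) = eps F V n m (t k v) :=
  LinearMap.congr_fun (opT_gt t 1 h hm) v

theorem opTi_eps_succ {k : ℕ} (hk : k + 1 ≤ n) (v : V) :
    (opT ξ n t k - ξ • 1) (eps F V n (k + 1) v) = eps F V n k v :=
  LinearMap.congr_fun (opTi_succ hk 1) v

/-- The vectors supported on the summands below `j`. -/
def below (F : Type) [Field F] (V : Type*) [AddCommGroup V] [Module F V] (n j : ℕ) :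
    Submodule F (Fin (n + 1) → V) where
  carrier := {w | ∀ m : Fin (n + 1), j ≤ m → w m = 0}
  add_mem' ha hb m hm := by rw [Pi.add_apply, ha m hm, hb m hm, add_zero]
  zero_mem' _ _ := rfl
  smul_mem' a w hw m hm := by rw [Pi.smul_apply, hw m hm, smul_zero]

theorem eps_mem_below {m j : ℕ} (h : m < j) (v : V) : eps F V n m v ∈ below F V n j := by
  intro i hi
  rw [eps]
  split_ifs with hm
  · rw [LinearMap.single_apply, Pi.single_eq_of_ne]
    intro e
    have := congrArg Fin.val e
    simp only at this
    omega
  · rfl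

theorem below_mono {i j : ℕ} (h : i ≤ j) : below F V n i ≤ below F V n j :=
  fun _ hw m hm => hw m (h.trans hm)

theorem sum_eps (w : Fin (n + 1) → V) : w = ∑ m : Fin (n + 1), eps F V n m (w m) := by
  have h : ∀ m : Fin (n + 1), eps F V n m (w m) = Pi.single m (w m) := fun m => by
    rw [eps, dif_pos m.2]; rfl
  simp only [h]
  exact (Finset.univ_sum_single w).symm

theorem map_below {W : Type*} [AddCommGroup W] [Module F W] {A : (Fin (n + 1) → V) →ₗ[F] W}
    {M : Submodule F W} {j : ℕ}
    (h : ∀ m < j, m ≤ n → ∀ v, A (eps F V n m v) ∈ M) {w : Fin (n + 1) → V}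
    (hw : w ∈ below F V n j) : A w ∈ M := by
  rw [sum_eps (F := F) w, map_sum]
  refine M.sum_mem fun m _ => ?_
  rcases Nat.lt_or_ge m j with hm | hm
  · exact h m hm (by omega) _
  · rw [hw m hm, map_zero, map_zero]; exact M.zero_mem

/-- A full family of operators on the model extending the given ones. -/
structure Full (h : Coeff ξ n t c x y CV XV XVi) (C X Y : ℕ → Module.End F (Fin (n + 1) → V)) :
    Prop where
  rev : Rev ξ (n + 1) (opT ξ n t) C X Y
  C0 : C 0 = opC n c CV
  X0 : X 0 = opX ξ n t x XV h.Yc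

theorem Coeff.exists_full (h : Coeff ξ n t c x y CV XV XVi) : ∃ C X Y, Full h C X Y := by
  obtain ⟨C, X, Y, h1, h2, -, h3⟩ := MinRev.exists_rev n (model_minRev h)
  exact ⟨C, X, Y, h3, h1, h2⟩

namespace Full

variable {h : Coeff ξ n t c x y CV XV XVi} {C X Y : ℕ → Module.End F (Fin (n + 1) → V)}

theorem C_emb_gt (H : Full h C X Y) {k m : ℕ} (hk : k < m) (hm : m ≤ n) (r : Module.End F V) :
    C k • emb n m r = emb n m (c k * r) := by
  induction k generalizing r with
  | zero =>
    obtain ⟨m, rfl⟩ : ∃ j, m = j + 1 := ⟨m - 1, by omega⟩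
    rw [H.C0, opC_succ _ _ _ hm]
  | succ k ih =>
    rw [(H.rev.xpair k (by omega)).c_eq, mul_smul, mul_smul, opT_gt _ _ hk hm, ih (by omega),
      opTi_gt hk hm, (h.rev.xpair k (by omega)).c_eq]
    simp only [mul_assoc]

theorem opTi_lt {k m : ℕ} (h : m < k) (hk : k ≤ n) (r : Module.End F V) :
    (opT ξ n t k - ξ • 1) • emb n m r = emb n m ((t (k - 1) - ξ • 1) * r) := by
  rw [op_sub_smul, opT_lt _ _ h hk, smul_assoc, one_smul, sub_mul, emb_sub, smul_mul_assoc, one_mul,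
    emb_smul]

theorem C_emb_le (H : Full h C X Y) {j m : ℕ} (hm : m ≤ j) (hj : j < n) (r : Module.End F V) :
    C (j + 1) • emb n m r = emb n m (c j * r) := by
  induction j generalizing m r with
  | zero =>
    obtain rfl : m = 0 := by omega
    rw [(H.rev.xpair 0 (by omega)).c_eq, mul_smul, mul_smul, opT_eq _ _ (by omega),
      H.C_emb_gt (by omega) (by omega), opTi_succ (k := 0) (by omega)]
  | succ j ih =>
    rw [(H.rev.xpair (j + 1) (by omega)).c_eq, mul_smul, mul_smul]
    rcases Nat.lt_or_ge m (j + 1) with hm' | hm'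
    · rw [opT_lt _ _ hm' (by omega), ih (by omega) (by omega), opTi_lt hm' (by omega),
        Nat.add_sub_cancel, (h.rev.xpair j (by omega)).c_eq]
      simp only [mul_assoc]
    · obtain rfl : m = j + 1 := by omega
      rw [opT_eq _ _ (by omega), H.C_emb_gt (by omega) (by omega), opTi_succ (by omega)]

theorem C_one (H : Full h C X Y) (hn : 0 < n) : C 1 = opc ξ n t c CV := by
  rw [(H.rev.xpair 0 (by omega)).c_eq, H.C0]; rfl

theorem X_one (H : Full h C X Y) (hn : 0 < n) : X 1 = opx h := by
  have hp := H.rev.xpair 0 (by omega)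
  rw [hp.lower_eq hp.cross, H.X0, H.C0, zero_add, H.C_one hn]; rfl

theorem X_emb_le (H : Full h C X Y) {j m : ℕ} (hm : m ≤ j) (hj : j < n) (r : Module.End F V) :
    X (j + 1) • emb n m r = emb n m (x j * r) := by
  induction j generalizing m r with
  | zero =>
    obtain rfl : m = 0 := by omega
    rw [zero_add, H.X_one (by omega), opx_zero h (by omega)]
  | succ j ih =>
    have aux : ∀ m < j + 1, ∀ r : Module.End F V,
        X (j + 2) • emb n m r = emb n m (x (j + 1) * r) := by
      intro m hm' r
      have hp := H.rev.xpair (j + 1) (by omega)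
      have hq := h.rev.xpair j (by omega)
      have e := hp.lower_eq hp.cross
      have e' := hq.lower_eq hq.cross
      rw [e, mul_smul, mul_smul, opTi_lt hm' (by omega), ih (by omega) (by omega), add_smul,
        opTi_lt hm' (by omega), smul_assoc, mul_smul, H.C_emb_le (by omega) (by omega),
        H.C_emb_le (by omega) (by omega), e', Nat.add_sub_cancel, ← emb_smul, ← emb_add]
      simp only [mul_assoc, add_mul, smul_mul_assoc]
    rcases Nat.lt_or_ge m (j + 1) with hm' | hm'
    · exact aux m hm' r
    · obtain rfl : m = j + 1 := by omega
      rw [← opT_eq (ξ := ξ) t r (show j ≤ n by omega), ← mul_smul,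
        ← (H.rev.TXo j (by omega) (j + 2) (by omega) (by omega) (by omega)).eq, mul_smul,
        aux j (by omega), opT_eq _ _ (by omega)]

end Full

end Filtration

section Triangular

variable {F} {V : Type*} [AddCommGroup V] [Module F V] {ξ : F} {n : ℕ}
  {t c x y : ℕ → Module.End F V} {CV XV XVi : Module.End F V}

theorem opT_mem_below {k m : ℕ} (hk : k ≤ n) (h : k + 1 < m ∨ m ≤ k)
    {w : Fin (n + 1) → V} (hw : w ∈ below F V n m) : opT ξ n t k w ∈ below F V n m := by
  refine map_below (fun i hi hin v => ?_) hw
  rcases lt_trichotomy i k with hik | rfl | hik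
  · rw [opT_eps_lt hik hk]; exact eps_mem_below hi _
  · rw [opT_eps_eq hk]; exact eps_mem_below (by omega) _
  · rcases eq_or_lt_of_le (show k + 1 ≤ i from hik) with rfl | hik'
    · rw [opT_eps_succ (by omega)]
      exact add_mem (Submodule.smul_mem _ _ (eps_mem_below hi _)) (eps_mem_below (by omega) _)
    · rw [opT_eps_gt hik' hin]; exact eps_mem_below hi _

theorem opTi_mem_below {k m : ℕ} (hk : k ≤ n) (h : k + 1 < m ∨ m ≤ k)
    {w : Fin (n + 1) → V} (hw : w ∈ below F V n m) :
    (opT ξ n t k - ξ • 1) w ∈ below F V n m :=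
  sub_mem (opT_mem_below hk h hw) (Submodule.smul_mem _ _ hw)

namespace Full

variable {h : Coeff ξ n t c x y CV XV XVi} {C X Y : ℕ → Module.End F (Fin (n + 1) → V)}

theorem C_eps_gt (H : Full h C X Y) {k m : ℕ} (hk : k < m) (hm : m ≤ n) (v : V) :
    C k (eps F V n m v) = eps F V n m (c k v) :=
  LinearMap.congr_fun (H.C_emb_gt hk hm 1) v

theorem C_eps_le (H : Full h C X Y) {j m : ℕ} (hm : m ≤ j) (hj : j < n) (v : V) :
    C (j + 1) (eps F V n m v) = eps F V n m (c j v) :=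
  LinearMap.congr_fun (H.C_emb_le hm hj 1) v

theorem X_eps_le (H : Full h C X Y) {j m : ℕ} (hm : m ≤ j) (hj : j < n) (v : V) :
    X (j + 1) (eps F V n m v) = eps F V n m (x j v) :=
  LinearMap.congr_fun (H.X_emb_le hm hj 1) v

theorem C_zero_eps (H : Full h C X Y) (v : V) : C 0 (eps F V n 0 v) = eps F V n 0 (CV v) := by
  rw [H.C0]; exact LinearMap.congr_fun (opC_zero c CV 1) v

theorem X_zero_eps (H : Full h C X Y) (v : V) : X 0 (eps F V n 0 v) = eps F V n 0 (XV v) := by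
  rw [H.X0]; exact LinearMap.congr_fun (opX_zero t x XV h.Yc 1) v

theorem C_succ (H : Full h C X Y) {k : ℕ} (hk : k < n) :
    C (k + 1) = (opT ξ n t k - ξ • 1) * C k * opT ξ n t k :=
  (H.rev.xpair k (by omega)).c_eq

theorem C_mem_below (H : Full h C X Y) {k m : ℕ} (hk : k < m) (hm : m ≤ n) {w : Fin (n + 1) → V}
    (hw : w ∈ below F V n m) : C k w ∈ below F V n m := by
  induction k generalizing w with
  | zero =>
    refine map_below (fun i hi hin v => ?_) hw
    rcases Nat.eq_zero_or_pos i with rfl | hi0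
    · rw [H.C_zero_eps]; exact eps_mem_below hi _
    · rw [H.C_eps_gt hi0 hin]; exact eps_mem_below hi _
  | succ k ih =>
    rw [H.C_succ (by omega)]
    exact opTi_mem_below (by omega) (Or.inl hk)
      (ih (by omega) (opT_mem_below (by omega) (Or.inl hk) hw))

theorem C_self_mem_below (H : Full h C X Y) {j : ℕ} (hj : j ≤ n) {w : Fin (n + 1) → V}
    (hw : w ∈ below F V n j) : C j w ∈ below F V n j := by
  refine map_below (fun i hi hin v => ?_) hw
  obtain ⟨j, rfl⟩ : ∃ k, j = k + 1 := ⟨j - 1, by omega⟩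
  rw [H.C_eps_le (by omega) (by omega)]
  exact eps_mem_below hi _

theorem C_eps_self (H : Full h C X Y) {j : ℕ} (hj : j ≤ n) (v : V) :
    C j (eps F V n j v) - eps F V n j (CV v) ∈ below F V n j := by
  induction j with
  | zero => rw [H.C_zero_eps, sub_self]; exact zero_mem _
  | succ j ih =>
    have ih := ih (by omega)
    set p := C j (eps F V n j v) - eps F V n j (CV v) with hp
    have e : C j (eps F V n j v) = eps F V n j (CV v) + p := by rw [hp]; abel
    have e2 : C (j + 1) (eps F V n (j + 1) v) - eps F V n (j + 1) (CV v) =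
        ξ • eps F V n j (c j v) - ξ • eps F V n j (CV v) + (opT ξ n t j - ξ • 1) p := by
      rw [H.C_succ (by omega), Module.End.mul_apply, Module.End.mul_apply, opT_eps_succ hj, map_add,
        map_smul, H.C_eps_gt (by omega) hj, e, map_add, map_smul, opTi_eps_succ hj, map_add,
        LinearMap.sub_apply _ _ (eps F V n j _), opT_eps_eq (by omega), LinearMap.smul_apply,
        Module.End.one_apply]
      abel
    rw [e2]
    exact add_mem (sub_mem (Submodule.smul_mem _ _ (eps_mem_below (by omega) _))
      (Submodule.smul_mem _ _ (eps_mem_below (by omega) _)))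
      (below_mono (Nat.le_succ j) (opTi_mem_below (by omega) (Or.inr le_rfl) ih))

/-- The operators conjugating the top strand down. -/
noncomputable def Thi (ξ : F) (n : ℕ) (t : ℕ → Module.End F V)
    (C : ℕ → Module.End F (Fin (n + 1) → V)) (k : ℕ) : Module.End F (Fin (n + 1) → V) :=
  opT ξ n t k - ξ • 1 + ξ • (C (k + 1) * C k)

theorem Thi_apply (k : ℕ) (w : Fin (n + 1) → V) : Thi ξ n t C k w =
    opT ξ n t k w - ξ • w + ξ • C (k + 1) (C k w) := rfl

theorem X_succ (H : Full h C X Y) {k : ℕ} (hk : k < n) :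
    X (k + 1) = Thi ξ n t C k * X k * (opT ξ n t k - ξ • 1) := by
  have hp := H.rev.xpair k (by omega)
  exact hp.lower_eq hp.cross

/-- The image of the top summand under the conjugating operators. -/
noncomputable def G (ξ : F) (n : ℕ) (t : ℕ → Module.End F V)
    (C : ℕ → Module.End F (Fin (n + 1) → V)) : ℕ → V →ₗ[F] (Fin (n + 1) → V)
  | 0 => eps F V n 0
  | k + 1 => Thi ξ n t C k ∘ₗ G ξ n t C k

theorem X_eps_self (H : Full h C X Y) {j : ℕ} (hj : j ≤ n) (v : V) :
    X j (eps F V n j v) = G ξ n t C j (XV v) := by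
  induction j with
  | zero => exact H.X_zero_eps v
  | succ j ih =>
    rw [H.X_succ (by omega), Module.End.mul_apply, Module.End.mul_apply, opTi_eps_succ hj,
      ih (by omega)]
    rfl

theorem G_sub_mem (H : Full h C X Y) {j : ℕ} (hj : j ≤ n) (v : V) :
    G ξ n t C j v - eps F V n j v ∈ below F V n j := by
  induction j with
  | zero => rw [G, sub_self]; exact zero_mem _
  | succ j ih =>
    have ih := ih (by omega)
    set p := G ξ n t C j v - eps F V n j v with hp
    have e : G ξ n t C j v = eps F V n j v + p := by rw [hp]; abel
    have e2 : G ξ n t C (j + 1) v - eps F V n (j + 1) v =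
        opT ξ n t j p - ξ • (eps F V n j v + p) + ξ • C (j + 1) (C j (eps F V n j v + p)) := by
      rw [G, LinearMap.comp_apply, e, Thi_apply, map_add (opT ξ n t j), opT_eps_eq (by omega)]
      abel
    have hjj : eps F V n j v ∈ below F V n (j + 1) := eps_mem_below (by omega) _
    have hpj := below_mono (F := F) (V := V) (n := n) (Nat.le_succ j) ih
    have hC : C j (eps F V n j v + p) ∈ below F V n (j + 1) :=
      H.C_mem_below (by omega) hj (add_mem hjj hpj)
    rw [e2]
    exact add_mem (sub_mem (below_mono (Nat.le_succ j)
      (opT_mem_below (by omega) (Or.inr le_rfl) ih))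
      (Submodule.smul_mem _ _ (add_mem hjj hpj)))
      (Submodule.smul_mem _ _ (H.C_self_mem_below hj hC))

theorem X_eps_self_sub_mem (H : Full h C X Y) {j : ℕ} (hj : j ≤ n) (v : V) :
    X j (eps F V n j v) - eps F V n j (XV v) ∈ below F V n j := by
  rw [H.X_eps_self hj]; exact H.G_sub_mem hj _

theorem X_eps_gt_sub_mem (H : Full h C X Y) {k m : ℕ} (hk : k < m) (hm : m ≤ n) (v : V) :
    X k (eps F V n m v) - eps F V n m (x k v) ∈ below F V n m := by
  induction k generalizing v with
  | zero =>
    obtain ⟨m, rfl⟩ : ∃ j, m = j + 1 := ⟨m - 1, by omega⟩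
    have e : X 0 (eps F V n (m + 1) v) = eps F V n (m + 1) (x 0 v) +
        ξ • eps F V n 0 ((tau t m * h.Yc) v) := by
      rw [H.X0]; exact LinearMap.congr_fun (opX_succ t x XV h.Yc 1 hm) v
    rw [e, add_sub_cancel_left]
    exact Submodule.smul_mem _ _ (eps_mem_below hk _)
  | succ k ih =>
    have hq := h.rev.xpair k (by omega)
    have e' := hq.lower_eq hq.cross
    set u := (t k - ξ • 1) v with hu
    have ih := ih (by omega) u
    set p := X k (eps F V n m u) - eps F V n m (x k u) with hp
    have e : X k (eps F V n m u) = eps F V n m (x k u) + p := by rw [hp]; abel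
    have e1 : (opT ξ n t k - ξ • 1) (eps F V n m v) = eps F V n m u :=
      LinearMap.congr_fun (opTi_gt hk hm 1) v
    have e2 : Thi ξ n t C k (eps F V n m (x k u)) = eps F V n m (x (k + 1) v) := by
      rw [Thi_apply, opT_eps_gt hk hm, H.C_eps_gt (by omega) hm, H.C_eps_gt (by omega) hm, e',
        ← map_smul (eps F V n m), ← map_smul (eps F V n m), ← map_sub, ← map_add]
      rfl
    rw [H.X_succ (by omega), Module.End.mul_apply, Module.End.mul_apply, e1, e, map_add, e2,
      add_sub_cancel_left, Thi_apply]
    exact add_mem (sub_mem (opT_mem_below (by omega) (Or.inl hk) ih)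
      (Submodule.smul_mem _ _ ih))
      (Submodule.smul_mem _ _ (H.C_mem_below hk hm (H.C_mem_below (by omega) hm ih)))

end Full

end Triangular

section Evaluation

variable {F} {R : Type*} [Ring R] [Algebra F R]

/-- The value of the polynomial with coefficients `aa` at `A`. -/
noncomputable def fev (d : ℕ) (aa : ℕ → F) (A : R) : R := ∑ i ∈ Finset.range (d + 1), aa i • A ^ i

theorem map_fev {S : Type*} [Ring S] [Algebra F S] (g : R →ₐ[F] S) (d : ℕ) (aa : ℕ → F) (A : R) :
    g (fev d aa A) = fev d aa (g A) := by
  simp only [fev, map_sum, map_smul, map_pow]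

theorem commute_fev {A B : R} (h : Commute B A) (d : ℕ) (aa : ℕ → F) : Commute B (fev d aa A) :=
  Commute.sum_right _ _ _ fun i _ => (h.pow_right i).smul_right _

theorem semiconj_fev {A A' B : R} (h : B * A = A' * B) (d : ℕ) (aa : ℕ → F) :
    B * fev d aa A = fev d aa A' * B := by
  rw [fev, fev, Finset.mul_sum, Finset.sum_mul]
  refine Finset.sum_congr rfl fun i _ => ?_
  have : SemiconjBy B A A' := h
  rw [mul_smul_comm, smul_mul_assoc, (this.pow_right i).eq]

theorem fev_inv {d : ℕ} {aa : ℕ → F} (hf : GoodPoly F d aa) {A A' : R} (h : A' * A = 1) :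
    fev d aa A' = aa 0 • (A' ^ d * fev d aa A) := by
  rw [fev, fev, ← Finset.sum_range_reflect, Finset.mul_sum, Finset.smul_sum]
  refine Finset.sum_congr rfl fun i hi => ?_
  have hi' : i ≤ d := by rw [Finset.mem_range] at hi; omega
  have hp : ∀ k : ℕ, A' ^ k * A ^ k = 1 := by
    intro k
    induction k with
    | zero => simp
    | succ k ih => rw [pow_succ, pow_succ', mul_assoc, ← mul_assoc A', h, one_mul, ih]
  rw [show d + 1 - 1 - i = d - i by omega, hf.2.2.1 (d - i) (by omega),
    show d - (d - i) = i by omega, mul_smul_comm, smul_smul]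
  congr 1
  obtain ⟨e, rfl⟩ : ∃ e, d = e + i := ⟨d - i, by omega⟩
  rw [Nat.add_sub_cancel, pow_add, mul_assoc, hp, mul_one]

end Evaluation

section Kernel

variable {F} {V : Type*} [AddCommGroup V] [Module F V] {ξ : F} {n : ℕ}
  {t c x y : ℕ → Module.End F V} {CV XV XVi : Module.End F V} {d : ℕ} {aa : ℕ → F}

/-- Operators on the coefficients compatible with the coefficient actions, for which the
resulting submodule is stable under the odd generators. -/
structure Twist (d n : ℕ) (t c x : ℕ → Module.End F V) (CV XV XVi θ : Module.End F V) : Prop where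
  t : ∀ k, k + 1 < n → Commute θ (t k)
  c : ∀ k < n, Commute θ (c k)
  x : ∀ k < n, Commute θ (x k)
  XV : Commute θ XV
  CV : XVi ^ d * CV * θ = θ * CV
  surj : Function.Surjective θ

/-- The twisted image of the last summand under the polynomial. -/
noncomputable def psi (d : ℕ) (aa : ℕ → F) (n : ℕ) (A : Module.End F (Fin (n + 1) → V))
    (θ : Module.End F V) : V →ₗ[F] (Fin (n + 1) → V) :=
  fev d aa A ∘ₗ eps F V n n ∘ₗ θ

theorem psi_apply (A : Module.End F (Fin (n + 1) → V)) (θ : Module.End F V) (v : V) :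
    psi d aa n A θ v = fev d aa A (eps F V n n (θ v)) := rfl

/-- The descending products `T_{n-l} ⋯ T_{n-1}`. -/
noncomputable def chain (ξ : F) (n : ℕ) (t : ℕ → Module.End F V) :
    ℕ → Module.End F (Fin (n + 1) → V)
  | 0 => 1
  | l + 1 => opT ξ n t (n - l - 1) * chain ξ n t l

/-- The submodule generated from `M` through `psi`. -/
noncomputable def ker (ξ : F) (n : ℕ) (t : ℕ → Module.End F V) (ps : V →ₗ[F] (Fin (n + 1) → V))
    (M : Submodule F V) : Submodule F (Fin (n + 1) → V) :=
  Submodule.span F {w | ∃ l ≤ n, ∃ v ∈ M, w = chain ξ n t l (ps v)}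

theorem chain_mem_ker {ps : V →ₗ[F] (Fin (n + 1) → V)} {M : Submodule F V} {l : ℕ} (hl : l ≤ n)
    {v : V} (hv : v ∈ M) : chain ξ n t l (ps v) ∈ ker ξ n t ps M :=
  Submodule.subset_span ⟨l, hl, v, hv, rfl⟩

theorem map_ker {ps : V →ₗ[F] (Fin (n + 1) → V)} {M : Submodule F V}
    {S : Submodule F (Fin (n + 1) → V)} {A : Module.End F (Fin (n + 1) → V)}
    (hA : ∀ l ≤ n, ∀ v ∈ M, A (chain ξ n t l (ps v)) ∈ S) {w : Fin (n + 1) → V}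
    (hw : w ∈ ker ξ n t ps M) : A w ∈ S := by
  induction hw using Submodule.span_induction with
  | mem w hw => obtain ⟨l, hl, v, hv, rfl⟩ := hw; exact hA l hl v hv
  | zero => rw [map_zero]; exact zero_mem _
  | add u v _ _ hu hv => rw [map_add]; exact add_mem hu hv
  | smul a v _ hv => rw [map_smul]; exact Submodule.smul_mem _ _ hv

namespace Full

variable {h : Coeff ξ n t c x y CV XV XVi} {C X Y : ℕ → Module.End F (Fin (n + 1) → V)}
  {θ : Module.End F V}

theorem chain_commute (H : Full h C X Y) {k l : ℕ} (hk : k + 1 < n - l) :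
    Commute (opT ξ n t k) (chain ξ n t l) := by
  induction l with
  | zero => exact Commute.one_right _
  | succ l ih =>
    exact (H.rev.far k _ (by omega) (by omega)).mul_right (ih (by omega))

theorem chain_shift (H : Full h C X Y) {k l : ℕ} (hk : k < n) (hl : l ≤ n) (hkl : n - l < k) :
    opT ξ n t k * chain ξ n t l = chain ξ n t l * opT ξ n t (k - 1) := by
  induction l with
  | zero => omega
  | succ l ih =>
    rcases Nat.lt_or_ge (n - l) k with hk' | hk'
    · rw [chain, ← mul_assoc, ← (H.rev.far (n - l - 1) k (by omega) (by omega)).eq, mul_assoc,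
        ih (by omega) hk', mul_assoc]
    · obtain ⟨l, rfl⟩ : ∃ j, l = j + 1 := ⟨l - 1, by omega⟩
      have e1 : n - (l + 1) - 1 = k - 1 := by omega
      have e2 : n - l - 1 = k - 1 + 1 := by omega
      have e3 : k = k - 1 + 1 := by omega
      rw [chain, chain, e1, e2]
      nth_rewrite 1 [e3]
      have hb := H.rev.braid (k - 1) (by omega)
      rw [← mul_assoc, ← mul_assoc, ← hb, mul_assoc _ (opT ξ n t (k - 1)),
        (H.chain_commute (k := k - 1) (l := l) (by omega)).eq]
      simp only [mul_assoc]

variable {ps : V →ₗ[F] (Fin (n + 1) → V)} {M : Submodule F V}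

theorem T_mem_ker (H : Full h C X Y) (hps : ∀ k, k + 1 < n → ∀ v, opT ξ n t k (ps v) = ps (t k v))
    (hM : ∀ k, k + 1 < n → ∀ v ∈ M, t k v ∈ M) {k : ℕ} (hk : k < n) {w : Fin (n + 1) → V}
    (hw : w ∈ ker ξ n t ps M) : opT ξ n t k w ∈ ker ξ n t ps M := by
  refine map_ker (fun l hl v hv => ?_) hw
  rcases lt_trichotomy (k + 1) (n - l) with hkl | hkl | hkl
  · rw [← Module.End.mul_apply, (H.chain_commute hkl).eq, Module.End.mul_apply,
      hps k (by omega)]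
    exact chain_mem_ker hl (hM k (by omega) v hv)
  · obtain rfl : k = n - l - 1 := by omega
    exact chain_mem_ker (l := l + 1) (by omega) hv
  · rcases eq_or_lt_of_le (show n - l ≤ k by omega) with hkl' | hkl'
    · obtain ⟨l, rfl⟩ : ∃ j, l = j + 1 := ⟨l - 1, by omega⟩
      have e : k = n - l - 1 := by omega
      have e2 : opT ξ n t k * chain ξ n t (l + 1) = ξ • chain ξ n t (l + 1) + chain ξ n t l := by
        rw [chain, ← e, ← mul_assoc, H.rev.quad k (by omega), add_mul, smul_mul_assoc, one_mul]
      rw [← Module.End.mul_apply, e2]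
      exact add_mem (Submodule.smul_mem _ _ (chain_mem_ker hl hv)) (chain_mem_ker (by omega) hv)
    · rw [← Module.End.mul_apply, H.chain_shift hk hl hkl', Module.End.mul_apply,
        hps (k - 1) (by omega)]
      exact chain_mem_ker hl (hM (k - 1) (by omega) v hv)

theorem mem_ker_of_commute {A : Module.End F (Fin (n + 1) → V)}
    (hT : ∀ k < n, ∀ w ∈ ker ξ n t ps M, opT ξ n t k w ∈ ker ξ n t ps M)
    (hA : ∀ k, k + 1 < n → Commute A (opT ξ n t k))
    (h0 : ∀ v ∈ M, A (ps v) ∈ ker ξ n t ps M)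
    (h1 : ∀ v ∈ M, A (opT ξ n t (n - 1) (ps v)) ∈ ker ξ n t ps M) {w : Fin (n + 1) → V}
    (hw : w ∈ ker ξ n t ps M) : A w ∈ ker ξ n t ps M := by
  refine map_ker (fun l hl v hv => ?_) hw
  induction l with
  | zero => exact h0 v hv
  | succ l ih =>
    rcases Nat.eq_zero_or_pos l with rfl | hl0
    · exact h1 v hv
    · rw [chain, Module.End.mul_apply, ← Module.End.mul_apply, (hA _ (by omega)).eq]
      exact hT _ (by omega) _ (ih (by omega))

theorem fev_below (H : Full h C X Y) (hx : fev d aa (x (n - 1)) = 0) {w : Fin (n + 1) → V} (hw : w ∈ below F V n n) :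
    fev d aa (X n) w = 0 := by
  have key := map_below (A := fev d aa (X n)) (M := ⊥) (j := n) (fun m hm hmn v => ?_) hw
  · exact (Submodule.mem_bot F).1 key
  · rw [Submodule.mem_bot]
    have hp : ∀ i : ℕ, (X n ^ i) (eps F V n m v) = eps F V n m ((x (n - 1) ^ i) v) := by
      intro i
      induction i with
      | zero => rfl
      | succ i ih =>
        have := H.X_eps_le (j := n - 1) (m := m) (by omega) (by omega) ((x (n - 1) ^ i) v)
        rw [Nat.sub_add_cancel (by omega)] at this
        rw [pow_succ', Module.End.mul_apply, ih, this, pow_succ', Module.End.mul_apply]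
    have e : fev d aa (X n) (eps F V n m v) = eps F V n m (fev d aa (x (n - 1)) v) := by
      simp only [fev, LinearMap.sum_apply, LinearMap.smul_apply, hp, map_sum, map_smul]
    rw [e, hx, LinearMap.zero_apply, map_zero]

theorem fev_congr (H : Full h C X Y) (hx : fev d aa (x (n - 1)) = 0) {u w : Fin (n + 1) → V} (hw : u - w ∈ below F V n n) :
    fev d aa (X n) u = fev d aa (X n) w := by
  rw [← sub_eq_zero, ← map_sub, H.fev_below hx hw]

theorem T_psi (H : Full h C X Y) (hθ : Twist d n t c x CV XV XVi θ) {k : ℕ} (hk : k + 1 < n)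
    (v : V) : opT ξ n t k (psi d aa n (X n) θ v) = psi d aa n (X n) θ (t k v) := by
  rw [psi_apply, psi_apply, ← Module.End.mul_apply,
    (commute_fev (H.rev.TXo k (by omega) n (by omega) (by omega) (by omega)) d aa).eq,
    Module.End.mul_apply, opT_eps_gt hk le_rfl, ← Module.End.mul_apply, ← (hθ.t k hk).eq]
  rfl

theorem C_psi (H : Full h C X Y) (hθ : Twist d n t c x CV XV XVi θ) {k : ℕ} (hk : k < n)
    (v : V) : C k (psi d aa n (X n) θ v) = psi d aa n (X n) θ (c k v) := by
  rw [psi_apply, psi_apply, ← Module.End.mul_apply,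
    (commute_fev (H.rev.CXo k (by omega) n (by omega) (by omega)) d aa).eq,
    Module.End.mul_apply, H.C_eps_gt hk le_rfl, ← Module.End.mul_apply, ← (hθ.c k hk).eq]
  rfl

theorem X_fev_eps (H : Full h C X Y) (hx : fev d aa (x (n - 1)) = 0) (v : V) : X n (fev d aa (X n) (eps F V n n v)) =
    fev d aa (X n) (eps F V n n (XV v)) := by
  rw [← Module.End.mul_apply, (commute_fev (Commute.refl (X n)) d aa).eq, Module.End.mul_apply]
  exact H.fev_congr hx (H.X_eps_self_sub_mem le_rfl v)

theorem Y_fev_eps (H : Full h C X Y) (hx : fev d aa (x (n - 1)) = 0) (v : V) : Y n (fev d aa (X n) (eps F V n n v)) =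
    fev d aa (X n) (eps F V n n (XVi v)) := by
  have e := H.X_fev_eps hx (XVi v)
  rw [← Module.End.mul_apply XV, h.XXi, Module.End.one_apply] at e
  rw [← e, ← Module.End.mul_apply, H.rev.YX n (by omega), Module.End.one_apply]

theorem X_psi (H : Full h C X Y) (hx : fev d aa (x (n - 1)) = 0) (hθ : Twist d n t c x CV XV XVi θ) (v : V) :
    X n (psi d aa n (X n) θ v) = psi d aa n (X n) θ (XV v) := by
  rw [psi_apply, H.X_fev_eps hx, ← Module.End.mul_apply, ← hθ.XV.eq]; rfl

theorem X_pred_psi (H : Full h C X Y) (hx : fev d aa (x (n - 1)) = 0) (hn : 0 < n) (hθ : Twist d n t c x CV XV XVi θ) (v : V) :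
    X (n - 1) (psi d aa n (X n) θ v) = psi d aa n (X n) θ (x (n - 1) v) := by
  rw [psi_apply, ← Module.End.mul_apply,
    (commute_fev (H.rev.XX (n - 1) (by omega) n (by omega)) d aa).eq, Module.End.mul_apply,
    H.fev_congr hx (H.X_eps_gt_sub_mem (k := n - 1) (by omega) le_rfl (θ v)),
    ← Module.End.mul_apply (x (n - 1)), ← (hθ.x (n - 1) (by omega)).eq]
  rfl

theorem C_last_psi (H : Full h C X Y) (hx : fev d aa (x (n - 1)) = 0) (hf : GoodPoly F d aa)
    (hθ : Twist d n t c x CV XV XVi θ) (v : V) :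
    C n (psi d aa n (X n) θ v) = aa 0 • psi d aa n (X n) θ (CV v) := by
  have e : ∀ i : ℕ, ∀ v, (Y n ^ i) (fev d aa (X n) (eps F V n n v)) =
      fev d aa (X n) (eps F V n n ((XVi ^ i) v)) := by
    intro i
    induction i with
    | zero => intro v; rfl
    | succ i ih =>
      intro v
      rw [pow_succ', Module.End.mul_apply, ih, H.Y_fev_eps hx, pow_succ', Module.End.mul_apply]
  rw [psi_apply, ← Module.End.mul_apply, semiconj_fev (H.rev.CX n (by omega)) d aa,
    fev_inv hf (H.rev.YX n (by omega)), smul_mul_assoc, LinearMap.smul_apply, mul_assoc,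
    Module.End.mul_apply, Module.End.mul_apply, H.fev_congr hx (H.C_eps_self le_rfl (θ v)), e,
    psi_apply, ← Module.End.mul_apply θ, ← hθ.CV]
  rfl

/-- Stability of `ker` under the finite part. -/
theorem C_last_mem_ker (H : Full h C X Y) (hx : fev d aa (x (n - 1)) = 0) (hn : 0 < n) (hf : GoodPoly F d aa)
    (hθ : Twist d n t c x CV XV XVi θ)
    (hT : ∀ k, k + 1 < n → ∀ v ∈ M, t k v ∈ M) (hC : ∀ v ∈ M, c (n - 1) v ∈ M)
    (hCV : ∀ v ∈ M, CV v ∈ M) {w : Fin (n + 1) → V}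
    (hw : w ∈ ker ξ n t (psi d aa n (X n) θ) M) :
    C n w ∈ ker ξ n t (psi d aa n (X n) θ) M := by
  have hTk : ∀ k < n, ∀ w ∈ ker ξ n t (psi d aa n (X n) θ) M,
      opT ξ n t k w ∈ ker ξ n t (psi d aa n (X n) θ) M :=
    fun k hk w hw => H.T_mem_ker (fun k hk v => H.T_psi hθ hk v) hT hk hw
  have h0 : ∀ v ∈ M, psi d aa n (X n) θ v ∈ ker ξ n t (psi d aa n (X n) θ) M :=
    fun v hv => chain_mem_ker (l := 0) (by omega) hv
  have hC0 : ∀ v ∈ M, C n (psi d aa n (X n) θ v) ∈ ker ξ n t (psi d aa n (X n) θ) M := by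
    intro v hv
    rw [H.C_last_psi hx hf hθ]
    exact Submodule.smul_mem _ _ (h0 _ (hCV v hv))
  refine mem_ker_of_commute hTk
    (fun k hk => (H.rev.TCo k (by omega) n (by omega) (by omega) (by omega)).symm) hC0
    (fun v hv => ?_) hw
  have e : C n * opT ξ n t (n - 1) = opT ξ n t (n - 1) * C (n - 1) + ξ • C n - ξ • C (n - 1) := by
    have := (H.rev.xpair (n - 1) (by omega)).cTi
    rw [Nat.sub_add_cancel (by omega : 1 ≤ n), mul_sub, sub_mul, mul_smul_comm, mul_one,
      smul_mul_assoc, one_mul] at this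
    rw [sub_eq_iff_eq_add] at this
    rw [this]; abel
  rw [← Module.End.mul_apply, e, LinearMap.sub_apply, LinearMap.add_apply, Module.End.mul_apply,
    LinearMap.smul_apply, LinearMap.smul_apply, H.C_psi hθ (by omega)]
  exact sub_mem (add_mem (hTk _ (by omega) _ (h0 _ (hC v hv))) (Submodule.smul_mem _ _ (hC0 v hv)))
    (Submodule.smul_mem _ _ (h0 _ (hC v hv)))

theorem C_mem_of_last (H : Full h C X Y) {N : Submodule F (Fin (n + 1) → V)}
    (hT : ∀ k < n, ∀ w ∈ N, opT ξ n t k w ∈ N) (hC : ∀ w ∈ N, C n w ∈ N) {k : ℕ} (hk : k ≤ n) :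
    ∀ w ∈ N, C k w ∈ N := by
  induction hk using Nat.decreasingInduction with
  | self => exact hC
  | of_succ k hk ih =>
    intro w hw
    have e : C k = opT ξ n t k * C (k + 1) * (opT ξ n t k - ξ • 1) := by
      rw [H.rev.TC k (by omega), mul_assoc, Pair.mul_inv (H.rev.quad k (by omega)), mul_one]
    rw [e]
    exact hT k hk _ (ih _ (sub_mem (hT k hk w hw) (Submodule.smul_mem _ _ hw)))

/-- The kernel submodule is a submodule for all generators. -/
theorem ker_top_stable (H : Full h C X Y) (hx : fev d aa (x (n - 1)) = 0) (hn : 0 < n) (hf : GoodPoly F d aa)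
    (hθ : Twist d n t c x CV XV XVi θ) :
    (∀ k < n, ∀ w ∈ ker ξ n t (psi d aa n (X n) θ) ⊤,
      opT ξ n t k w ∈ ker ξ n t (psi d aa n (X n) θ) ⊤) ∧
    (∀ k ≤ n, ∀ w ∈ ker ξ n t (psi d aa n (X n) θ) ⊤,
      C k w ∈ ker ξ n t (psi d aa n (X n) θ) ⊤) ∧
    (∀ k ≤ n, ∀ w ∈ ker ξ n t (psi d aa n (X n) θ) ⊤,
      X k w ∈ ker ξ n t (psi d aa n (X n) θ) ⊤) ∧
    (∀ k ≤ n, ∀ w ∈ ker ξ n t (psi d aa n (X n) θ) ⊤,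
      Y k w ∈ ker ξ n t (psi d aa n (X n) θ) ⊤) ∧
    ∀ w, fev d aa (X n) w ∈ ker ξ n t (psi d aa n (X n) θ) ⊤ := by
  set N := ker ξ n t (psi d aa n (X n) θ) ⊤ with hN
  have hTk : ∀ k < n, ∀ w ∈ N, opT ξ n t k w ∈ N := fun k hk w hw =>
    H.T_mem_ker (fun k hk v => H.T_psi hθ hk v) (fun _ _ _ _ => Submodule.mem_top) hk hw
  have hCk : ∀ k ≤ n, ∀ w ∈ N, C k w ∈ N := fun k hk => H.C_mem_of_last hTk (fun w hw =>
    H.C_last_mem_ker hx hn hf hθ (fun _ _ _ _ => Submodule.mem_top)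
      (fun _ _ => Submodule.mem_top) (fun _ _ => Submodule.mem_top) hw) hk
  have h0 : ∀ v, psi d aa n (X n) θ v ∈ N :=
    fun v => chain_mem_ker (l := 0) (by omega) Submodule.mem_top
  have hXn : ∀ w ∈ N, X n w ∈ N := by
    intro w hw
    refine mem_ker_of_commute hTk
      (fun k hk => (H.rev.TXo k (by omega) n (by omega) (by omega) (by omega)).symm)
      (fun v _ => ?_) (fun v _ => ?_) hw
    · rw [H.X_psi hx hθ]; exact h0 _
    · have e := H.X_succ (k := n - 1) (by omega)
      have hi := Pair.inv_mul (H.rev.quad (n - 1) (by omega))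
      rw [Nat.sub_add_cancel (by omega : 1 ≤ n)] at e
      have e2 : X n * opT ξ n t (n - 1) = Thi ξ n t C (n - 1) * X (n - 1) := by
        rw [e, mul_assoc, hi, mul_one]
      rw [← Module.End.mul_apply, e2, Module.End.mul_apply,
        H.X_pred_psi hx hn hθ, Thi_apply, Nat.sub_add_cancel (by omega : 1 ≤ n)]
      exact add_mem (sub_mem (hTk _ (by omega) _ (h0 _)) (Submodule.smul_mem _ _ (h0 _)))
        (Submodule.smul_mem _ _ (hCk _ le_rfl _ (hCk _ (by omega) _ (h0 _))))
  have hXk : ∀ k ≤ n, ∀ w ∈ N, X k w ∈ N := by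
    intro k hk
    induction hk using Nat.decreasingInduction with
    | self => exact hXn
    | of_succ k hk ih =>
      intro w hw
      rw [← H.rev.cross k (by omega)]
      have h1 := ih _ (hTk k hk w hw)
      exact add_mem (hTk k hk _ h1)
        (Submodule.smul_mem _ _ (hCk _ (by omega) _ (hCk _ (by omega) _ h1)))
  refine ⟨hTk, hCk, hXk, fun k hk w hw => ?_, fun w => ?_⟩
  · have e : Y k = C k * X k * C k := by
      rw [H.rev.CX k (by omega), mul_assoc, H.rev.CC k (by omega), mul_one]
    rw [e]
    exact hCk k hk _ (hXk k hk _ (hCk k hk _ hw))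
  · refine map_below (A := fev d aa (X n)) (j := n + 1) (fun m hm hmn v => ?_) (w := w)
      (fun m hm => absurd m.2 (by omega))
    rcases eq_or_lt_of_le hmn with rfl | hlt
    · obtain ⟨u, rfl⟩ := hθ.surj v
      exact h0 u
    · rw [H.fev_below hx (eps_mem_below hlt v)]
      exact zero_mem _

end Full

end Kernel

section Functoriality

variable {F} {V V' : Type*} [AddCommGroup V] [Module F V] [AddCommGroup V'] [Module F V']
  {ξ : F} {n : ℕ}
  {t c x y : ℕ → Module.End F V} {CV XV XVi : Module.End F V}
  {t' c' x' y' : ℕ → Module.End F V'} {CV' XV' XVi' : Module.End F V'}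
  {h : Coeff ξ n t c x y CV XV XVi} {C X Y : ℕ → Module.End F (Fin (n + 1) → V)}
  {h' : Coeff ξ n t' c' x' y' CV' XV' XVi'} {C' X' Y' : ℕ → Module.End F (Fin (n + 1) → V')}
  {g : V →ₗ[F] V'}

/-- The map induced on the model by a map of coefficients. -/
noncomputable def lift (n : ℕ) (g : V →ₗ[F] V') : (Fin (n + 1) → V) →ₗ[F] (Fin (n + 1) → V') :=
  g.compLeft (Fin (n + 1))

theorem lift_eps (m : ℕ) (v : V) : lift n g (eps F V n m v) = eps F V' n m (g v) := by
  funext i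
  rw [eps, eps]
  split_ifs with hm
  · simp only [lift, LinearMap.compLeft_apply, Function.comp_apply, LinearMap.single_apply]
    exact (Pi.apply_single (fun _ => g) (fun _ => map_zero g) _ v i)
  · exact map_zero g

theorem linear_ext {W : Type*} [AddCommGroup W] [Module F W]
    {A B : (Fin (n + 1) → V) →ₗ[F] W} (hAB : ∀ m ≤ n, ∀ v, A (eps F V n m v) = B (eps F V n m v))
    (w : Fin (n + 1) → V) : A w = B w := by
  rw [sum_eps (F := F) w, map_sum, map_sum]
  exact Finset.sum_congr rfl fun m _ => hAB m (by omega) _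

theorem lift_opT (ht : ∀ k, k + 1 < n → ∀ v, g (t k v) = t' k (g v)) {k : ℕ} (hk : k < n)
    (w : Fin (n + 1) → V) : lift n g (opT ξ n t k w) = opT ξ n t' k (lift n g w) := by
  refine linear_ext (A := lift n g ∘ₗ opT ξ n t k) (B := opT ξ n t' k ∘ₗ lift n g)
    (fun m hm v => ?_) w
  simp only [LinearMap.comp_apply]
  rcases lt_trichotomy m k with hmk | rfl | hmk
  · rw [opT_eps_lt hmk hk.le, lift_eps, lift_eps, opT_eps_lt hmk hk.le, ht _ (by omega)]
  · rw [opT_eps_eq hk.le, lift_eps, lift_eps, opT_eps_eq hk.le]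
  · rcases eq_or_lt_of_le (show k + 1 ≤ m from hmk) with rfl | hmk'
    · rw [opT_eps_succ hm, map_add, map_smul, lift_eps, lift_eps, opT_eps_succ hm]
    · rw [opT_eps_gt hmk' hm, lift_eps, lift_eps, opT_eps_gt hmk' hm, ht _ (by omega)]

namespace Full

theorem lift_C (H : Full h C X Y) (H' : Full h' C' X' Y')
    (ht : ∀ k, k + 1 < n → ∀ v, g (t k v) = t' k (g v)) (hc : ∀ k < n, ∀ v, g (c k v) = c' k (g v))
    (hCV : ∀ v, g (CV v) = CV' (g v)) {k : ℕ} (hk : k ≤ n) (w : Fin (n + 1) → V) :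
    lift n g (C k w) = C' k (lift n g w) := by
  induction k generalizing w with
  | zero =>
    refine linear_ext (A := lift n g ∘ₗ C 0) (B := C' 0 ∘ₗ lift n g) (fun m hm v => ?_) w
    simp only [LinearMap.comp_apply]
    rcases Nat.eq_zero_or_pos m with rfl | hm0
    · rw [H.C_zero_eps, lift_eps, lift_eps, H'.C_zero_eps, hCV]
    · rw [H.C_eps_gt hm0 hm, lift_eps, lift_eps, H'.C_eps_gt hm0 hm, hc _ (by omega)]
  | succ k ih =>
    rw [H.C_succ hk, H'.C_succ hk]
    simp only [Module.End.mul_apply, LinearMap.sub_apply, LinearMap.smul_apply,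
      Module.End.one_apply, map_sub, map_smul, lift_opT ht hk, ih (Nat.le_of_lt hk)]

theorem lift_Thi (H : Full h C X Y) (H' : Full h' C' X' Y')
    (ht : ∀ k, k + 1 < n → ∀ v, g (t k v) = t' k (g v)) (hc : ∀ k < n, ∀ v, g (c k v) = c' k (g v))
    (hCV : ∀ v, g (CV v) = CV' (g v)) {k : ℕ} (hk : k < n) (w : Fin (n + 1) → V) :
    lift n g (Thi ξ n t C k w) = Thi ξ n t' C' k (lift n g w) := by
  simp only [Thi_apply, map_add, map_sub, map_smul, lift_opT ht hk, H.lift_C H' ht hc hCV hk,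
    H.lift_C H' ht hc hCV hk.le]

theorem lift_G (H : Full h C X Y) (H' : Full h' C' X' Y')
    (ht : ∀ k, k + 1 < n → ∀ v, g (t k v) = t' k (g v)) (hc : ∀ k < n, ∀ v, g (c k v) = c' k (g v))
    (hCV : ∀ v, g (CV v) = CV' (g v)) {k : ℕ} (hk : k ≤ n) (v : V) :
    lift n g (G ξ n t C k v) = G ξ n t' C' k (g v) := by
  induction k with
  | zero => exact lift_eps 0 v
  | succ k ih =>
    rw [G, LinearMap.comp_apply, H.lift_Thi H' ht hc hCV hk, ih (by omega)]; rfl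

theorem lift_X (H : Full h C X Y) (H' : Full h' C' X' Y')
    (ht : ∀ k, k + 1 < n → ∀ v, g (t k v) = t' k (g v)) (hc : ∀ k < n, ∀ v, g (c k v) = c' k (g v))
    (hx : ∀ k < n, ∀ v, g (x k v) = x' k (g v))
    (hCV : ∀ v, g (CV v) = CV' (g v)) (hXV : ∀ v, g (XV v) = XV' (g v)) {k : ℕ} (hk : k ≤ n)
    (w : Fin (n + 1) → V) : lift n g (X k w) = X' k (lift n g w) := by
  induction k generalizing w with
  | zero =>
    refine linear_ext (A := lift n g ∘ₗ X 0) (B := X' 0 ∘ₗ lift n g) (fun m hm v => ?_) w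
    simp only [LinearMap.comp_apply]
    rcases Nat.eq_zero_or_pos m with rfl | hm0
    · rw [H.X_zero_eps, lift_eps, lift_eps, H'.X_zero_eps, hXV]
    · obtain ⟨m, rfl⟩ : ∃ j, m = j + 1 := ⟨m - 1, by omega⟩
      have e : X 0 (eps F V n (m + 1) v) = eps F V n (m + 1) (x 0 v) +
          ξ • eps F V n 0 (tau t m (h.Yc v)) := by
        rw [H.X0]; exact LinearMap.congr_fun (opX_succ t x XV h.Yc 1 hm) v
      have e' : X' 0 (eps F V' n (m + 1) (g v)) = eps F V' n (m + 1) (x' 0 (g v)) +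
          ξ • eps F V' n 0 (tau t' m (h'.Yc (g v))) := by
        rw [H'.X0]; exact LinearMap.congr_fun (opX_succ t' x' XV' h'.Yc 1 hm) (g v)
      have hY : g (h.Yc v) = h'.Yc (g v) := by
        simp only [Coeff.Yc, LinearMap.add_apply, Module.End.mul_apply, map_add, hXV,
          hc 0 (by omega), hx 0 (by omega), hCV]
      have htau : ∀ i, i < n → ∀ v, g (tau t i v) = tau t' i (g v) := by
        intro i hi
        induction i with
        | zero => intro v; rfl
        | succ i ih =>
          intro v
          rw [tau_succ, tau_succ, Module.End.mul_apply, Module.End.mul_apply, ht i hi,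
            ih (by omega)]
      rw [e, map_add, map_smul, lift_eps, lift_eps, lift_eps, e', hx 0 (by omega),
        htau m (by omega), hY]
  | succ k ih =>
    rw [H.X_succ hk, H'.X_succ hk]
    simp only [Module.End.mul_apply, H.lift_Thi H' ht hc hCV hk, ih (Nat.le_of_lt hk),
      LinearMap.sub_apply, LinearMap.smul_apply, Module.End.one_apply, map_sub, map_smul,
      lift_opT ht hk]

theorem lift_X_below (H : Full h C X Y) (H' : Full h' C' X' Y')
    (hx : ∀ k < n, ∀ v, g (x k v) = x' k (g v)) {w : Fin (n + 1) → V} (hw : w ∈ below F V n n) :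
    lift n g (X n w) = X' n (lift n g w) := by
  have := map_below (A := lift n g ∘ₗ X n - X' n ∘ₗ lift n g) (M := ⊥) (fun m hm hmn v => ?_) hw
  · rw [Submodule.mem_bot, LinearMap.sub_apply, sub_eq_zero] at this
    exact this
  · obtain ⟨k, rfl⟩ : ∃ j, n = j + 1 := ⟨n - 1, by omega⟩
    rw [Submodule.mem_bot, LinearMap.sub_apply, sub_eq_zero, LinearMap.comp_apply,
      LinearMap.comp_apply, H.X_eps_le (by omega) (by omega), lift_eps, lift_eps,
      H'.X_eps_le (by omega) (by omega), hx k (by omega)]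

end Full

theorem lift_mem_below {j : ℕ} {w : Fin (n + 1) → V} (hw : w ∈ below F V n j) :
    lift n g w ∈ below F V' n j := fun m hm => by
  simp only [lift, LinearMap.compLeft_apply, Function.comp_apply, hw m hm, map_zero]

theorem lift_chain (ht : ∀ k, k + 1 < n → ∀ v, g (t k v) = t' k (g v)) {l : ℕ} (hl : l ≤ n)
    (w : Fin (n + 1) → V) : lift n g (chain ξ n t l w) = chain ξ n t' l (lift n g w) := by
  induction l with
  | zero => rfl
  | succ l ih =>
    rw [chain, Module.End.mul_apply, lift_opT ht (by omega), ih (by omega)]; rfl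

end Functoriality

section FiniteGeneration

variable {F} {V : Type*} [AddCommGroup V] [Module F V] {ξ : F} {n : ℕ}
  {t c x y : ℕ → Module.End F V} {CV XV XVi : Module.End F V}
  {h : Coeff ξ n t c x y CV XV XVi} {C X Y : ℕ → Module.End F (Fin (n + 1) → V)}

namespace Full

theorem eq_top_of_zero (H : Full h C X Y) {S : Submodule F (Fin (n + 1) → V)}
    (hT : ∀ k < n, ∀ w ∈ S, opT ξ n t k w ∈ S) (hC : ∀ w ∈ S, C n w ∈ S) {P : Submodule F V}
    (hP : P ⊔ P.map CV = ⊤) (h0 : ∀ u ∈ P, eps F V n 0 u ∈ S) : S = ⊤ := by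
  have hC0 := H.C_mem_of_last hT hC (Nat.zero_le n)
  have h1 : ∀ v, eps F V n 0 v ∈ S := by
    intro v
    have hv : v ∈ P ⊔ P.map CV := hP ▸ Submodule.mem_top
    obtain ⟨a, ha, b, hb, rfl⟩ := Submodule.mem_sup.1 hv
    obtain ⟨b, hb, rfl⟩ := hb
    rw [map_add, ← H.C_zero_eps]
    exact add_mem (h0 a ha) (hC0 _ (h0 b hb))
  have h2 : ∀ m ≤ n, ∀ v, eps F V n m v ∈ S := by
    intro m
    induction m with
    | zero => exact fun _ => h1
    | succ m ih =>
      intro hm v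
      rw [← opT_eps_eq (ξ := ξ) (t := t) (by omega : m ≤ n)]
      exact hT m hm _ (ih (by omega) v)
  refine eq_top_iff.2 fun w _ => ?_
  rw [sum_eps (F := F) w]
  exact S.sum_mem fun m _ => h2 m (by omega) _

theorem eq_top_of_last (H : Full h C X Y) {S : Submodule F (Fin (n + 1) → V)}
    (hT : ∀ k < n, ∀ w ∈ S, opT ξ n t k w ∈ S) (hC : ∀ w ∈ S, C n w ∈ S) {P : Submodule F V}
    (hP : P ⊔ P.map CV = ⊤) (h0 : ∀ u ∈ P, eps F V n n u ∈ S) : S = ⊤ := by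
  refine H.eq_top_of_zero hT hC hP ?_
  have : ∀ m ≤ n, ∀ u ∈ P, eps F V n m u ∈ S := by
    intro m hm
    induction hm using Nat.decreasingInduction with
    | self => exact h0
    | of_succ k hk ih =>
      intro u hu
      rw [← opTi_eps_succ (ξ := ξ) (t := t) (show k + 1 ≤ n from hk)]
      exact sub_mem (hT k hk _ (ih u hu)) (Submodule.smul_mem _ _ (ih u hu))
  exact this 0 (Nat.zero_le n)

theorem eq_top_of_G (H : Full h C X Y) {S : Submodule F (Fin (n + 1) → V)}
    (hT : ∀ k < n, ∀ w ∈ S, opT ξ n t k w ∈ S) (hC : ∀ w ∈ S, C n w ∈ S) {P : Submodule F V}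
    (hP : P ⊔ P.map CV = ⊤) (h0 : ∀ u ∈ P, G ξ n t C n u ∈ S) : S = ⊤ := by
  refine H.eq_top_of_zero hT hC hP ?_
  have hCk : ∀ k ≤ n, ∀ w ∈ S, C k w ∈ S := fun k hk => H.C_mem_of_last hT hC hk
  have : ∀ m ≤ n, ∀ u ∈ P, G ξ n t C m u ∈ S := by
    intro m hm
    induction hm using Nat.decreasingInduction with
    | self => exact h0
    | of_succ k hk ih =>
      intro u hu
      have e : G ξ n t C k u = (opT ξ n t k + ξ • (C (k + 1) * C k)) (G ξ n t C (k + 1) u) := by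
        rw [G, LinearMap.comp_apply, ← Module.End.mul_apply, Thi,
          (H.rev.xpair k (by omega)).Th_Thi, Module.End.one_apply]
      rw [e]
      exact add_mem (hT k hk _ (ih u hu))
        (Submodule.smul_mem _ _ (hCk _ hk _ (hCk _ (by omega) _ (ih u hu))))
  exact this 0 (Nat.zero_le n)

end Full

end FiniteGeneration

section Grading

variable {F} {V E : Type*} [AddCommGroup V] [Module F V] [AddCommGroup E] [Module F E]
  {ξ : F} {n d : ℕ} {aa : ℕ → F}
  {t c x y : ℕ → Module.End F V} {CV XV XVi θ : Module.End F V}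
  {t' c' x' y' : ℕ → Module.End F E} {CV' XV' XVi' : Module.End F E}
  {κ : ℤ → V →ₗ[F] E} {ι : E →ₗ[F] V} {ρ : ℤ → Module.End F V} {P : Submodule F E}
  {h : Coeff ξ n t c x y CV XV XVi} {C X Y : ℕ → Module.End F (Fin (n + 1) → V)}
  {h' : Coeff ξ n t' c' x' y' CV' XV' XVi'} {C' X' Y' : ℕ → Module.End F (Fin (n + 1) → E)}

/-- A grading of the coefficients `V` by copies of `E`: `κ j` takes the component of degree `j`,
`ι` is the inclusion in degree `0`, and `ρ j` shifts degrees by `j`. -/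
structure Graded (n : ℕ) (t c x : ℕ → Module.End F V) (CV XV θ : Module.End F V)
    (t' c' x' : ℕ → Module.End F E) (CV' : Module.End F E)
    (κ : ℤ → V →ₗ[F] E) (ι : E →ₗ[F] V) (ρ : ℤ → Module.End F V) (P : Submodule F E) : Prop where
  κt : ∀ j k, k + 1 < n → ∀ v, κ j (t k v) = t' k (κ j v)
  κc : ∀ j, ∀ k < n, ∀ v, κ j (c k v) = c' k (κ j v)
  κx : ∀ j, ∀ k < n, ∀ v, κ j (x k v) = x' k (κ j v)
  κCV : ∀ j v, κ j (CV v) = CV' (κ j v)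
  κι_zero : ∀ u, κ 0 (ι u) = u
  κι : ∀ j, j ≠ 0 → ∀ u, κ j (ι u) = 0
  κρ : ∀ i j v, κ j (ρ i v) = κ (j - i) v
  sep : ∀ v, (∀ j, κ j v = 0) → v = 0
  fin : ∀ v, {j | κ j v ≠ 0}.Finite
  ρt : ∀ j k, k + 1 < n → Commute (ρ j) (t k)
  ρc : ∀ j, ∀ k < n, Commute (ρ j) (c k)
  ρx : ∀ j, ∀ k < n, Commute (ρ j) (x k)
  ρCV : ∀ j, Commute (ρ j) CV
  ρXV : ∀ j, Commute (ρ j) XV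
  ρθ : ∀ j, Commute (ρ j) θ
  XVP : ∀ u ∈ P, XV (ι u) = ρ 1 (ι u)
  θP : ∀ u ∈ P, θ (ι u) = ι u
  span : P ⊔ P.map CV' = ⊤

namespace Graded

theorem ext (D : Graded n t c x CV XV θ t' c' x' CV' κ ι ρ P) {u v : V}
    (huv : ∀ j, κ j u = κ j v) : u = v :=
  sub_eq_zero.1 (D.sep _ fun j => by rw [map_sub, huv, sub_self])

theorem κι' (D : Graded n t c x CV XV θ t' c' x' CV' κ ι ρ P) (j : ℤ) (u : E) :
    κ j (ι u) = if j = 0 then u else 0 := by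
  split_ifs with hj
  · rw [hj, D.κι_zero]
  · exact D.κι j hj u

theorem ρρ (D : Graded n t c x CV XV θ t' c' x' CV' κ ι ρ P) (i j : ℤ) (v : V) :
    ρ i (ρ j v) = ρ (i + j) v :=
  D.ext fun k => by rw [D.κρ, D.κρ, D.κρ, sub_sub]

theorem ι_map (D : Graded n t c x CV XV θ t' c' x' CV' κ ι ρ P) {A : Module.End F V}
    {A' : Module.End F E} (hA : ∀ j v, κ j (A v) = A' (κ j v)) (u : E) : A (ι u) = ι (A' u) :=
  D.ext fun j => by
    rw [hA, D.κι', D.κι']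
    split_ifs
    · rfl
    · exact map_zero _

theorem lift_κρ (D : Graded n t c x CV XV θ t' c' x' CV' κ ι ρ P) (i j : ℤ) (w : Fin (n + 1) → V) :
    lift n (κ j) (lift n (ρ i) w) = lift n (κ (j - i)) w :=
  funext fun m => D.κρ i j (w m)

theorem lift_ρρ (D : Graded n t c x CV XV θ t' c' x' CV' κ ι ρ P) (i j : ℤ) (w : Fin (n + 1) → V) :
    lift n (ρ i) (lift n (ρ j) w) = lift n (ρ (i + j)) w :=
  funext fun m => D.ρρ i j (w m)

theorem eq_sum (D : Graded n t c x CV XV θ t' c' x' CV' κ ι ρ P) (v : V) {s : Finset ℤ}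
    (hs : ∀ j, κ j v ≠ 0 → j ∈ s) : v = ∑ j ∈ s, ρ j (ι (κ j v)) := by
  refine D.ext fun i => ?_
  rw [map_sum]
  have : ∀ j, κ i (ρ j (ι (κ j v))) = if i = j then κ j v else 0 := by
    intro j
    rw [D.κρ, D.κι']
    simp only [sub_eq_zero]
  simp only [this, Finset.sum_ite_eq]
  split_ifs with hi
  · rfl
  · by_contra hne
    exact hi (hs i hne)

theorem X_lift_ρ (D : Graded n t c x CV XV θ t' c' x' CV' κ ι ρ P) (H : Full h C X Y) (i : ℤ)
    (w : Fin (n + 1) → V) : lift n (ρ i) (X n w) = X n (lift n (ρ i) w) :=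
  H.lift_X H (fun k hk => LinearMap.congr_fun (D.ρt i k hk).eq)
    (fun k hk => LinearMap.congr_fun (D.ρc i k hk).eq)
    (fun k hk => LinearMap.congr_fun (D.ρx i k hk).eq)
    (LinearMap.congr_fun (D.ρCV i).eq) (LinearMap.congr_fun (D.ρXV i).eq) le_rfl w

theorem X_pow_eps (D : Graded n t c x CV XV θ t' c' x' CV' κ ι ρ P) (H : Full h C X Y)
    (H' : Full h' C' X' Y') {u : E} (hu : u ∈ P) (i : ℕ) :
    ∃ w ∈ below F V n n, (X n ^ (i + 1)) (eps F V n n (ι u)) =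
        lift n (ρ (i + 1 : ℕ)) (Full.G ξ n t C n (ι u)) + w ∧
      ∀ j : ℤ, (j ≤ 0 ∨ (i + 1 : ℕ) ≤ j) → lift n (κ j) w = 0 := by
  have hG : ∀ j, lift n (κ j) (Full.G ξ n t C n (ι u)) = Full.G ξ n t' C' n (κ j (ι u)) :=
    fun j => H.lift_G H' (D.κt j) (D.κc j) (D.κCV j) le_rfl _
  have h1 : X n (eps F V n n (ι u)) = lift n (ρ 1) (Full.G ξ n t C n (ι u)) := by
    rw [H.X_eps_self le_rfl, D.XVP u hu]
    exact (H.lift_G H (fun k hk => LinearMap.congr_fun (D.ρt 1 k hk).eq)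
      (fun k hk => LinearMap.congr_fun (D.ρc 1 k hk).eq)
      (LinearMap.congr_fun (D.ρCV 1).eq) le_rfl _).symm
  induction i with
  | zero =>
    refine ⟨0, zero_mem _, ?_, fun j _ => map_zero _⟩
    rw [zero_add, pow_one, add_zero, h1]; rfl
  | succ i ih =>
    obtain ⟨w, hw, e, hd⟩ := ih
    set p := Full.G ξ n t C n (ι u) - eps F V n n (ι u) with hp
    have hpb : p ∈ below F V n n := H.G_sub_mem le_rfl _
    have hX : ∀ w ∈ below F V n n, X n w ∈ below F V n n := by
      intro w hw
      refine map_below (fun m hm hmn v => ?_) hw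
      obtain ⟨k, rfl⟩ : ∃ j, n = j + 1 := ⟨n - 1, by omega⟩
      rw [H.X_eps_le (by omega) (by omega)]
      exact eps_mem_below hm _
    have eG : Full.G ξ n t C n (ι u) = eps F V n n (ι u) + p := by rw [hp]; abel
    refine ⟨X n w + lift n (ρ (i + 1 : ℕ)) (X n p),
      add_mem (hX w hw) (lift_mem_below (hX p hpb)), ?_, fun j hj => ?_⟩
    · rw [pow_succ', Module.End.mul_apply, e, map_add, ← D.X_lift_ρ H]
      nth_rewrite 1 [eG]
      rw [map_add, h1, map_add, D.lift_ρρ]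
      push_cast
      abel
    · have hpj : lift n (κ (j - (i + 1 : ℕ))) p = 0 := by
        rw [hp, map_sub, hG, lift_eps, D.κι _ (by push_cast at hj ⊢; omega)]
        simp
      rw [map_add, H.lift_X_below H' (D.κx j) hw, hd j (by push_cast at hj ⊢; omega), D.lift_κρ,
        H.lift_X_below H' (D.κx _) hpb, hpj]
      simp

theorem κ_psi (D : Graded n t c x CV XV θ t' c' x' CV' κ ι ρ P) (H : Full h C X Y)
    (H' : Full h' C' X' Y') {u : E} (hu : u ∈ P) {j : ℤ} (hj : j ≤ 0 ∨ (d : ℤ) ≤ j) :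
    lift n (κ j) (psi d aa n (X n) θ (ι u)) = (∑ i ∈ Finset.range d, aa (i + 1) •
      Full.G ξ n t' C' n (κ (j - (i + 1 : ℕ)) (ι u))) + aa 0 • eps F E n n (κ j (ι u)) := by
  rw [psi_apply, D.θP u hu, fev, Finset.sum_range_succ', LinearMap.add_apply, map_add,
    LinearMap.sum_apply, map_sum]
  congr 1
  · refine Finset.sum_congr rfl fun i hi => ?_
    rw [Finset.mem_range] at hi
    obtain ⟨w, -, e, hd⟩ := D.X_pow_eps H H' hu i
    rw [LinearMap.smul_apply, map_smul, e, map_add, hd j (by push_cast; omega), add_zero,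
      D.lift_κρ, H.lift_G H' (D.κt _) (D.κc _) (D.κCV _) le_rfl]
  · rw [LinearMap.smul_apply, map_smul, pow_zero, Module.End.one_apply, lift_eps]

theorem κ_psi_zero (D : Graded n t c x CV XV θ t' c' x' CV' κ ι ρ P) (H : Full h C X Y)
    (H' : Full h' C' X' Y') {u : E} (hu : u ∈ P) :
    lift n (κ 0) (psi d aa n (X n) θ (ι u)) = aa 0 • eps F E n n u := by
  rw [D.κ_psi H H' hu (Or.inl le_rfl), D.κι_zero, Finset.sum_eq_zero, zero_add]
  intro i _
  rw [D.κι _ (by push_cast; omega), map_zero, smul_zero]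

theorem κ_psi_top (D : Graded n t c x CV XV θ t' c' x' CV' κ ι ρ P) (H : Full h C X Y)
    (H' : Full h' C' X' Y') (hf : GoodPoly F d aa) {u : E} (hu : u ∈ P) :
    lift n (κ d) (psi d aa n (X n) θ (ι u)) = Full.G ξ n t' C' n u := by
  have hd := hf.1
  obtain ⟨e, rfl⟩ : ∃ e, d = e + 1 := ⟨d - 1, by omega⟩
  rw [D.κ_psi H H' hu (Or.inr le_rfl), D.κι _ (by push_cast; omega), map_zero, smul_zero,
    add_zero, Finset.sum_range_succ, Finset.sum_eq_zero, zero_add, sub_self, D.κι_zero, hf.2.1,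
    one_smul]
  intro i hi
  rw [Finset.mem_range] at hi
  rw [D.κι _ (by push_cast; omega), map_zero, smul_zero]

theorem κ_psi_out (D : Graded n t c x CV XV θ t' c' x' CV' κ ι ρ P) (H : Full h C X Y)
    (H' : Full h' C' X' Y') (hf : GoodPoly F d aa) (hx : fev d aa (x (n - 1)) = 0)
    (hθ : Twist d n t c x CV XV XVi θ) (u : E) {j : ℤ} (hj : j < 0 ∨ (d : ℤ) < j) :
    lift n (κ j) (psi d aa n (X n) θ (ι u)) = 0 := by
  have hP : ∀ u ∈ P, lift n (κ j) (psi d aa n (X n) θ (ι u)) = 0 := by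
    intro u hu
    rw [D.κ_psi H H' hu (by omega), D.κι j (by omega), map_zero, smul_zero, add_zero]
    refine Finset.sum_eq_zero fun i hi => ?_
    rw [Finset.mem_range] at hi
    rw [D.κι _ (by push_cast; omega), map_zero, smul_zero]
  have ha : aa 0 ≠ 0 := by
    have := hf.2.2.1 d le_rfl
    rw [hf.2.1, Nat.sub_self] at this
    intro h0
    rw [h0, zero_mul] at this
    exact one_ne_zero this
  have hu : u ∈ P ⊔ P.map CV' := D.span ▸ Submodule.mem_top
  obtain ⟨a, ha', b, hb, rfl⟩ := Submodule.mem_sup.1 hu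
  obtain ⟨b, hb, rfl⟩ := hb
  have e : psi d aa n (X n) θ (ι (CV' b)) = (aa 0)⁻¹ • C n (psi d aa n (X n) θ (ι b)) := by
    rw [H.C_last_psi hx hf hθ, smul_smul, inv_mul_cancel₀ ha, one_smul, D.ι_map D.κCV]
  rw [map_add, map_add, map_add, hP a ha', e, map_smul,
    H.lift_C H' (D.κt j) (D.κc j) (D.κCV j) le_rfl, hP b hb]
  simp

end Graded

/-- The generators of `ker` assembled into one map. -/
noncomputable def assemble (ξ : F) (n : ℕ) (t : ℕ → Module.End F V)
    (ps : E →ₗ[F] (Fin (n + 1) → V)) : (Fin (n + 1) → E) →ₗ[F] (Fin (n + 1) → V) :=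
  ∑ l : Fin (n + 1), chain ξ n t l ∘ₗ ps ∘ₗ LinearMap.proj l

theorem assemble_apply (ps : E →ₗ[F] (Fin (n + 1) → V)) (g : Fin (n + 1) → E) :
    assemble ξ n t ps g = ∑ l : Fin (n + 1), chain ξ n t l (ps (g l)) := by
  simp [assemble]

theorem ker_le_range (ps : V →ₗ[F] (Fin (n + 1) → V)) (ι : E →ₗ[F] V) :
    ker ξ n t ps (LinearMap.range ι) ≤ LinearMap.range (assemble ξ n t (ps ∘ₗ ι)) := by
  refine Submodule.span_le.2 ?_
  rintro _ ⟨l, hl, _, ⟨u, rfl⟩, rfl⟩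
  refine ⟨Pi.single ⟨l, by omega⟩ u, ?_⟩
  rw [assemble_apply, Finset.sum_eq_single ⟨l, by omega⟩]
  · rw [Pi.single_eq_same]; rfl
  · intro b _ hb
    rw [Pi.single_eq_of_ne hb, map_zero, map_zero]
  · intro hb; exact absurd (Finset.mem_univ _) hb

namespace Graded

theorem map_ker_eq_top (D : Graded n t c x CV XV θ t' c' x' CV' κ ι ρ P) (H : Full h C X Y)
    (H' : Full h' C' X' Y') (hn : 0 < n) (hf : GoodPoly F d aa) (hx : fev d aa (x (n - 1)) = 0)
    (hθ : Twist d n t c x CV XV XVi θ) {j : ℤ} (hj : j = 0 ∨ j = d) :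
    (ker ξ n t (psi d aa n (X n) θ) (LinearMap.range ι)).map (lift n (κ j)) = ⊤ := by
  set K := ker ξ n t (psi d aa n (X n) θ) (LinearMap.range ι) with hK
  have hmem : ∀ (A : Module.End F V) (A' : Module.End F E), (∀ j v, κ j (A v) = A' (κ j v)) →
      ∀ v ∈ LinearMap.range ι, A v ∈ LinearMap.range ι := by
    rintro A A' hA _ ⟨u, rfl⟩
    exact ⟨A' u, (D.ι_map hA u).symm⟩
  have hT0 : ∀ k, k + 1 < n → ∀ v ∈ LinearMap.range ι, t k v ∈ LinearMap.range ι :=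
    fun k hk => hmem (t k) (t' k) fun j => D.κt j k hk
  have hT : ∀ k < n, ∀ w ∈ K.map (lift n (κ j)), opT ξ n t' k w ∈ K.map (lift n (κ j)) := by
    rintro k hk _ ⟨w, hw, rfl⟩
    exact ⟨_, H.T_mem_ker (fun k hk v => H.T_psi hθ hk v) hT0 hk hw, lift_opT (D.κt j) hk w⟩
  have hC : ∀ w ∈ K.map (lift n (κ j)), C' n w ∈ K.map (lift n (κ j)) := by
    rintro _ ⟨w, hw, rfl⟩
    exact ⟨_, H.C_last_mem_ker hx hn hf hθ hT0
      (hmem _ (c' (n - 1)) fun j => D.κc j (n - 1) (by omega)) (hmem _ CV' D.κCV) hw,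
      H.lift_C H' (D.κt j) (D.κc j) (D.κCV j) le_rfl w⟩
  have h0 : ∀ u, psi d aa n (X n) θ (ι u) ∈ K :=
    fun u => chain_mem_ker (l := 0) (Nat.zero_le n) ⟨u, rfl⟩
  have ha : aa 0 ≠ 0 := by
    have := hf.2.2.1 d le_rfl
    rw [hf.2.1, Nat.sub_self] at this
    intro h0
    rw [h0, zero_mul] at this
    exact one_ne_zero this
  rcases hj with rfl | rfl
  · refine H'.eq_top_of_last hT hC D.span fun u hu => ?_
    refine ⟨(aa 0)⁻¹ • psi d aa n (X n) θ (ι u), Submodule.smul_mem _ _ (h0 u), ?_⟩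
    rw [map_smul, D.κ_psi_zero H H' hu, smul_smul, inv_mul_cancel₀ ha, one_smul]
  · exact H'.eq_top_of_G hT hC D.span fun u hu => ⟨_, h0 u, D.κ_psi_top H H' hf hu⟩

theorem injective_comp (D : Graded n t c x CV XV θ t' c' x' CV' κ ι ρ P) (H : Full h C X Y)
    (H' : Full h' C' X' Y') (hn : 0 < n) (hf : GoodPoly F d aa) (hx : fev d aa (x (n - 1)) = 0)
    (hθ : Twist d n t c x CV XV XVi θ) [FiniteDimensional F E] {j : ℤ} (hj : j = 0 ∨ j = d) :
    Function.Injective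
      (lift n (κ j) ∘ₗ assemble ξ n t (psi d aa n (X n) θ ∘ₗ ι) : Module.End F _) := by
  refine LinearMap.injective_iff_surjective.2 (LinearMap.range_eq_top.1 (eq_top_iff.2 ?_))
  rw [← D.map_ker_eq_top H H' hn hf hx hθ hj, LinearMap.range_comp]
  exact Submodule.map_mono (ker_le_range _ ι)

theorem eq_zero_of_mem_ker (D : Graded n t c x CV XV θ t' c' x' CV' κ ι ρ P) (H : Full h C X Y)
    (H' : Full h' C' X' Y') (hn : 0 < n) (hf : GoodPoly F d aa) (hx : fev d aa (x (n - 1)) = 0)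
    (hθ : Twist d n t c x CV XV XVi θ) [FiniteDimensional F E] {w : Fin (n + 1) → V}
    (hw : w ∈ ker ξ n t (psi d aa n (X n) θ) ⊤)
    (hdeg : ∀ j : ℤ, (j < 0 ∨ (d : ℤ) ≤ j) → lift n (κ j) w = 0) : w = 0 := by
  set Φ := assemble ξ n t (psi d aa n (X n) θ ∘ₗ ι) with hΦ
  have hw' : w ∈ LinearMap.range (assemble ξ n t (psi d aa n (X n) θ)) := by
    have := ker_le_range (ξ := ξ) (t := t) (psi d aa n (X n) θ) LinearMap.id
    rw [LinearMap.range_id] at this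
    exact this hw
  obtain ⟨g, rfl⟩ := hw'
  have hfin : (⋃ l : Fin (n + 1), {j | κ j (g l) ≠ 0}).Finite :=
    Set.finite_iUnion fun l => D.fin (g l)
  set s := hfin.toFinset with hs
  have hsum : assemble ξ n t (psi d aa n (X n) θ) g =
      ∑ k ∈ s, lift n (ρ k) (Φ (lift n (κ k) g)) := by
    have hl : ∀ l : Fin (n + 1), g l = ∑ k ∈ s, ρ k (ι (κ k (g l))) := fun l =>
      D.eq_sum (g l) fun j hj => by
        rw [hs, Set.Finite.mem_toFinset, Set.mem_iUnion]; exact ⟨l, hj⟩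
    have hcomm : ∀ k v, psi d aa n (X n) θ (ρ k v) = lift n (ρ k) (psi d aa n (X n) θ v) := by
      intro k v
      have hpow : ∀ i w, lift n (ρ k) ((X n ^ i) w) = (X n ^ i) (lift n (ρ k) w) := by
        intro i
        induction i with
        | zero => exact fun _ => rfl
        | succ i ih =>
          intro w
          rw [pow_succ', Module.End.mul_apply, D.X_lift_ρ H, ih, Module.End.mul_apply]
      have e : θ (ρ k v) = ρ k (θ v) := (LinearMap.congr_fun (D.ρθ k).eq v).symm
      simp only [psi_apply, fev, LinearMap.sum_apply, LinearMap.smul_apply, map_sum, map_smul,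
        hpow, lift_eps, e]
    rw [assemble_apply]
    have : ∀ k, lift n (ρ k) (Φ (lift n (κ k) g)) =
        ∑ l : Fin (n + 1), chain ξ n t l (psi d aa n (X n) θ (ρ k (ι (κ k (g l))))) := by
      intro k
      rw [hΦ, assemble_apply, map_sum]
      refine Finset.sum_congr rfl fun l _ => ?_
      rw [lift_chain (fun i hi => LinearMap.congr_fun (D.ρt k i hi).eq) (by omega), hcomm]
      rfl
    simp only [this]
    rw [Finset.sum_comm]
    refine Finset.sum_congr rfl fun l _ => ?_
    conv_lhs => rw [hl l]
    rw [map_sum, map_sum]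
  have hΦout : ∀ (u : Fin (n + 1) → E) {j : ℤ}, (j < 0 ∨ (d : ℤ) < j) →
      lift n (κ j) (Φ u) = 0 := by
    intro u j hj
    rw [hΦ, assemble_apply, map_sum]
    refine Finset.sum_eq_zero fun l _ => ?_
    rw [lift_chain (D.κt j) (by omega), LinearMap.comp_apply, D.κ_psi_out H H' hf hx hθ _ hj,
      map_zero]
  have hκ : ∀ j, lift n (κ j) (assemble ξ n t (psi d aa n (X n) θ) g) =
      ∑ k ∈ s, lift n (κ (j - k)) (Φ (lift n (κ k) g)) := by
    intro j
    rw [hsum, map_sum]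
    exact Finset.sum_congr rfl fun k _ => D.lift_κρ _ _ _
  have hne : ∀ k ∈ s, lift n (κ k) g ≠ 0 := by
    intro k hk h0
    rw [hs, Set.Finite.mem_toFinset, Set.mem_iUnion] at hk
    obtain ⟨l, hl⟩ := hk
    exact hl (congrFun h0 l)
  rcases s.eq_empty_or_nonempty with hs0 | hs0
  · rw [hsum, hs0, Finset.sum_empty]
  · exfalso
    have h1 := s.max'_mem hs0
    have h2 := s.min'_mem hs0
    set a := s.max' hs0 with hadef
    set b := s.min' hs0 with hbdef
    have hba : b ≤ a := s.min'_le _ h1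
    have e1 : lift n (κ (a + d)) (assemble ξ n t (psi d aa n (X n) θ) g) =
        lift n (κ d) (Φ (lift n (κ a) g)) := by
      rw [hκ, Finset.sum_eq_single a]
      · rw [add_sub_cancel_left]
      · intro k hk hka
        have : k ≤ a := s.le_max' k hk
        exact hΦout _ (Or.inr (by omega))
      · intro ha; exact absurd h1 ha
    have e2 : lift n (κ b) (assemble ξ n t (psi d aa n (X n) θ) g) =
        lift n (κ 0) (Φ (lift n (κ b) g)) := by
      rw [hκ, Finset.sum_eq_single b]
      · rw [sub_self]
      · intro k hk hkb
        have : b ≤ k := s.min'_le k hk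
        exact hΦout _ (Or.inl (by omega))
      · intro hb; exact absurd h2 hb
    rcases lt_or_ge b 0 with hb | hb
    · rw [hdeg b (Or.inl hb)] at e2
      refine hne b h2 (D.injective_comp H H' hn hf hx hθ (Or.inl rfl) ?_)
      rw [map_zero]
      exact e2.symm
    · rw [hdeg (a + d) (Or.inr (by omega))] at e1
      refine hne a h1 (D.injective_comp H H' hn hf hx hθ (Or.inr rfl) ?_)
      rw [map_zero]
      exact e1.symm

end Graded

end Grading

section Concrete

theorem coeff_T_mul {A : Type*} [Ring A] (i j : ℤ) (f : LaurentPolynomial A) :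
    (LaurentPolynomial.T i * f).coeff j = f.coeff (j - i) := by
  rw [LaurentPolynomial.T, AddMonoidAlgebra.coeff_single_mul_apply, one_mul]
  congr 1; ring

variable {F} {A : Type*} [Ring A] [Algebra F A] (σ : A →ₐ[F] A)

/-- Left multiplication by `(a, σ a)` on `A × A`. -/
noncomputable def actE : A →ₐ[F] Module.End F (A × A) :=
  (Algebra.lmul F (A × A)).comp ((AlgHom.id F A).prod σ)

/-- Left multiplication by `(a, σ a)` on pairs of Laurent polynomials. -/
noncomputable def actV : A →ₐ[F] Module.End F (LaurentPolynomial A × LaurentPolynomial A) :=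
  (Algebra.lmul F (LaurentPolynomial A × LaurentPolynomial A)).comp
    (AddMonoidAlgebra.singleZeroAlgHom.prod (AddMonoidAlgebra.singleZeroAlgHom.comp σ))

/-- Multiplication by `(T^i, T^j)`. -/
noncomputable def shift (F : Type) [Field F] (A : Type*) [Ring A] [Algebra F A] (i j : ℤ) :
    Module.End F (LaurentPolynomial A × LaurentPolynomial A) :=
  Algebra.lmul F (LaurentPolynomial A × LaurentPolynomial A)
    (LaurentPolynomial.T i, LaurentPolynomial.T j)

/-- The interchange of the two components. -/
def swp (F : Type) [Field F] (B : Type*) [AddCommGroup B] [Module F B] : Module.End F (B × B) :=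
  (LinearEquiv.prodComm F B B).toLinearMap

/-- The coefficients of degree `j`. -/
noncomputable def coef (F : Type) [Field F] (A : Type*) [Ring A] [Algebra F A] (j : ℤ) :
    LaurentPolynomial A × LaurentPolynomial A →ₗ[F] A × A where
  toFun w := (w.1.coeff j, w.2.coeff j)
  map_add' u v := by simp
  map_smul' a v := by simp

/-- The inclusion of the constants. -/
noncomputable def const (F : Type) [Field F] (A : Type*) [Ring A] [Algebra F A] :
    A × A →ₗ[F] LaurentPolynomial A × LaurentPolynomial A :=
  LinearMap.prodMap (AddMonoidAlgebra.singleZeroAlgHom (R := F)).toLinearMap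
    (AddMonoidAlgebra.singleZeroAlgHom (R := F)).toLinearMap

@[simp] theorem actE_apply (a : A) (u : A × A) : actE σ a u = (a * u.1, σ a * u.2) := rfl

@[simp] theorem actV_apply (a : A) (u : LaurentPolynomial A × LaurentPolynomial A) :
    actV σ a u = (.single 0 a * u.1, .single 0 (σ a) * u.2) := rfl

@[simp] theorem shift_apply (i j : ℤ) (u : LaurentPolynomial A × LaurentPolynomial A) :
    shift F A i j u = (LaurentPolynomial.T i * u.1, LaurentPolynomial.T j * u.2) := rfl

@[simp] theorem swp_apply {B : Type*} [AddCommGroup B] [Module F B] (u : B × B) :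
    swp F B u = (u.2, u.1) := rfl

@[simp] theorem coef_apply (j : ℤ) (u : LaurentPolynomial A × LaurentPolynomial A) :
    coef F A j u = (u.1.coeff j, u.2.coeff j) := rfl

@[simp] theorem const_apply (u : A × A) :
    const F A u = (.single 0 u.1, .single 0 u.2) := rfl

theorem shift_mul (i j i' j' : ℤ) :
    shift F A i j * shift F A i' j' = shift F A (i + i') (j + j') := by
  rw [shift, shift, shift, ← map_mul, Prod.mk_mul_mk, LaurentPolynomial.T_add,
    LaurentPolynomial.T_add]

theorem shift_zero : shift F A 0 0 = 1 := by
  rw [shift, LaurentPolynomial.T_zero]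
  exact map_one _

theorem shift_commute (i j i' j' : ℤ) : Commute (shift F A i j) (shift F A i' j') := by
  rw [Commute, SemiconjBy, shift_mul, shift_mul, add_comm i, add_comm j]

theorem shift_pow (i j : ℤ) (k : ℕ) : shift F A i j ^ k = shift F A (k * i) (k * j) := by
  rw [shift, shift, ← map_pow, Prod.pow_mk, LaurentPolynomial.T_pow, LaurentPolynomial.T_pow]

theorem actV_shift (a : A) (i j : ℤ) : Commute (actV σ a) (shift F A i j) := by
  rw [Commute, SemiconjBy]
  refine LinearMap.ext fun u => ?_
  simp only [Module.End.mul_apply, actV_apply, shift_apply, LaurentPolynomial.T_mul, mul_assoc]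

theorem swp_shift (i j : ℤ) : swp F (LaurentPolynomial A) * shift F A i j =
    shift F A j i * swp F (LaurentPolynomial A) := rfl

theorem swp_swp {B : Type*} [AddCommGroup B] [Module F B] : swp F B * swp F B = 1 := rfl

variable {σ}

theorem actV_swp {a : A} (h : σ a = a) : Commute (actV σ a) (swp F (LaurentPolynomial A)) := by
  rw [Commute, SemiconjBy]
  refine LinearMap.ext fun u => ?_
  simp [h]

theorem actV_swp_neg {a : A} (h : σ a = -a) :
    actV σ a * swp F (LaurentPolynomial A) = -(swp F (LaurentPolynomial A) * actV σ a) := by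
  refine LinearMap.ext fun u => ?_
  simp [h]

theorem actE_swp {a : A} (h : σ a = a) : Commute (actE σ a) (swp F A) := by
  rw [Commute, SemiconjBy]
  refine LinearMap.ext fun u => ?_
  simp [h]

theorem actE_swp_neg {a : A} (h : σ a = -a) :
    actE σ a * swp F A = -(swp F A * actE σ a) := by
  refine LinearMap.ext fun u => ?_
  simp [h]

/-- A homomorphism fixing the even generators and negating the odd ones. -/
structure Parity (n : ℕ) (t c x : ℕ → A) (σ : A →ₐ[F] A) : Prop where
  t : ∀ k, k + 1 < n → σ (t k) = t k
  c : ∀ k < n, σ (c k) = -c k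
  x : ∀ k < n, σ (x k) = x k

variable {ξ : F} {n : ℕ} {t c x y : ℕ → A}

theorem coeffV (h : Rev ξ n t c x y) (hσ : Parity n t c x σ) :
    Coeff ξ n (fun k => actV σ (t k)) (fun k => actV σ (c k)) (fun k => actV σ (x k))
      (fun k => actV σ (y k)) (swp F (LaurentPolynomial A)) (shift F A 1 (-1))
      (shift F A (-1) 1) where
  rev := h.map (actV σ)
  CC := swp_swp
  XXi := by rw [shift_mul]; exact shift_zero
  XiX := by rw [shift_mul]; exact shift_zero
  CX := swp_shift _ _
  tC k hk := actV_swp (hσ.t k hk)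
  cC k hk := actV_swp_neg (hσ.c k hk)
  xC k hk := actV_swp (hσ.x k hk)
  tX k hk := actV_shift _ _ _ _
  cX k hk := actV_shift _ _ _ _
  xX k hk := actV_shift _ _ _ _

theorem coeffE (h : Rev ξ n t c x y) (hσ : Parity n t c x σ) :
    Coeff ξ n (fun k => actE σ (t k)) (fun k => actE σ (c k)) (fun k => actE σ (x k))
      (fun k => actE σ (y k)) (swp F A) 1 1 where
  rev := h.map (actE σ)
  CC := swp_swp
  XXi := one_mul 1
  XiX := one_mul 1
  CX := by rw [mul_one, one_mul]
  tC k hk := actE_swp (hσ.t k hk)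
  cC k hk := actE_swp_neg (hσ.c k hk)
  xC k hk := actE_swp (hσ.x k hk)
  tX k hk := Commute.one_right _
  cX k hk := Commute.one_right _
  xX k hk := Commute.one_right _

theorem twistV (σ : A →ₐ[F] A) (d n : ℕ) (t c x : ℕ → A) :
    Twist d n (fun k => actV σ (t k)) (fun k => actV σ (c k)) (fun k => actV σ (x k))
      (swp F (LaurentPolynomial A)) (shift F A 1 (-1)) (shift F A (-1) 1) (shift F A 0 d) where
  t k hk := (actV_shift _ _ _ _).symm
  c k hk := (actV_shift _ _ _ _).symm
  x k hk := (actV_shift _ _ _ _).symm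
  XV := shift_commute _ _ _ _
  CV := by
    rw [shift_pow, mul_assoc, swp_shift, ← mul_assoc, shift_mul]
    congr 2 <;> ring
  surj w := ⟨shift F A 0 (-d) w, by
    rw [← Module.End.mul_apply, shift_mul, add_neg_cancel, add_zero, shift_zero]; rfl⟩

theorem gradedV (σ : A →ₐ[F] A) (d n : ℕ) (t c x : ℕ → A) :
    Graded n (fun k => actV σ (t k)) (fun k => actV σ (c k)) (fun k => actV σ (x k))
      (swp F (LaurentPolynomial A)) (shift F A 1 (-1)) (shift F A 0 d)
      (fun k => actE σ (t k)) (fun k => actE σ (c k)) (fun k => actE σ (x k)) (swp F A)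
      (coef F A) (const F A) (fun j => shift F A j j) (LinearMap.range (LinearMap.inl F A A)) where
  κt j k _ v := by simp only [coef_apply, actV_apply, actE_apply, AddMonoidAlgebra.coeff_single_zero_mul]
  κc j k _ v := by simp only [coef_apply, actV_apply, actE_apply, AddMonoidAlgebra.coeff_single_zero_mul]
  κx j k _ v := by simp only [coef_apply, actV_apply, actE_apply, AddMonoidAlgebra.coeff_single_zero_mul]
  κCV j v := rfl
  κι_zero u := by simp
  κι j hj u := by simp [hj]
  κρ i j v := by simp only [coef_apply, shift_apply, coeff_T_mul]
  sep v hv := by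
    refine Prod.ext ?_ ?_ <;> refine LaurentPolynomial.ext fun j => ?_
    · exact congrArg Prod.fst (hv j)
    · exact congrArg Prod.snd (hv j)
  fin v := by
    refine (v.1.coeff.support ∪ v.2.coeff.support).finite_toSet.subset fun j hj => ?_
    simp only [Set.mem_ofPred_eq, coef_apply, ne_eq, Prod.mk_eq_zero, not_and_or] at hj
    simpa using hj
  ρt j k _ := (actV_shift _ _ _ _).symm
  ρc j k _ := (actV_shift _ _ _ _).symm
  ρx j k _ := (actV_shift _ _ _ _).symm
  ρCV j := (swp_shift _ _).symm
  ρXV j := shift_commute _ _ _ _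
  ρθ j := shift_commute _ _ _ _
  XVP := by rintro _ ⟨a, rfl⟩; simp
  θP := by rintro _ ⟨a, rfl⟩; simp
  span := by
    rw [eq_top_iff]
    rintro ⟨a, b⟩ -
    rw [show ((a, b) : A × A) = (a, 0) + (0, b) by simp]
    exact Submodule.add_mem_sup ⟨a, rfl⟩ ⟨(b, 0), ⟨b, rfl⟩, rfl⟩

end Concrete

section LowerBound

variable {F}

/-- The relations pass to quotients. -/
theorem Rev.of_surjective {K Q : Type*} [AddCommGroup K] [Module F K] [AddCommGroup Q] [Module F Q]
    {ξ : F} {N : ℕ} {T C X Y : ℕ → Module.End F K} {T' C' X' Y' : ℕ → Module.End F Q}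
    (h : Rev ξ N T C X Y) (π : K →ₗ[F] Q) (hπ : Function.Surjective π)
    (hT : ∀ i, i + 1 < N → ∀ w, T' i (π w) = π (T i w)) (hC : ∀ i < N, ∀ w, C' i (π w) = π (C i w))
    (hX : ∀ i < N, ∀ w, X' i (π w) = π (X i w)) (hY : ∀ i < N, ∀ w, Y' i (π w) = π (Y i w)) :
    Rev ξ N T' C' X' Y' := by
  have ext : ∀ {a b : Module.End F Q}, (∀ w, a (π w) = b (π w)) → a = b := fun hab =>
    LinearMap.ext fun w => by obtain ⟨v, rfl⟩ := hπ w; exact hab v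
  constructor
  · intro i hi
    refine ext fun w => ?_
    simpa [hX, hY, hi] using congrArg π (LinearMap.congr_fun (h.XY i hi) w)
  · intro i hi
    refine ext fun w => ?_
    simpa [hX, hY, hi] using congrArg π (LinearMap.congr_fun (h.YX i hi) w)
  · intro i hi j hj
    refine ext fun w => ?_
    simpa [hX, hi, hj] using congrArg π (LinearMap.congr_fun (h.XX i hi j hj).eq w)
  · intro i hi
    refine ext fun w => ?_
    simpa [hC, hi] using congrArg π (LinearMap.congr_fun (h.CC i hi) w)
  · intro i hi j hj hij
    refine ext fun w => ?_
    simpa [hC, hi, hj] using congrArg π (LinearMap.congr_fun (h.anti i hi j hj hij) w)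
  · intro i hi
    refine ext fun w => ?_
    simpa [hX, hY, hC, hi] using congrArg π (LinearMap.congr_fun (h.CX i hi) w)
  · intro i hi j hj hij
    refine ext fun w => ?_
    simpa [hX, hC, hi, hj] using congrArg π (LinearMap.congr_fun (h.CXo i hi j hj hij).eq w)
  · intro i hi
    refine ext fun w => ?_
    simpa [hT, hi] using congrArg π (LinearMap.congr_fun (h.quad i hi) w)
  · intro i hi
    refine ext fun w => ?_
    have hi' : i + 1 < N := by omega
    simpa [hT, hi', hi] using congrArg π (LinearMap.congr_fun (h.braid i hi) w)
  · intro i j hij hj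
    refine ext fun w => ?_
    have hi' : i + 1 < N := by omega
    simpa [hT, hi', hj] using congrArg π (LinearMap.congr_fun (h.far i j hij hj).eq w)
  · intro i hi
    refine ext fun w => ?_
    have hi' : i < N := by omega
    simpa [hT, hC, hi', hi] using congrArg π (LinearMap.congr_fun (h.TC i hi) w)
  · intro i hi j hj h1 h2
    refine ext fun w => ?_
    simpa [hT, hC, hi, hj] using congrArg π (LinearMap.congr_fun (h.TCo i hi j hj h1 h2).eq w)
  · intro i hi j hj h1 h2
    refine ext fun w => ?_
    simpa [hT, hX, hi, hj] using congrArg π (LinearMap.congr_fun (h.TXo i hi j hj h1 h2).eq w)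
  · intro i hi
    refine ext fun w => ?_
    have hi' : i < N := by omega
    simpa [hT, hX, hC, hi', hi] using congrArg π (LinearMap.congr_fun (h.cross i hi) w)

theorem fev_map_apply {K Q : Type*} [AddCommGroup K] [Module F K] [AddCommGroup Q] [Module F Q]
    (π : K →ₗ[F] Q) {X : Module.End F K} {X' : Module.End F Q} (hX : ∀ w, X' (π w) = π (X w))
    (d : ℕ) (aa : ℕ → F) (w : K) : fev d aa X' (π w) = π (fev d aa X w) := by
  have hp : ∀ i : ℕ, (X' ^ i) (π w) = π ((X ^ i) w) := fun i => by
    induction i with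
    | zero => rfl
    | succ i ih => rw [pow_succ', pow_succ', Module.End.mul_apply, ih, hX]; rfl
  simp only [fev, LinearMap.sum_apply, LinearMap.smul_apply, hp, map_sum, map_smul]

/-- Vectors whose components have degrees between `0` and `d - 1`. -/
noncomputable def short (F : Type) [Field F] (A : Type*) [Ring A] [Algebra F A] (n d : ℕ) :
    (Fin (n + 1) → Fin d → A × A) →ₗ[F]
      (Fin (n + 1) → LaurentPolynomial A × LaurentPolynomial A) where
  toFun g m := ∑ k : Fin d, shift F A k k (const F A (g m k))
  map_add' g g' := by funext m; simp only [Pi.add_apply, map_add, Finset.sum_add_distrib]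
  map_smul' a g := by
    funext m; simp only [Pi.smul_apply, map_smul, RingHom.id_apply, Finset.smul_sum]

theorem coef_shift_const {A : Type*} [Ring A] [Algebra F A] (i j : ℤ) (u : A × A) :
    coef F A j (shift F A i i (const F A u)) = if j = i then u else 0 := by
  have D := gradedV (AlgHom.id F A) 0 0 (fun _ => 0) (fun _ => 0) (fun _ => 0)
  rw [D.κρ i j, D.κι']
  simp only [sub_eq_zero]

theorem coef_short {A : Type*} [Ring A] [Algebra F A] {n d : ℕ}
    (g : Fin (n + 1) → Fin d → A × A) (m : Fin (n + 1)) (j : ℤ) :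
    coef F A j (short F A n d g m) = ∑ k : Fin d, if j = k then g m k else 0 := by
  simp only [short, LinearMap.coe_mk, AddHom.coe_mk, map_sum, coef_shift_const]

variable {A : Type} [Ring A] [Algebra F A] {σ : A →ₐ[F] A} {ξ : F} {n d : ℕ} {aa : ℕ → F}
  {t c x y : ℕ → A}

/-- Every subspace containing `1` and stable under the generators is everything. -/
def Generates (F : Type) [Field F] {A : Type*} [Ring A] [Algebra F A] (n : ℕ)
    (t c x y : ℕ → A) : Prop :=
  ∀ S : Submodule F A, 1 ∈ S → (∀ k, k + 1 < n → ∀ a ∈ S, t k * a ∈ S) →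
    (∀ k < n, ∀ a ∈ S, c k * a ∈ S) → (∀ k < n, ∀ a ∈ S, x k * a ∈ S) →
    (∀ k < n, ∀ a ∈ S, y k * a ∈ S) → S = ⊤

section Fill

variable {h : Coeff ξ n (fun k => actV σ (t k)) (fun k => actV σ (c k)) (fun k => actV σ (x k))
      (fun k => actV σ (y k)) (swp F (LaurentPolynomial A)) (shift F A 1 (-1)) (shift F A (-1) 1)}
    {C X Y : ℕ → Module.End F (Fin (n + 1) → LaurentPolynomial A × LaurentPolynomial A)}

theorem Full.Y_eps_zero (H : Full h C X Y) {j : ℕ} (hj : j < n)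
    (v : LaurentPolynomial A × LaurentPolynomial A) :
    Y (j + 1) (eps F _ n 0 v) = eps F _ n 0 (actV σ (y j) v) := by
  have h1 : X (j + 1) (eps F _ n 0 (actV σ (y j) v)) = eps F _ n 0 v := by
    rw [H.X_eps_le (Nat.zero_le j) hj]
    congr 1
    exact LinearMap.congr_fun (h.rev.XY j hj) v
  rw [← h1, ← Module.End.mul_apply, H.rev.YX (j + 1) (by omega)]
  rfl

theorem short_mem (H : Full h C X Y) (hσ : Function.Surjective σ) (hgen : Generates F n t c x y)
    {S : Submodule F (Fin (n + 1) → LaurentPolynomial A × LaurentPolynomial A)}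
    (hS : eps F _ n 0 (const F A (1, 0)) ∈ S)
    (hT : ∀ k < n, ∀ w ∈ S, opT ξ n (fun k => actV σ (t k)) k w ∈ S)
    (hC : ∀ k ≤ n, ∀ w ∈ S, C k w ∈ S) (hX : ∀ k ≤ n, ∀ w ∈ S, X k w ∈ S)
    (hY : ∀ k ≤ n, ∀ w ∈ S, Y k w ∈ S) (g : Fin (n + 1) → Fin d → A × A) :
    short F A n d g ∈ S := by
  have hA : ∀ v : LaurentPolynomial A × LaurentPolynomial A, eps F _ n 0 v ∈ S →
      ∀ a : A, eps F _ n 0 (actV σ a v) ∈ S := fun v hv a => by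
    let φ : A →ₗ[F] (Fin (n + 1) → LaurentPolynomial A × LaurentPolynomial A) :=
      eps F _ n 0 ∘ₗ LinearMap.applyₗ v ∘ₗ (actV σ).toLinearMap
    have e : ∀ a b, φ (a * b) = eps F _ n 0 (actV σ a (actV σ b v)) := fun a b => by
      show eps F _ n 0 (actV σ (a * b) v) = _
      rw [map_mul]; rfl
    suffices hS : S.comap φ = ⊤ by
      have := Submodule.mem_top (R := F) (x := a)
      rwa [← hS] at this
    refine hgen _ ?_ ?_ ?_ ?_ ?_
    · show eps F _ n 0 (actV σ 1 v) ∈ S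
      rw [map_one]; exact hv
    · intro k hk b hb
      rw [Submodule.mem_comap, e]
      have := hT (k + 1) (by omega) _ hb
      change opT ξ n _ (k + 1) (eps F _ n 0 (actV σ b v)) ∈ S at this
      rwa [opT_eps_lt (Nat.succ_pos k) (by omega)] at this
    · intro k hk b hb
      rw [Submodule.mem_comap, e, ← H.C_eps_le (Nat.zero_le k) hk]
      exact hC (k + 1) (by omega) _ hb
    · intro k hk b hb
      rw [Submodule.mem_comap, e, ← H.X_eps_le (Nat.zero_le k) hk]
      exact hX (k + 1) (by omega) _ hb
    · intro k hk b hb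
      rw [Submodule.mem_comap, e, ← H.Y_eps_zero hk]
      exact hY (k + 1) (by omega) _ hb
  have hk : ∀ k : ℕ, eps F _ n 0 (shift F A k k (const F A (1, 0))) ∈ S := fun k => by
    induction k with
    | zero => simpa [shift_zero] using hS
    | succ k ih =>
      have := hX 0 (Nat.zero_le n) _ ih
      rw [H.X_zero_eps] at this
      convert this using 2
      rw [← Module.End.mul_apply, shift_mul]
      simp [add_comm (1 : ℤ)]
  have hk' : ∀ k : ℕ, eps F _ n 0 (shift F A k k (const F A (0, 1))) ∈ S := fun k => by
    have := hC 0 (Nat.zero_le n) _ (hk k)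
    rw [H.C_zero_eps] at this
    convert this using 2
    simp
  have h0 : ∀ (k : ℕ) (u : A × A), eps F _ n 0 (shift F A k k (const F A u)) ∈ S := fun k u => by
    obtain ⟨b, hb⟩ := hσ u.2
    have := add_mem (hA _ (hk k) u.1) (hA _ (hk' k) b)
    rw [← map_add] at this
    convert this using 2
    simp [hb, LaurentPolynomial.T_mul]
  have hm : ∀ m ≤ n, ∀ (k : ℕ) (u : A × A),
      eps F _ n m (shift F A k k (const F A u)) ∈ S := fun m => by
    induction m with
    | zero => exact fun _ => h0
    | succ m ih =>
      intro hm k u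
      have := hT m (by omega) _ (ih (by omega) k u)
      rwa [opT_eps_eq (by omega)] at this
  rw [sum_eps (F := F) (short F A n d g)]
  refine Submodule.sum_mem _ fun m _ => ?_
  show eps F _ n m (∑ k : Fin d, shift F A k k (const F A (g m k))) ∈ S
  rw [map_sum]
  exact Submodule.sum_mem _ fun k _ => hm m (by omega) k _

end Fill

/-- The inductive model: a quotient module for the relations with `n + 1` strands in which the
submodule generated by a suitable vector is large. -/
theorem exists_model [FiniteDimensional F A] (h : Rev ξ n t c x y) (hσ : Parity n t c x σ)
    (hσs : Function.Surjective σ) (hgen : Generates F n t c x y) (hn : 0 < n)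
    (hf : GoodPoly F d aa) (hx : fev d aa (x (n - 1)) = 0) :
    ∃ (Q : Type) (_ : AddCommGroup Q) (_ : Module F Q) (T C X Y : ℕ → Module.End F Q) (z : Q),
      Rev ξ (n + 1) T C X Y ∧ fev d aa (X n) = 0 ∧
      ∀ S : Submodule F Q, FiniteDimensional F S → z ∈ S → (∀ k < n, ∀ w ∈ S, T k w ∈ S) →
        (∀ k ≤ n, ∀ w ∈ S, C k w ∈ S) → (∀ k ≤ n, ∀ w ∈ S, X k w ∈ S) →
        (∀ k ≤ n, ∀ w ∈ S, Y k w ∈ S) →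
        2 * d * (n + 1) * Module.finrank F A ≤ Module.finrank F S := by
  obtain ⟨C, X, Y, H⟩ := (coeffV h hσ).exists_full
  obtain ⟨C', X', Y', H'⟩ := (coeffE h hσ).exists_full
  have hx' : fev d aa (actV σ (x (n - 1))) = 0 := by rw [← map_fev, hx, map_zero]
  have hθ := twistV σ d n t c x
  obtain ⟨sT, sC, sX, sY, sf⟩ := H.ker_top_stable hx' hn hf hθ
  set N := ker ξ n (fun k => actV σ (t k)) (psi d aa n (X n) (shift F A 0 d)) ⊤ with hN
  classical
  let desc : (Module.End F (Fin (n + 1) → LaurentPolynomial A × LaurentPolynomial A)) →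
      Module.End F (_ ⧸ N) := fun B => if hB : N ≤ N.comap B then N.mapQ N B hB else 0
  have hdesc : ∀ B, (∀ w ∈ N, B w ∈ N) → ∀ w, desc B (N.mkQ w) = N.mkQ (B w) := fun B hB w => by
    simp only [desc, dif_pos (show N ≤ N.comap B from hB)]
    rfl
  refine ⟨_ ⧸ N, inferInstance, inferInstance,
    fun k => desc (opT ξ n (fun k => actV σ (t k)) k), fun k => desc (C k), fun k => desc (X k),
    fun k => desc (Y k), N.mkQ (eps F _ n 0 (const F A (1, 0))), ?_, ?_, ?_⟩
  · exact H.rev.of_surjective N.mkQ N.mkQ_surjective (fun i hi => hdesc _ (sT i (by omega)))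
      (fun i hi => hdesc _ (sC i (by omega))) (fun i hi => hdesc _ (sX i (by omega)))
      (fun i hi => hdesc _ (sY i (by omega)))
  · refine LinearMap.ext fun w => ?_
    obtain ⟨v, rfl⟩ := N.mkQ_surjective w
    rw [fev_map_apply N.mkQ (hdesc _ (sX n le_rfl))]
    exact (Submodule.Quotient.mk_eq_zero N).2 (sf v)
  · intro S hS hz h1 h2 h3 h4
    have hmem : ∀ g, N.mkQ (short F A n d g) ∈ S := fun g =>
      short_mem H hσs hgen (S := S.comap N.mkQ) hz
        (fun k hk w hw => by
          rw [Submodule.mem_comap, ← hdesc _ (sT k hk)]; exact h1 k hk _ hw)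
        (fun k hk w hw => by
          rw [Submodule.mem_comap, ← hdesc _ (sC k hk)]; exact h2 k hk _ hw)
        (fun k hk w hw => by
          rw [Submodule.mem_comap, ← hdesc _ (sX k hk)]; exact h3 k hk _ hw)
        (fun k hk w hw => by
          rw [Submodule.mem_comap, ← hdesc _ (sY k hk)]; exact h4 k hk _ hw) g
    let φ : (Fin (n + 1) → Fin d → A × A) →ₗ[F] S :=
      (N.mkQ ∘ₗ short F A n d).codRestrict S hmem
    have hφ : Function.Injective φ := by
      refine (injective_iff_map_eq_zero φ).2 fun g hg => ?_
      have hgN : short F A n d g ∈ N :=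
        (Submodule.Quotient.mk_eq_zero N).1 (congrArg Subtype.val hg)
      have h0 : short F A n d g = 0 := by
        refine (gradedV σ d n t c x).eq_zero_of_mem_ker H H' hn hf hx' hθ hgN fun j hj => ?_
        funext m
        show coef F A j (short F A n d g m) = 0
        rw [coef_short]
        refine Finset.sum_eq_zero fun k _ => if_neg ?_
        have := k.2
        omega
      funext m k
      have := coef_short (F := F) g m k
      rw [h0, Finset.sum_eq_single k] at this
      · exact (this.trans (if_pos rfl)).symm.trans (map_zero (coef F A k))
      · intro k' _ hk'
        refine if_neg fun e => hk' (Fin.ext ?_)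
        exact_mod_cast e.symm
      · simp
    have := LinearMap.finrank_le_finrank_of_injective hφ
    rw [Module.finrank_pi_fintype] at this
    simp only [Module.finrank_pi_fintype, Module.finrank_prod, Finset.sum_const, Finset.card_univ,
      Fintype.card_fin, smul_eq_mul] at this
    calc _ = (n + 1) * (d * (Module.finrank F A + Module.finrank F A)) := by ring
      _ ≤ _ := this

end LowerBound

section OneStep

variable {F} {R : Type*} [Ring R] [Algebra F R]

/-- The span of `M T M` and of `X^i M`, `X^i C M` for `i < m`. -/
def layer (M : Subalgebra F R) (T C X : R) (m : ℕ) : Submodule F R :=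
  Submodule.span F {w | (∃ a ∈ M, ∃ b ∈ M, w = a * T * b) ∨
    ∃ i < m, ∃ b ∈ M, w = X ^ i * b ∨ w = X ^ i * C * b}

variable {M : Subalgebra F R} {T C X Y : R} {m : ℕ}

theorem T_mem_layer {a b : R} (ha : a ∈ M) (hb : b ∈ M) : a * T * b ∈ layer M T C X m :=
  Submodule.subset_span (Or.inl ⟨a, ha, b, hb, rfl⟩)

theorem X_mem_layer {i : ℕ} (hi : i < m) {b : R} (hb : b ∈ M) : X ^ i * b ∈ layer M T C X m :=
  Submodule.subset_span (Or.inr ⟨i, hi, b, hb, Or.inl rfl⟩)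

theorem XC_mem_layer {i : ℕ} (hi : i < m) {b : R} (hb : b ∈ M) :
    X ^ i * C * b ∈ layer M T C X m :=
  Submodule.subset_span (Or.inr ⟨i, hi, b, hb, Or.inr rfl⟩)

theorem mem_layer (hm : 0 < m) {b : R} (hb : b ∈ M) : b ∈ layer M T C X m := by
  simpa using X_mem_layer (T := T) (C := C) (X := X) hm hb

theorem C_mem_layer (hm : 0 < m) {b : R} (hb : b ∈ M) : C * b ∈ layer M T C X m := by
  simpa using XC_mem_layer (T := T) (C := C) (X := X) hm hb

theorem layer_map {S : Submodule F R} (φ : R →ₗ[F] R)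
    (h1 : ∀ a ∈ M, ∀ b ∈ M, φ (a * T * b) ∈ S) (h2 : ∀ i < m, ∀ b ∈ M, φ (X ^ i * b) ∈ S)
    (h3 : ∀ i < m, ∀ b ∈ M, φ (X ^ i * C * b) ∈ S) {w : R} (hw : w ∈ layer M T C X m) :
    φ w ∈ S := by
  suffices h : layer M T C X m ≤ S.comap φ from h hw
  refine Submodule.span_le.2 ?_
  rintro _ (⟨a, ha, b, hb, rfl⟩ | ⟨i, hi, b, hb, rfl | rfl⟩)
  exacts [h1 a ha b hb, h2 i hi b hb, h3 i hi b hb]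

theorem layer_mono {m m' : ℕ} (h : m ≤ m') : layer M T C X m ≤ layer M T C X m' := fun w hw =>
  layer_map LinearMap.id (fun _ ha _ hb => T_mem_layer ha hb)
    (fun _ hi _ hb => X_mem_layer (by omega) hb) (fun _ hi _ hb => XC_mem_layer (by omega) hb) hw

/-- The compatibility of a subalgebra with the generators of a further strand. -/
structure Strand (M : Subalgebra F R) (C X Y : R) : Prop where
  XY : X * Y = 1
  YX : Y * X = 1
  CC : C * C = 1
  CX : C * X = Y * C
  MX : ∀ a ∈ M, X * a = a * X
  MC : ∀ a ∈ M, ∃ a' ∈ M, C * a = a' * C ∧ a * C = C * a'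

namespace Strand

theorem XpM (h : Strand M C X Y) (i : ℕ) {a : R} (ha : a ∈ M) : X ^ i * a = a * X ^ i :=
  ((show Commute X a from h.MX a ha).pow_left i).eq

theorem CXp (h : Strand M C X Y) (i : ℕ) : C * X ^ i = Y ^ i * C :=
  (show SemiconjBy C X Y from h.CX).pow_right i

theorem mul_mem_layer (h : Strand M C X Y) {a w : R} (ha : a ∈ M) (hw : w ∈ layer M T C X m) :
    a * w ∈ layer M T C X m := by
  refine layer_map (LinearMap.mulLeft F a) (fun u hu v hv => ?_) (fun i hi v hv => ?_)
    (fun i hi v hv => ?_) hw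
  · rw [LinearMap.mulLeft_apply, ← mul_assoc, ← mul_assoc]
    exact T_mem_layer (mul_mem ha hu) hv
  · rw [LinearMap.mulLeft_apply, ← mul_assoc, ← h.XpM i ha, mul_assoc]
    exact X_mem_layer hi (mul_mem ha hv)
  · obtain ⟨a', ha', -, e⟩ := h.MC a ha
    rw [LinearMap.mulLeft_apply, ← mul_assoc, ← mul_assoc, ← h.XpM i ha, mul_assoc (X ^ i), e,
      ← mul_assoc, mul_assoc _ a']
    exact XC_mem_layer hi (mul_mem ha' hv)

theorem layer_mul_mem {a w : R} (ha : a ∈ M) (hw : w ∈ layer M T C X m) :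
    w * a ∈ layer M T C X m := by
  refine layer_map (LinearMap.mulRight F a) (fun u hu v hv => ?_) (fun i hi v hv => ?_)
    (fun i hi v hv => ?_) hw <;> rw [LinearMap.mulRight_apply, mul_assoc]
  · exact T_mem_layer hu (mul_mem hv ha)
  · exact X_mem_layer hi (mul_mem hv ha)
  · exact XC_mem_layer hi (mul_mem hv ha)

theorem X_mul_layer (h : Strand M C X Y) {m' : ℕ} (hm : m + 1 ≤ m') (hm2 : 2 ≤ m')
    (hXT : X * T ∈ layer M T C X 2) {w : R}
    (hw : w ∈ layer M T C X m) : X * w ∈ layer M T C X m' := by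
  refine layer_map (LinearMap.mulLeft F X) (fun u hu v hv => ?_) (fun i hi v hv => ?_)
    (fun i hi v hv => ?_) hw
  · rw [LinearMap.mulLeft_apply, ← mul_assoc, ← mul_assoc, h.MX u hu, mul_assoc u]
    exact layer_mono hm2 (layer_mul_mem hv (h.mul_mem_layer hu hXT))
  · rw [LinearMap.mulLeft_apply, ← mul_assoc, ← pow_succ']
    exact X_mem_layer (by omega) hv
  · rw [LinearMap.mulLeft_apply, ← mul_assoc, ← mul_assoc, ← pow_succ']
    exact XC_mem_layer (by omega) hv

theorem layer_mul_C (h : Strand M C X Y) (hm : 0 < m) (hTC : T * C ∈ layer M T C X 1) {w : R}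
    (hw : w ∈ layer M T C X m) : w * C ∈ layer M T C X m := by
  refine layer_map (LinearMap.mulRight F C) (fun u hu v hv => ?_) (fun i hi v hv => ?_)
    (fun i hi v hv => ?_) hw <;> obtain ⟨v', hv', -, e⟩ := h.MC v hv <;>
    rw [LinearMap.mulRight_apply, mul_assoc, e, ← mul_assoc]
  · rw [mul_assoc u]
    exact layer_mono hm (layer_mul_mem hv' (h.mul_mem_layer hu hTC))
  · exact XC_mem_layer hi hv'
  · rw [mul_assoc _ C C, h.CC, mul_one]
    exact X_mem_layer hi hv'

theorem layer_succ_le (h : Strand M C X Y) {d : ℕ} (hd : 0 < d) (hTC : T * C ∈ layer M T C X 1)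
    (hXd : X ^ d ∈ layer M T C X d) : layer M T C X (d + 1) ≤ layer M T C X d := fun w hw => by
  refine layer_map LinearMap.id (fun u hu v hv => T_mem_layer hu hv) (fun i hi v hv => ?_)
    (fun i hi v hv => ?_) hw
  · rcases Nat.lt_succ_iff_lt_or_eq.1 hi with hi | rfl
    · exact X_mem_layer hi hv
    · exact layer_mul_mem hv hXd
  · rcases Nat.lt_succ_iff_lt_or_eq.1 hi with hi | rfl
    · exact XC_mem_layer hi hv
    · exact layer_mul_mem hv (h.layer_mul_C hd hTC hXd)

/-- Stability of the top layer under the generators. -/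
theorem layer_stable (h : Strand M C X Y) {d : ℕ} (hd : 0 < d) (hTC : T * C ∈ layer M T C X 1)
    (hXT : X * T ∈ layer M T C X 2) (hXd : X ^ d ∈ layer M T C X d)
    (hCT : ∃ c ∈ M, C * T = T * c) [FiniteDimensional F (layer M T C X d)] :
    (∀ w ∈ layer M T C X d, X * w ∈ layer M T C X d) ∧
    (∀ w ∈ layer M T C X d, Y * w ∈ layer M T C X d) ∧
    ∀ w ∈ layer M T C X d, C * w ∈ layer M T C X d := by
  have hX : ∀ w ∈ layer M T C X d, X * w ∈ layer M T C X d := fun w hw =>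
    h.layer_succ_le hd hTC hXd (h.X_mul_layer le_rfl (by omega) hXT hw)
  have hY : ∀ w ∈ layer M T C X d, Y * w ∈ layer M T C X d := fun w hw => by
    let φ : layer M T C X d →ₗ[F] layer M T C X d :=
      (LinearMap.mulLeft F X).restrict hX
    have hφ : Function.Injective φ := fun u v huv => by
      have e : X * (u : R) = X * (v : R) := congrArg Subtype.val huv
      have := congrArg (Y * ·) e
      simp only [← mul_assoc, h.YX, one_mul] at this
      exact Subtype.ext this
    obtain ⟨v, hv⟩ := (LinearMap.injective_iff_surjective.1 hφ) ⟨w, hw⟩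
    have e : X * (v : R) = w := congrArg Subtype.val hv
    rw [← e, ← mul_assoc, h.YX, one_mul]
    exact v.2
  have hYp : ∀ (i : ℕ), ∀ w ∈ layer M T C X d, Y ^ i * w ∈ layer M T C X d := fun i => by
    induction i with
    | zero => intro w hw; simpa using hw
    | succ i ih => intro w hw; rw [pow_succ', mul_assoc]; exact hY _ (ih w hw)
  refine ⟨hX, hY, fun w hw => layer_map (LinearMap.mulLeft F C) (fun u hu v hv => ?_)
    (fun i hi v hv => ?_) (fun i hi v hv => ?_) hw⟩
  · obtain ⟨u', hu', e, -⟩ := h.MC u hu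
    obtain ⟨c, hc, e'⟩ := hCT
    rw [LinearMap.mulLeft_apply, ← mul_assoc, ← mul_assoc, e, mul_assoc u', e', ← mul_assoc,
      mul_assoc _ c]
    exact T_mem_layer hu' (mul_mem hc hv)
  · rw [LinearMap.mulLeft_apply, ← mul_assoc, h.CXp, mul_assoc]
    exact hYp i _ (C_mem_layer hd hv)
  · rw [LinearMap.mulLeft_apply, ← mul_assoc, ← mul_assoc, h.CXp, mul_assoc _ C C, h.CC, mul_one]
    exact hYp i _ (mem_layer hd hv)

end Strand

/-- The relations linking a strand to the one below it. -/
structure Link (ξ : F) (M : Subalgebra F R) (T c C x X : R) : Prop where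
  cM : c ∈ M
  xM : x ∈ M
  quad : T * T = ξ • T + 1
  CT : C * T = T * c
  TC : T * C = c * T - ξ • (c - C)
  XT : X * T = T * x + ξ • X + ξ • (c * C * x)
  TX : T * X = x * T + ξ • X - ξ • (c * C * X)
  cross : (T + ξ • (c * C)) * x * T = X
  Cx : C * x = x * C

namespace Link

variable {ξ : F} {c x : R}

theorem TC_mem (l : Link ξ M T c C x X) : T * C ∈ layer M T C X 1 := by
  rw [l.TC, smul_sub]
  refine sub_mem ?_ (sub_mem ?_ ?_)
  · simpa using T_mem_layer (T := T) (C := C) (X := X) (m := 1) l.cM (one_mem M)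
  · exact Submodule.smul_mem _ _ (mem_layer one_pos l.cM)
  · exact Submodule.smul_mem _ _ (by
      simpa using C_mem_layer (T := T) (C := C) (X := X) one_pos (one_mem M))

theorem XT_mem (l : Link ξ M T c C x X) (h : Strand M C X Y) : X * T ∈ layer M T C X 2 := by
  rw [l.XT]
  refine add_mem (add_mem ?_ ?_) ?_
  · simpa using T_mem_layer (T := T) (C := C) (X := X) (m := 2) (one_mem M) l.xM
  · exact Submodule.smul_mem _ _ (by
      simpa using X_mem_layer (T := T) (C := C) (X := X) one_lt_two (one_mem M))
  · rw [mul_assoc]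
    exact Submodule.smul_mem _ _ (h.mul_mem_layer l.cM (C_mem_layer two_pos l.xM))

theorem TxT_succ (l : Link ξ M T c C x X) (h : Strand M C X Y) (i : ℕ) :
    T * x ^ (i + 1) * T =
      X * (T * x ^ i * T) - ξ • (x ^ i * (X * T)) - ξ • (c * x ^ (i + 1) * T * c) := by
  have hCx : C * x ^ (i + 1) = x ^ (i + 1) * C :=
    ((show Commute C x from l.Cx).pow_right (i + 1)).eq
  have h1 : T * x = X * (T - ξ • 1) - ξ • (c * C * x) := by
    rw [← l.cross]
    have : T * (T - ξ • (1 : R)) = 1 := by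
      rw [mul_sub, l.quad, mul_smul_comm, mul_one, add_sub_cancel_left]
    rw [mul_assoc _ T, this, mul_one, add_mul, smul_mul_assoc, add_sub_cancel_right]
  have h2 : X * x ^ i = x ^ i * X := h.MX _ (pow_mem l.xM i)
  calc T * x ^ (i + 1) * T = (T * x) * (x ^ i * T) := by rw [pow_succ']; simp only [mul_assoc]
    _ = X * (T * x ^ i * T) - ξ • (X * x ^ i * T) - ξ • (c * (C * x ^ (i + 1)) * T) := by
        rw [h1, sub_mul, mul_sub, sub_mul, pow_succ']
        simp only [smul_mul_assoc, mul_smul_comm, mul_one, mul_assoc]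
    _ = _ := by
        rw [h2, hCx]
        simp only [mul_assoc, l.CT]

theorem TxT_mem (l : Link ξ M T c C x X) (h : Strand M C X Y) (i : ℕ) :
    T * x ^ (i + 1) * T - X ^ (i + 1) ∈ layer M T C X (i + 1) := by
  induction i with
  | zero =>
    rw [l.TxT_succ h, pow_zero, mul_one, l.quad, mul_add, mul_smul_comm, mul_one, one_mul,
      add_sub_cancel_left, zero_add, pow_one, pow_one, sub_sub_cancel_left]
    exact neg_mem (Submodule.smul_mem _ _ (T_mem_layer (mul_mem l.cM l.xM) l.cM))
  | succ i ih =>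
    rw [l.TxT_succ h (i + 1), pow_succ' X (i + 1)]
    have := h.X_mul_layer (m' := i + 2) le_rfl (by omega) (l.XT_mem h) ih
    rw [mul_sub] at this
    rw [sub_right_comm, sub_right_comm _ (ξ • _) (X * X ^ (i + 1))]
    refine sub_mem (sub_mem this ?_) ?_
    · exact Submodule.smul_mem _ _
        (layer_mono (by omega) (h.mul_mem_layer (pow_mem l.xM _) (l.XT_mem h)))
    · exact Submodule.smul_mem _ _ (T_mem_layer (mul_mem l.cM (pow_mem l.xM _)) l.cM)

theorem TxT_mem' (l : Link ξ M T c C x X) (h : Strand M C X Y) (i : ℕ) :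
    T * x ^ i * T ∈ layer M T C X (i + 1) := by
  cases i with
  | zero =>
    rw [pow_zero, mul_one, l.quad]
    refine add_mem (Submodule.smul_mem _ _ ?_) (mem_layer (by omega) (one_mem M))
    simpa using T_mem_layer (T := T) (C := C) (X := X) (m := 0 + 1) (one_mem M) (one_mem M)
  | succ i =>
    have := layer_mono (show i + 1 ≤ i + 2 by omega) (l.TxT_mem h i)
    have hX : X ^ (i + 1) ∈ layer M T C X (i + 2) := by
      simpa using X_mem_layer (T := T) (C := C) (X := X) (show i + 1 < i + 2 by omega) (one_mem M)
    simpa using add_mem this hX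

theorem TxcT_mem (l : Link ξ M T c C x X) (h : Strand M C X Y) (i : ℕ) :
    T * (x ^ i * c) * T ∈ layer M T C X (i + 1) := by
  have e : c * T = T * C + ξ • c - ξ • C := by rw [l.TC, smul_sub]; abel
  have hCx : x ^ i * C = C * x ^ i := ((show Commute C x from l.Cx).pow_right i).eq.symm
  have : T * (x ^ i * c) * T =
      T * x ^ i * T * C + ξ • (1 * T * (x ^ i * c)) - ξ • (T * C * x ^ i) := by
    rw [one_mul, mul_assoc T C, ← hCx, mul_assoc, mul_assoc, e]
    simp only [mul_add, mul_sub, mul_smul_comm, mul_assoc]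
  rw [this]
  refine sub_mem (add_mem ?_ ?_) ?_
  · exact h.layer_mul_C (Nat.succ_pos i) l.TC_mem (l.TxT_mem' h i)
  · exact Submodule.smul_mem _ _ (T_mem_layer (one_mem M) (mul_mem (pow_mem l.xM i) l.cM))
  · exact Submodule.smul_mem _ _ (layer_mono (by omega)
      (Strand.layer_mul_mem (pow_mem l.xM i) l.TC_mem))

/-- The top layer is stable under left multiplication by all generators. -/
theorem layer_stable (l : Link ξ M T c C x X) (h : Strand M C X Y) {d : ℕ} (hd : 0 < d)
    {B : Subalgebra F R} (hBM : B ≤ M) (hTB : ∀ b ∈ B, T * b = b * T) {s : R}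
    (hs : T * s * T ∈ layer M T C X d)
    (hM : M.toSubmodule ≤ layer B s c x d) [FiniteDimensional F (layer M T C X d)] :
    (∀ w ∈ layer M T C X d, T * w ∈ layer M T C X d) ∧
    (∀ w ∈ layer M T C X d, C * w ∈ layer M T C X d) ∧
    (∀ w ∈ layer M T C X d, X * w ∈ layer M T C X d) ∧
    ∀ w ∈ layer M T C X d, Y * w ∈ layer M T C X d := by
  have hTMT : ∀ a ∈ M, T * a * T ∈ layer M T C X d := fun a ha => by
    refine layer_map (LinearMap.mulRight F T ∘ₗ LinearMap.mulLeft F T) (fun u hu v hv => ?_)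
      (fun i hi v hv => ?_) (fun i hi v hv => ?_) (hM ha) <;>
      rw [LinearMap.comp_apply, LinearMap.mulRight_apply, LinearMap.mulLeft_apply]
    · have : T * (u * s * v) * T = u * (T * s * T) * v := by
        rw [← mul_assoc, ← mul_assoc, hTB u hu, mul_assoc _ v, ← hTB v hv]
        simp only [mul_assoc]
      rw [this]
      exact Strand.layer_mul_mem (hBM hv) (h.mul_mem_layer (hBM hu) hs)
    · rw [← mul_assoc, mul_assoc _ v, ← hTB v hv, ← mul_assoc]
      exact Strand.layer_mul_mem (hBM hv) (layer_mono (by omega) (l.TxT_mem' h i))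
    · rw [← mul_assoc, mul_assoc _ v, ← hTB v hv, ← mul_assoc]
      exact Strand.layer_mul_mem (hBM hv) (layer_mono (by omega) (l.TxcT_mem h i))
  have hXd : X ^ d ∈ layer M T C X d := by
    obtain ⟨e, rfl⟩ : ∃ e, d = e + 1 := ⟨d - 1, by omega⟩
    simpa using sub_mem (hTMT _ (pow_mem l.xM (e + 1))) (l.TxT_mem h e)
  obtain ⟨hX, hY, hC⟩ := h.layer_stable hd l.TC_mem (l.XT_mem h) hXd ⟨c, l.cM, l.CT⟩
  have hTX : ∀ i, ∀ g, T * g ∈ layer M T C X d → (∀ j, X ^ j * g ∈ layer M T C X d) →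
      T * (X ^ i * g) ∈ layer M T C X d := fun i g h0 hg => by
    induction i with
    | zero => simpa using h0
    | succ i ih =>
      have : T * (X ^ (i + 1) * g) = x * (T * (X ^ i * g)) + ξ • (X ^ (i + 1) * g) -
          ξ • (c * (C * (X ^ (i + 1) * g))) := by
        rw [pow_succ', mul_assoc, ← mul_assoc T, l.TX]
        simp only [add_mul, sub_mul, smul_mul_assoc, mul_assoc]
      rw [this]
      exact sub_mem (add_mem (h.mul_mem_layer l.xM ih) (Submodule.smul_mem _ _ (hg _)))
        (Submodule.smul_mem _ _ (h.mul_mem_layer l.cM (hC _ (hg _))))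
  have hXp : ∀ w ∈ layer M T C X d, ∀ i : ℕ, X ^ i * w ∈ layer M T C X d := fun w hw i => by
    induction i with
    | zero => simpa using hw
    | succ i ih => rw [pow_succ', mul_assoc]; exact hX _ ih
  refine ⟨fun w hw => layer_map (LinearMap.mulLeft F T) (fun u hu v hv => ?_)
    (fun i hi v hv => ?_) (fun i hi v hv => ?_) hw, hC, hX, hY⟩ <;> rw [LinearMap.mulLeft_apply]
  · rw [← mul_assoc, ← mul_assoc]
    exact Strand.layer_mul_mem hv (hTMT u hu)
  · refine hTX i v ?_ (hXp v (mem_layer hd hv))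
    simpa using T_mem_layer (one_mem M) hv
  · rw [mul_assoc]
    refine hTX i (C * v) ?_ (hXp _ (C_mem_layer hd hv))
    rw [← mul_assoc]
    exact layer_mono (by omega) (Strand.layer_mul_mem hv l.TC_mem)

end Link

end OneStep

section Spanning

variable {F} {R : Type*} [Ring R] [Algebra F R]

theorem adjoin_le_of_stable {G : Set R} {S : Submodule F R} (h1 : 1 ∈ S)
    (hG : ∀ g ∈ G, ∀ w ∈ S, g * w ∈ S) : (Algebra.adjoin F G).toSubmodule ≤ S := fun a ha => by
  suffices h : ∀ w ∈ S, a * w ∈ S by simpa using h 1 h1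
  refine Algebra.adjoin_induction (p := fun a _ => ∀ w ∈ S, a * w ∈ S) (fun g hg => hG g hg)
    (fun r w hw => ?_) (fun a b _ _ ha hb w hw => ?_) (fun a b _ _ ha hb w hw => ?_) ha
  · rw [← Algebra.smul_def]
    exact S.smul_mem r hw
  · rw [add_mul]
    exact add_mem (ha w hw) (hb w hw)
  · rw [mul_assoc]
    exact ha _ (hb w hw)

/-- The subalgebra generated by the first `k` strands. -/
def lower (F : Type) [Field F] {R : Type*} [Ring R] [Algebra F R] (T C X Y : ℕ → R) (k : ℕ) :
    Subalgebra F R :=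
  Algebra.adjoin F {r | (∃ i, i + 1 < k ∧ r = T i) ∨ ∃ i < k, r = C i ∨ r = X i ∨ r = Y i}

/-- The generator linking strand `k` to the one below it, if any. -/
def linkT (T : ℕ → R) : ℕ → R
  | 0 => 0
  | k + 1 => T k

section Lower

variable {T C X Y : ℕ → R} {k : ℕ}

theorem T_mem_lower {i : ℕ} (hi : i + 1 < k) : T i ∈ lower F T C X Y k :=
  Algebra.subset_adjoin (Or.inl ⟨i, hi, rfl⟩)

theorem C_mem_lower {i : ℕ} (hi : i < k) : C i ∈ lower F T C X Y k :=
  Algebra.subset_adjoin (Or.inr ⟨i, hi, Or.inl rfl⟩)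

theorem X_mem_lower {i : ℕ} (hi : i < k) : X i ∈ lower F T C X Y k :=
  Algebra.subset_adjoin (Or.inr ⟨i, hi, Or.inr (Or.inl rfl)⟩)

theorem Y_mem_lower {i : ℕ} (hi : i < k) : Y i ∈ lower F T C X Y k :=
  Algebra.subset_adjoin (Or.inr ⟨i, hi, Or.inr (Or.inr rfl)⟩)

theorem lower_mono {k' : ℕ} (h : k ≤ k') : lower F T C X Y k ≤ lower F T C X Y k' := by
  refine Algebra.adjoin_le ?_
  rintro _ (⟨i, hi, rfl⟩ | ⟨i, hi, rfl | rfl | rfl⟩)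
  exacts [T_mem_lower (by omega), C_mem_lower (by omega), X_mem_lower (by omega),
    Y_mem_lower (by omega)]

theorem commute_lower {g : R} (hT : ∀ i, i + 1 < k → Commute g (T i))
    (hC : ∀ i < k, Commute g (C i)) (hX : ∀ i < k, Commute g (X i))
    (hY : ∀ i < k, Commute g (Y i)) {a : R} (ha : a ∈ lower F T C X Y k) : g * a = a * g := by
  have : lower F T C X Y k ≤ Subalgebra.centralizer F {g} := by
    refine Algebra.adjoin_le ?_
    rintro _ (⟨i, hi, rfl⟩ | ⟨i, hi, rfl | rfl | rfl⟩) <;>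
      simp only [SetLike.mem_coe, Subalgebra.mem_centralizer_iff, Set.mem_singleton_iff, forall_eq]
    exacts [hT i hi, hC i hi, hX i hi, hY i hi]
  exact (Subalgebra.mem_centralizer_iff F).1 (this ha) g rfl

end Lower

namespace Fwd

variable {ξ : F} {N : ℕ} {T C X Y : ℕ → R} {k : ℕ}

theorem commute_Y (h : Fwd ξ N T C X Y) {g : R} {i : ℕ} (hi : i < N) (hg : Commute g (X i)) :
    Commute g (Y i) := by
  show g * Y i = Y i * g
  calc g * Y i = Y i * (X i * g) * Y i := by rw [← mul_assoc, h.YX i hi, one_mul]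
    _ = Y i * g := by rw [← hg.eq, mul_assoc, mul_assoc, h.XY i hi, mul_one]

theorem strand (h : Fwd ξ N T C X Y) (hk : k < N) :
    Strand (lower F T C X Y k) (C k) (X k) (Y k) where
  XY := h.XY k hk
  YX := h.YX k hk
  CC := h.CC k hk
  CX := h.CX k hk
  MX a ha := commute_lower (fun i hi => (h.TXo i (by omega) k hk (by omega) (by omega)).symm)
    (fun i hi => (h.CXo i (by omega) k hk (by omega)).symm) (fun i hi => h.XX k hk i (by omega))
    (fun i hi => h.commute_Y (by omega) (h.XX k hk i (by omega))) ha
  MC a ha := by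
    refine Algebra.adjoin_induction
      (p := fun a _ => ∃ a' ∈ lower F T C X Y k, C k * a = a' * C k ∧ a * C k = C k * a')
      ?_ (fun r => ?_) ?_ ?_ ha
    · rintro _ (⟨i, hi, rfl⟩ | ⟨i, hi, rfl | rfl | rfl⟩)
      · have := h.TCo i (by omega) k hk (by omega) (by omega)
        exact ⟨T i, T_mem_lower hi, this.symm.eq, this.eq⟩
      · refine ⟨-C i, neg_mem (C_mem_lower hi), ?_, ?_⟩
        · rw [h.anti k hk i (by omega) (by omega), neg_mul]
        · rw [h.anti i (by omega) k hk (by omega), mul_neg]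
      · have := h.CXo k hk i (by omega) (by omega)
        exact ⟨X i, X_mem_lower hi, this.eq, this.symm.eq⟩
      · have := h.commute_Y (by omega) (h.CXo k hk i (by omega) (by omega))
        exact ⟨Y i, Y_mem_lower hi, this.eq, this.symm.eq⟩
    · exact ⟨algebraMap F R r, Subalgebra.algebraMap_mem _ r,
        (Algebra.commutes r (C k)).symm, Algebra.commutes r (C k)⟩
    · rintro a b _ _ ⟨a', ha', e1, e2⟩ ⟨b', hb', e3, e4⟩
      exact ⟨a' + b', add_mem ha' hb', by rw [mul_add, add_mul, e1, e3],
        by rw [mul_add, add_mul, e2, e4]⟩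
    · rintro a b _ _ ⟨a', ha', e1, e2⟩ ⟨b', hb', e3, e4⟩
      exact ⟨a' * b', mul_mem ha' hb', by rw [← mul_assoc, e1, mul_assoc, e3, mul_assoc],
        by rw [mul_assoc, e4, ← mul_assoc, e2, mul_assoc]⟩

theorem link (h : Fwd ξ N T C X Y) (hk : k + 1 < N) :
    Link ξ (lower F T C X Y (k + 1)) (T k) (C k) (C (k + 1)) (X k) (X (k + 1)) := by
  have hp : Pair ξ (T k) (C k) (C (k + 1)) := ⟨h.quad k hk, h.TC k hk, h.CC _ hk,
    h.anti _ (by omega) _ hk (by omega)⟩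
  have hc := h.cross k hk
  refine ⟨C_mem_lower (by omega), X_mem_lower (by omega), h.quad k hk, (h.TC k hk).symm, ?_, ?_, ?_,
    hc, (h.CXo _ hk _ (by omega) (by omega)).eq⟩
  · rw [hp.TC, smul_sub]
    abel
  · calc X (k + 1) * T k = (T k + ξ • (C k * C (k + 1))) * X k * (T k * T k) := by
          rw [← hc, mul_assoc]
      _ = ξ • ((T k + ξ • (C k * C (k + 1))) * X k * T k) +
          (T k + ξ • (C k * C (k + 1))) * X k := by
          rw [h.quad k hk, mul_add, mul_one, mul_smul_comm]
      _ = _ := by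
          rw [hc, add_mul, smul_mul_assoc]
          abel
  · rw [hp.xT hc, add_mul, sub_mul, smul_mul_assoc, smul_mul_assoc, one_mul]
    abel

theorem commute_T_lower (h : Fwd ξ N T C X Y) (hk : k + 1 < N) {a : R}
    (ha : a ∈ lower F T C X Y k) : T k * a = a * T k :=
  commute_lower (fun i hi => (h.far i k hi hk).symm)
    (fun i hi => h.TCo k hk i (by omega) (by omega) (by omega))
    (fun i hi => h.TXo k hk i (by omega) (by omega) (by omega))
    (fun i hi => h.commute_Y (by omega) (h.TXo k hk i (by omega) (by omega) (by omega))) ha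

end Fwd

theorem finiteDimensional_layer {M : Subalgebra F R} [FiniteDimensional F M] (T C X : R) (m : ℕ) :
    FiniteDimensional F (layer M T C X m) := by
  have hM : M.toSubmodule.FG := Module.Finite.iff_fg.1 (inferInstanceAs (FiniteDimensional F M))
  let G : Set R := Set.image (fun i => X ^ i) (Set.Iio m) ∪ Set.image (fun i => X ^ i * C) (Set.Iio m)
  have hG : G.Finite := ((Set.finite_Iio m).image _).union ((Set.finite_Iio m).image _)
  have hS : (M.toSubmodule * Submodule.span F {T} * M.toSubmodule ⊔
      Submodule.span F G * M.toSubmodule).FG :=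
    ((hM.mul (Submodule.fg_span (Set.finite_singleton T))).mul hM).sup
      ((Submodule.fg_span hG).mul hM)
  have hle : layer M T C X m ≤ M.toSubmodule * Submodule.span F {T} * M.toSubmodule ⊔
      Submodule.span F G * M.toSubmodule := by
    refine Submodule.span_le.2 ?_
    rintro _ (⟨a, ha, b, hb, rfl⟩ | ⟨i, hi, b, hb, rfl | rfl⟩)
    · exact Submodule.mem_sup_left (Submodule.mul_mem_mul (Submodule.mul_mem_mul ha
        (Submodule.mem_span_singleton_self T)) hb)
    · exact Submodule.mem_sup_right (Submodule.mul_mem_mul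
        (Submodule.subset_span (Or.inl ⟨i, hi, rfl⟩)) hb)
    · exact Submodule.mem_sup_right (Submodule.mul_mem_mul
        (Submodule.subset_span (Or.inr ⟨i, hi, rfl⟩)) hb)
  have : FiniteDimensional F _ := Module.Finite.iff_fg.2 hS
  exact Submodule.finiteDimensional_of_le hle

theorem lower_zero {T C X Y : ℕ → R} : lower F T C X Y 0 = ⊥ := by
  simp [lower]

theorem lower_succ_le_of_stable {T C X Y : ℕ → R} {k : ℕ} {S : Submodule F R} (h1 : 1 ∈ S)
    (hM : ∀ a ∈ lower F T C X Y k, ∀ w ∈ S, a * w ∈ S)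
    (hT : ∀ w ∈ S, linkT T k * w ∈ S)
    (hC : ∀ w ∈ S, C k * w ∈ S) (hX : ∀ w ∈ S, X k * w ∈ S) (hY : ∀ w ∈ S, Y k * w ∈ S) :
    (lower F T C X Y (k + 1)).toSubmodule ≤ S := by
  refine adjoin_le_of_stable h1 ?_
  rintro _ (⟨i, hi, rfl⟩ | ⟨i, hi, h⟩)
  · rcases Nat.lt_succ_iff_lt_or_eq.1 hi with hi | rfl
    exacts [hM _ (T_mem_lower hi), hT]
  · rcases Nat.lt_succ_iff_lt_or_eq.1 hi with hi | rfl <;> rcases h with rfl | rfl | rfl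
    exacts [hM _ (C_mem_lower hi), hM _ (X_mem_lower hi), hM _ (Y_mem_lower hi), hC, hX, hY]

namespace Fwd

variable {ξ : F} {N d : ℕ} {aa : ℕ → F} {T C X Y : ℕ → R} {k : ℕ}

theorem lower_succ_le_layer (h : Fwd ξ N T C X Y) (hf : GoodPoly F d aa)
    (hX : fev d aa (X 0) = 0) (hk : k < N) : FiniteDimensional F (lower F T C X Y k) ∧
      (lower F T C X Y (k + 1)).toSubmodule ≤
        layer (lower F T C X Y k) (linkT T k) (C k) (X k) d := by
  have hd : 0 < d := hf.1
  induction k with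
  | zero =>
    have hfd : FiniteDimensional F (lower F T C X Y 0) := by
      rw [lower_zero]
      infer_instance
    refine ⟨hfd, ?_⟩
    have := finiteDimensional_layer (M := lower F T C X Y 0) (linkT T 0) (C 0) (X 0) d
    have hs := h.strand hk
    have h0 : linkT T 0 = 0 := rfl
    have hXd : X 0 ^ d ∈ layer (lower F T C X Y 0) (linkT T 0) (C 0) (X 0) d := by
      rw [fev, Finset.sum_range_succ, hf.2.1, one_smul] at hX
      rw [eq_neg_of_add_eq_zero_right hX]
      refine neg_mem (sum_mem fun i hi => Submodule.smul_mem _ _ ?_)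
      simpa using X_mem_layer (T := linkT T 0) (C := C 0) (X := X 0) (Finset.mem_range.1 hi)
        (one_mem (lower F T C X Y 0))
    obtain ⟨h1, h2, h3⟩ := hs.layer_stable hd (by rw [h0, zero_mul]; exact zero_mem _)
      (by rw [h0, mul_zero]; exact zero_mem _) hXd ⟨0, zero_mem _, by rw [h0, mul_zero, mul_zero]⟩
    exact lower_succ_le_of_stable (mem_layer hd (one_mem _)) (fun a ha w hw => hs.mul_mem_layer ha hw)
      (fun w _ => by rw [h0, zero_mul]; exact zero_mem _) h3 h1 h2
  | succ k ih =>
    obtain ⟨hfd, hle⟩ := ih (by omega)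
    have := finiteDimensional_layer (M := lower F T C X Y k) (linkT T k) (C k) (X k) d
    have hfd' : FiniteDimensional F (lower F T C X Y (k + 1)) :=
      Submodule.finiteDimensional_of_le hle
    refine ⟨hfd', ?_⟩
    have := finiteDimensional_layer (M := lower F T C X Y (k + 1)) (T k) (C (k + 1)) (X (k + 1)) d
    have hs := h.strand hk
    have hTsT : T k * linkT T k * T k ∈
        layer (lower F T C X Y (k + 1)) (T k) (C (k + 1)) (X (k + 1)) d := by
      cases k with
      | zero => simp [linkT]
      | succ k =>
        rw [linkT, ← h.braid k (by omega)]
        exact T_mem_layer (T_mem_lower (by omega)) (T_mem_lower (by omega))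
    obtain ⟨h1, h2, h3, h4⟩ := (h.link hk).layer_stable hs hd (lower_mono (Nat.le_succ k))
      (fun b hb => h.commute_T_lower hk hb) hTsT hle
    exact lower_succ_le_of_stable (mem_layer hd (one_mem _)) (fun a ha w hw => hs.mul_mem_layer ha hw)
      h1 h2 h3 h4

end Fwd

/-- The element `X_j^a C_j^b T_j ⋯ T_{k-1}`. -/
def std (T C X : ℕ → R) (k a : ℕ) (b : Bool) (j : ℕ) : R :=
  X j ^ a * (if b then C j else 1) * (((List.range k).filter fun i => j ≤ i).map T).prod

theorem std_self (T C X : ℕ → R) (k a : ℕ) (b : Bool) :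
    std T C X k a b k = X k ^ a * (if b then C k else 1) := by
  have : ((List.range k).filter fun i => decide (k ≤ i)) = [] := by
    rw [List.filter_eq_nil_iff]
    intro i hi
    simpa using List.mem_range.1 hi
  rw [std, this, List.map_nil, List.prod_nil, mul_one]

theorem std_succ (T C X : ℕ → R) {k j : ℕ} (a : ℕ) (b : Bool) (hj : j ≤ k) :
    std T C X (k + 1) a b j = std T C X k a b j * T k := by
  simp only [std, List.range_succ, List.filter_append, List.map_append, List.prod_append]
  simp [hj, mul_assoc]

/-- A spanning set of the subalgebra of the first `k + 1` strands over that of the first `k`. -/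
theorem Fwd.mem_span_std {ξ : F} {N d : ℕ} {aa : ℕ → F} {T C X Y : ℕ → R} {k : ℕ}
    (h : Fwd ξ N T C X Y) (hf : GoodPoly F d aa) (hX : fev d aa (X 0) = 0) (hk : k < N)
    {w : R} (hw : w ∈ lower F T C X Y (k + 1)) :
    w ∈ Submodule.span F {r | ∃ a < d, ∃ b : Bool, ∃ j ≤ k, ∃ m ∈ lower F T C X Y k,
      r = std T C X k a b j * m} := by
  induction k generalizing w with
  | zero =>
    refine layer_map LinearMap.id (fun a ha b hb => by simp [linkT]) (fun i hi b hb => ?_)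
      (fun i hi b hb => ?_) ((h.lower_succ_le_layer hf hX hk).2 hw)
    · exact Submodule.subset_span ⟨i, hi, false, 0, le_rfl, b, hb, by simp [std_self]⟩
    · exact Submodule.subset_span ⟨i, hi, true, 0, le_rfl, b, hb, by simp [std_self]⟩
  | succ k ih =>
    refine layer_map LinearMap.id (fun u hu v hv => ?_) (fun i hi b hb => ?_)
      (fun i hi b hb => ?_) ((h.lower_succ_le_layer hf hX hk).2 hw)
    · let S := Submodule.span F {r | ∃ a < d, ∃ b : Bool, ∃ j ≤ k + 1,
          ∃ m ∈ lower F T C X Y (k + 1), r = std T C X (k + 1) a b j * m}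
      suffices hle : Submodule.span F {r | ∃ a < d, ∃ b : Bool, ∃ j ≤ k,
          ∃ m ∈ lower F T C X Y k, r = std T C X k a b j * m} ≤
          S.comap (LinearMap.mulRight F (T k * v)) by
        have := hle (ih (by omega) hu)
        rwa [Submodule.mem_comap, LinearMap.mulRight_apply, ← mul_assoc] at this
      refine Submodule.span_le.2 ?_
      rintro _ ⟨a, ha, b, j, hj, m, hm, rfl⟩
      refine Submodule.subset_span ⟨a, ha, b, j, by omega, m * v,
        mul_mem (lower_mono (by omega) hm) hv, ?_⟩
      rw [std_succ T C X a b hj, LinearMap.mulRight_apply, ← mul_assoc, mul_assoc _ m,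
        ← h.commute_T_lower (by omega) hm]
      simp only [mul_assoc]
    · exact Submodule.subset_span ⟨i, hi, false, k + 1, le_rfl, b, hb, by simp [std_self]⟩
    · exact Submodule.subset_span ⟨i, hi, true, k + 1, le_rfl, b, hb, by simp [std_self]⟩

end Spanning

section Translation

/-- Extension of a finite family by zero. -/
def ext0 {R : Type*} [Zero R] {m : ℕ} (g : Fin m → R) (i : ℕ) : R :=
  if h : i < m then g ⟨i, h⟩ else 0

theorem ext0_of_lt {R : Type*} [Zero R] {m : ℕ} (g : Fin m → R) {i : ℕ} (h : i < m) :
    ext0 g i = g ⟨i, h⟩ := dif_pos h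

theorem ext0_val {R : Type*} [Zero R] {m : ℕ} (g : Fin m → R) (i : Fin m) :
    ext0 g i = g i := ext0_of_lt g i.isLt

variable {F} {R : Type*} [Ring R] [Algebra F R]

namespace Fwd

variable {ξ : F} {N : ℕ} {T C X Y : ℕ → R}

theorem CY (h : Fwd ξ N T C X Y) {i : ℕ} (hi : i < N) : C i * Y i = X i * C i := by
  calc C i * Y i = X i * (Y i * C i) * Y i := by rw [← mul_assoc, h.XY i hi, one_mul]
    _ = X i * C i := by rw [← h.CX i hi, mul_assoc, mul_assoc, h.XY i hi, mul_one]

theorem YY (h : Fwd ξ N T C X Y) {i j : ℕ} (hi : i < N) (hj : j < N) : Commute (Y i) (Y j) :=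
  h.commute_Y hj (h.commute_Y hi (h.XX j hj i hi)).symm

theorem neg (h : Fwd ξ N T C X Y) : Fwd ξ N T (fun i => -C i) X Y where
  XY := h.XY
  YX := h.YX
  XX := h.XX
  CC i hi := by rw [neg_mul_neg, h.CC i hi]
  anti i hi j hj hij := by rw [neg_mul_neg, neg_mul_neg, h.anti i hi j hj hij]
  CX i hi := by rw [neg_mul, mul_neg, h.CX i hi]
  CXo i hi j hj hij := (h.CXo i hi j hj hij).neg_left
  quad := h.quad
  braid := h.braid
  far := h.far
  TC i hi := by rw [neg_mul, mul_neg, h.TC i hi]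
  TCo i hi j hj h1 h2 := (h.TCo i hi j hj h1 h2).neg_right
  TXo := h.TXo
  cross i hi := by rw [neg_mul_neg, h.cross i hi]

end Fwd

variable (q : F) (n d : ℕ) (aa : ℕ → F)

/-- The generators of `H_n^f` indexed by natural numbers. -/
noncomputable def nT : ℕ → Hf F q n d aa := ext0 (Tf F q n d aa)
noncomputable def nC : ℕ → Hf F q n d aa := ext0 (Cf F q n d aa)
noncomputable def nX : ℕ → Hf F q n d aa := ext0 (Xf F q n d aa)
noncomputable def nY : ℕ → Hf F q n d aa := ext0 (Xinvf F q n d aa)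

theorem cyc_rel {a b : FA F n} (h : Rel F q n a b) :
    cyc F q n d aa (RingQuot.mkAlgHom F (Rel F q n) a) =
      cyc F q n d aa (RingQuot.mkAlgHom F (Rel F q n) b) :=
  congrArg _ (RingQuot.mkAlgHom_rel F h)

theorem fwd_hf : Fwd (q - q⁻¹) n (nT q n d aa) (nC q n d aa) (nX q n d aa) (nY q n d aa) where
  XY i hi := by
    simpa [nX, nY, ext0_of_lt _ hi] using! cyc_rel q n d aa (Rel.XXinv ⟨i, hi⟩)
  YX i hi := by
    simpa [nX, nY, ext0_of_lt _ hi] using! cyc_rel q n d aa (Rel.XinvX ⟨i, hi⟩)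
  XX i hi j hj := by
    simpa [nX, ext0_of_lt _ hi, ext0_of_lt _ hj] using! cyc_rel q n d aa (Rel.XX ⟨i, hi⟩ ⟨j, hj⟩)
  CC i hi := by
    simpa [nC, ext0_of_lt _ hi] using! cyc_rel q n d aa (Rel.CC ⟨i, hi⟩)
  anti i hi j hj hij := by
    simpa [nC, ext0_of_lt _ hi, ext0_of_lt _ hj] using!
      cyc_rel q n d aa (Rel.Canti ⟨i, hi⟩ ⟨j, hj⟩ (by simpa using hij))
  CX i hi := by
    simpa [nC, nX, nY, ext0_of_lt _ hi] using! cyc_rel q n d aa (Rel.CX ⟨i, hi⟩)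
  CXo i hi j hj hij := by
    simpa [nC, nX, ext0_of_lt _ hi, ext0_of_lt _ hj] using!
      cyc_rel q n d aa (Rel.CXo ⟨i, hi⟩ ⟨j, hj⟩ (by simpa using hij))
  quad i hi := by
    have hi' : i < n - 1 := by omega
    simpa [nT, ext0_of_lt _ hi'] using! cyc_rel q n d aa (Rel.Tquad ⟨i, hi'⟩)
  braid i hi := by
    have hi' : i < n - 1 := by omega
    have hj' : i + 1 < n - 1 := by omega
    simpa [nT, ext0_of_lt _ hi', ext0_of_lt _ hj'] using!
      cyc_rel q n d aa (Rel.Tbraid ⟨i, hi'⟩ ⟨i + 1, hj'⟩ rfl)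
  far i j hij hj := by
    have hi' : i < n - 1 := by omega
    have hj' : j < n - 1 := by omega
    simpa [nT, ext0_of_lt _ hi', ext0_of_lt _ hj'] using!
      cyc_rel q n d aa (Rel.TTfar ⟨i, hi'⟩ ⟨j, hj'⟩ hij)
  TC i hi := by
    have hi' : i < n - 1 := by omega
    have hi'' : i < n := by omega
    simpa [nT, nC, ext0_of_lt _ hi', ext0_of_lt _ hi'', ext0_of_lt _ hi] using!
      cyc_rel q n d aa (Rel.TC ⟨i, hi'⟩)
  TCo i hi j hj h1 h2 := by
    have hi' : i < n - 1 := by omega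
    simpa [nT, nC, ext0_of_lt _ hi', ext0_of_lt _ hj] using!
      cyc_rel q n d aa (Rel.TCo ⟨i, hi'⟩ ⟨j, hj⟩ (by simpa [lo] using h1) (by simpa [HC.hi] using h2))
  TXo i hi j hj h1 h2 := by
    have hi' : i < n - 1 := by omega
    simpa [nT, nX, ext0_of_lt _ hi', ext0_of_lt _ hj] using!
      cyc_rel q n d aa (Rel.TXo ⟨i, hi'⟩ ⟨j, hj⟩ (by simpa [lo] using h1) (by simpa [HC.hi] using h2))
  cross i hi := by
    have hi' : i < n - 1 := by omega
    have hi'' : i < n := by omega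
    simpa [nT, nC, nX, ext0_of_lt _ hi', ext0_of_lt _ hi'', ext0_of_lt _ hi] using!
      cyc_rel q n d aa (Rel.cross ⟨i, hi'⟩)

theorem fev_nX (hn : 0 < n) : fev d aa (nX q n d aa 0) = 0 := by
  have h : cyc F q n d aa (felem F q n d aa) = 0 :=
    (RingQuot.mkAlgHom_rel F CycRel.rel).trans (map_zero _)
  rw [felem, dif_pos hn] at h
  rw [nX, ext0_of_lt _ hn]
  rw [Xf, ← map_fev]
  exact h

/-- The universal property of `H_n^f`. -/
theorem exists_hom {T C X Y : ℕ → R} (h : Fwd (q - q⁻¹) n T C X Y)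
    (hX : 0 < n → fev d aa (X 0) = 0) :
    ∃ φ : Hf F q n d aa →ₐ[F] R, (∀ i, i + 1 < n → φ (nT q n d aa i) = T i) ∧
      (∀ i < n, φ (nC q n d aa i) = C i) ∧ (∀ i < n, φ (nX q n d aa i) = X i) ∧
      ∀ i < n, φ (nY q n d aa i) = Y i := by
  let g : Gen n → R
    | Gen.X i => X i
    | Gen.Xinv i => Y i
    | Gen.C i => C i
    | Gen.T i => T i
  have hx : ∀ i : Fin n, FreeAlgebra.lift F g (fx F i) = X i := fun i =>
    FreeAlgebra.lift_ι_apply _ _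
  have hy : ∀ i : Fin n, FreeAlgebra.lift F g (fxinv F i) = Y i := fun i =>
    FreeAlgebra.lift_ι_apply _ _
  have hc : ∀ i : Fin n, FreeAlgebra.lift F g (fc F i) = C i := fun i =>
    FreeAlgebra.lift_ι_apply _ _
  have ht : ∀ i : Fin (n - 1), FreeAlgebra.lift F g (ft F i) = T i := fun i =>
    FreeAlgebra.lift_ι_apply _ _
  have hrel : ∀ ⦃a b⦄, Rel F q n a b → FreeAlgebra.lift F g a = FreeAlgebra.lift F g b := by
    have hlt : ∀ i : Fin (n - 1), (i : ℕ) + 1 < n := fun i => by have := i.isLt; omega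
    rintro _ _ (i | i | ⟨i, j⟩ | ⟨i, j⟩ | ⟨i, j, hij⟩ | i | ⟨i, j, hij⟩ | i | i | ⟨i, j, hij⟩ |
      ⟨i, j, hij⟩ | i | ⟨i, j, hij⟩ | ⟨i, j, hij⟩ | i | ⟨i, j, h1, h2⟩ | ⟨i, j, h1, h2⟩ |
      ⟨i, j, h1, h2⟩ | i) <;>
      simp only [map_mul, map_add, map_neg, map_smul, map_one, hx, hy, hc, ht]
    · exact h.XY i i.2
    · exact h.YX i i.2
    · exact (h.XX i i.2 j j.2).eq
    · exact (h.YY i.2 j.2).eq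
    · exact (h.commute_Y j.2 (h.XX i i.2 j j.2)).eq
    · exact h.CC i i.2
    · exact h.anti i i.2 j j.2 (fun e => hij (Fin.ext e))
    · exact h.CX i i.2
    · exact h.CY i.2
    · exact (h.CXo i i.2 j j.2 (fun e => hij (Fin.ext e))).eq
    · exact (h.commute_Y j.2 (h.CXo i i.2 j j.2 (fun e => hij (Fin.ext e)))).eq
    · exact h.quad i (hlt i)
    · rw [hij]
      exact h.braid i (by have := hlt j; omega)
    · exact (h.far i j hij (hlt j)).eq
    · exact h.TC i (hlt i)
    · exact (h.TCo i (hlt i) j j.2 (fun e => h1 (Fin.ext e)) (fun e => h2 (Fin.ext e))).eq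
    · exact (h.TXo i (hlt i) j j.2 (fun e => h1 (Fin.ext e)) (fun e => h2 (Fin.ext e))).eq
    · exact (h.commute_Y j.2
        (h.TXo i (hlt i) j j.2 (fun e => h1 (Fin.ext e)) (fun e => h2 (Fin.ext e)))).eq
    · exact h.cross i (hlt i)
  let φ₀ : H F q n →ₐ[F] R := RingQuot.liftAlgHom F ⟨FreeAlgebra.lift F g, hrel⟩
  have hφ₀ : ∀ a, φ₀ (RingQuot.mkAlgHom F (Rel F q n) a) = FreeAlgebra.lift F g a := fun a =>
    RingQuot.liftAlgHom_mkAlgHom_apply F _ hrel a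
  have hcyc : ∀ ⦃a b⦄, CycRel F q n d aa a b → φ₀ a = φ₀ b := by
    rintro _ _ ⟨⟩
    rw [map_zero, felem]
    split
    · next hn =>
      refine (map_fev φ₀ d aa _).trans ?_
      rw [HC.X, hφ₀, hx]
      exact hX hn
    · exact map_zero _
  refine ⟨RingQuot.liftAlgHom F ⟨φ₀, hcyc⟩, fun i hi => ?_, fun i hi => ?_, fun i hi => ?_,
    fun i hi => ?_⟩
  · have hi' : i < n - 1 := by omega
    rw [nT, ext0_of_lt _ hi', Tf, cyc, RingQuot.liftAlgHom_mkAlgHom_apply, HC.T, hφ₀, ht]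
  · rw [nC, ext0_of_lt _ hi, Cf, cyc, RingQuot.liftAlgHom_mkAlgHom_apply, HC.C, hφ₀, hc]
  · rw [nX, ext0_of_lt _ hi, Xf, cyc, RingQuot.liftAlgHom_mkAlgHom_apply, HC.X, hφ₀, hx]
  · rw [nY, ext0_of_lt _ hi, Xinvf, cyc, RingQuot.liftAlgHom_mkAlgHom_apply, Xinv, hφ₀, hy]

theorem lower_hf_eq_top :
    lower F (nT q n d aa) (nC q n d aa) (nX q n d aa) (nY q n d aa) n = ⊤ := by
  refine Algebra.eq_top_iff.2 fun a => ?_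
  obtain ⟨a, rfl⟩ := RingQuot.mkAlgHom_surjective F (CycRel F q n d aa) a
  obtain ⟨a, rfl⟩ := RingQuot.mkAlgHom_surjective F (Rel F q n) a
  show ((cyc F q n d aa).comp (RingQuot.mkAlgHom F (Rel F q n))) a ∈ _
  induction a using FreeAlgebra.induction with
  | grade0 r => rw [AlgHom.commutes]; exact Subalgebra.algebraMap_mem _ r
  | grade1 g =>
    cases g with
    | X i =>
      have := X_mem_lower (F := F) (T := nT q n d aa) (C := nC q n d aa) (X := nX q n d aa)
        (Y := nY q n d aa) i.2
      rwa [nX, ext0_val] at this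
    | Xinv i =>
      have := Y_mem_lower (F := F) (T := nT q n d aa) (C := nC q n d aa) (X := nX q n d aa)
        (Y := nY q n d aa) i.2
      rwa [nY, ext0_val] at this
    | C i =>
      have := C_mem_lower (F := F) (T := nT q n d aa) (C := nC q n d aa) (X := nX q n d aa)
        (Y := nY q n d aa) i.2
      rwa [nC, ext0_val] at this
    | T i =>
      have := T_mem_lower (F := F) (T := nT q n d aa) (C := nC q n d aa) (X := nX q n d aa)
        (Y := nY q n d aa) (k := n) (i := i) (by have := i.2; omega)
      rwa [nT, ext0_val] at this
  | mul a b ha hb => rw [map_mul]; exact mul_mem ha hb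
  | add a b ha hb => rw [map_add]; exact add_mem ha hb

end Translation

section Dimension

variable {F} {q : F} {n d : ℕ} {aa : ℕ → F}

section Generic

variable {R : Type*} [Ring R] [Algebra F R] {ξ : F} {N : ℕ} {T C X Y : ℕ → R}

theorem Fwd.finiteDimensional (h : Fwd ξ N T C X Y) (hf : GoodPoly F d aa)
    (hX : 0 < N → fev d aa (X 0) = 0) (ht : lower F T C X Y N = ⊤) : FiniteDimensional F R := by
  have hl : FiniteDimensional F (lower F T C X Y N) := by
    cases N with
    | zero =>
      rw [lower_zero]
      infer_instance
    | succ N =>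
      obtain ⟨_, h2⟩ := h.lower_succ_le_layer hf (hX (Nat.succ_pos N)) (Nat.lt_succ_self N)
      have := finiteDimensional_layer (M := lower F T C X Y N) (linkT T N) (C N) (X N) d
      exact Submodule.finiteDimensional_of_le h2
  rw [ht] at hl
  exact Module.Finite.of_surjective (Subalgebra.val ⊤).toLinearMap fun a => ⟨⟨a, trivial⟩, rfl⟩

theorem generates_of_lower_eq_top (ht : lower F T C X Y N = ⊤) :
    Generates F N (fun k => T (N - 2 - k)) (fun k => C (N - 1 - k))
      (fun k => X (N - 1 - k)) (fun k => Y (N - 1 - k)) := by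
  intro S h1 hT hC hX hY
  refine eq_top_iff.2 fun a _ => ?_
  have ha : a ∈ lower F T C X Y N := by
    rw [ht]
    trivial
  refine adjoin_le_of_stable h1 ?_ ha
  have e : ∀ i < N, N - 1 - (N - 1 - i) = i := fun i hi => by omega
  rintro _ (⟨i, hi, rfl⟩ | ⟨i, hi, rfl | rfl | rfl⟩)
  · simpa only [show N - 2 - (N - 2 - i) = i by omega] using hT (N - 2 - i) (by omega)
  · simpa only [e i hi] using hC (N - 1 - i) (by omega)
  · simpa only [e i hi] using hX (N - 1 - i) (by omega)
  · simpa only [e i hi] using hY (N - 1 - i) (by omega)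

theorem surjective_of_neg (ht : lower F T C X Y N = ⊤) {σ : R →ₐ[F] R}
    (hT : ∀ i, i + 1 < N → σ (T i) = T i) (hC : ∀ i < N, σ (C i) = -C i)
    (hX : ∀ i < N, σ (X i) = X i) (hY : ∀ i < N, σ (Y i) = Y i) : Function.Surjective σ := by
  rw [← AlgHom.range_eq_top, eq_top_iff, ← ht]
  refine Algebra.adjoin_le ?_
  rintro _ (⟨i, hi, rfl⟩ | ⟨i, hi, rfl | rfl | rfl⟩)
  · exact ⟨_, hT i hi⟩
  · exact ⟨-C i, (map_neg σ _).trans (by rw [hC i hi, neg_neg])⟩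
  · exact ⟨_, hX i hi⟩
  · exact ⟨_, hY i hi⟩

end Generic

theorem finiteDimensional_hf (q : F) (n : ℕ) (hf : GoodPoly F d aa) :
    FiniteDimensional F (Hf F q n d aa) :=
  (fwd_hf q n d aa).finiteDimensional hf (fev_nX q n d aa) (lower_hf_eq_top q n d aa)

theorem exists_parity (q : F) (n d : ℕ) (aa : ℕ → F) :
    ∃ σ : Hf F q n d aa →ₐ[F] Hf F q n d aa, Function.Surjective σ ∧
      Parity n (fun k => nT q n d aa (n - 2 - k)) (fun k => nC q n d aa (n - 1 - k))
        (fun k => nX q n d aa (n - 1 - k)) σ := by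
  obtain ⟨σ, hT, hC, hX, hY⟩ := exists_hom q n d aa (fwd_hf q n d aa).neg (fev_nX q n d aa)
  exact ⟨σ, surjective_of_neg (lower_hf_eq_top q n d aa) hT hC hX hY, fun k hk => hT _ (by omega),
    fun k hk => hC _ (by omega), fun k hk => hX _ (by omega)⟩

theorem le_finrank_hf (hn : 0 < n) (hf : GoodPoly F d aa) :
    2 * d * (n + 1) * Module.finrank F (Hf F q n d aa) ≤
      Module.finrank F (Hf F q (n + 1) d aa) := by
  have := finiteDimensional_hf q n hf
  have := finiteDimensional_hf q (n + 1) hf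
  obtain ⟨σ, hσs, hσ⟩ := exists_parity q n d aa
  obtain ⟨Q, _, _, T, C, X, Y, z, hrev, hX, hS⟩ := exists_model (fwd_hf q n d aa).rev hσ hσs
    (generates_of_lower_eq_top (lower_hf_eq_top q n d aa)) hn hf (by rw [Nat.sub_self]; exact fev_nX q n d aa hn)
  obtain ⟨φ, hφT, hφC, hφX, hφY⟩ := exists_hom q (n + 1) d aa hrev.fwd (fun _ => by
    simpa using hX)
  let ev : Hf F q (n + 1) d aa →ₗ[F] Q := LinearMap.applyₗ z ∘ₗ φ.toLinearMap
  have hev : ∀ g w, ev (g * w) = φ g (ev w) := fun g w => by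
    simp [ev]
  refine (hS (LinearMap.range ev) inferInstance ⟨1, by simp [ev]⟩ ?_ ?_ ?_ ?_).trans
    ev.finrank_range_le <;> rintro k hk _ ⟨w, rfl⟩
  · refine ⟨nT q (n + 1) d aa (n - 1 - k) * w, ?_⟩
    rw [hev, hφT _ (by omega)]
    congr 2
    omega
  · refine ⟨nC q (n + 1) d aa (n - k) * w, ?_⟩
    rw [hev, hφC _ (by omega)]
    congr 2
    omega
  · refine ⟨nX q (n + 1) d aa (n - k) * w, ?_⟩
    rw [hev, hφX _ (by omega)]
    congr 2
    omega
  · refine ⟨nY q (n + 1) d aa (n - k) * w, ?_⟩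
    rw [hev, hφY _ (by omega)]
    congr 2
    omega

theorem range_emb {k N : ℕ} (hk : k ≤ N) {e : Hf F q k d aa →ₐ[F] Hf F q N d aa}
    (he : IsCycEmb F q k N d aa 0 e) :
    e.range = lower F (nT q N d aa) (nC q N d aa) (nX q N d aa) (nY q N d aa) k := by
  obtain ⟨hX, hY, hC, hT⟩ := he
  have eT : ∀ i, i + 1 < k → e (nT q k d aa i) = nT q N d aa i := fun i hi => by
    rw [nT, nT, ext0_of_lt _ (show i < k - 1 by omega), ext0_of_lt _ (show i < N - 1 by omega)]
    exact hT _ _ (Nat.zero_add _).symm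
  have eC : ∀ i < k, e (nC q k d aa i) = nC q N d aa i := fun i hi => by
    rw [nC, nC, ext0_of_lt _ hi, ext0_of_lt _ (show i < N by omega)]
    exact hC _ _ (Nat.zero_add _).symm
  have eX : ∀ i < k, e (nX q k d aa i) = nX q N d aa i := fun i hi => by
    rw [nX, nX, ext0_of_lt _ hi, ext0_of_lt _ (show i < N by omega)]
    exact hX _ _ (Nat.zero_add _).symm
  have eY : ∀ i < k, e (nY q k d aa i) = nY q N d aa i := fun i hi => by
    rw [nY, nY, ext0_of_lt _ hi, ext0_of_lt _ (show i < N by omega)]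
    exact hY _ _ (Nat.zero_add _).symm
  rw [← Algebra.map_top, ← lower_hf_eq_top, lower, AlgHom.map_adjoin, lower]
  congr 1
  ext r
  constructor
  · rintro ⟨_, ⟨i, hi, rfl⟩ | ⟨i, hi, rfl | rfl | rfl⟩, rfl⟩
    · exact Or.inl ⟨i, hi, eT i hi⟩
    · exact Or.inr ⟨i, hi, Or.inl (eC i hi)⟩
    · exact Or.inr ⟨i, hi, Or.inr (Or.inl (eX i hi))⟩
    · exact Or.inr ⟨i, hi, Or.inr (Or.inr (eY i hi))⟩
  · rintro (⟨i, hi, rfl⟩ | ⟨i, hi, rfl | rfl | rfl⟩)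
    · exact ⟨_, Or.inl ⟨i, hi, rfl⟩, eT i hi⟩
    · exact ⟨_, Or.inr ⟨i, hi, Or.inl rfl⟩, eC i hi⟩
    · exact ⟨_, Or.inr ⟨i, hi, Or.inr (Or.inl rfl)⟩, eX i hi⟩
    · exact ⟨_, Or.inr ⟨i, hi, Or.inr (Or.inr rfl)⟩, eY i hi⟩

end Dimension

section Counting

variable {F}

theorem iSupIndep_of_sum_le {V ι : Type*} [AddCommGroup V] [Module F V] [FiniteDimensional F V]
    [Fintype ι] {P : ι → Submodule F V} {m : ι → ℕ} (hP : ⨆ i, P i = ⊤)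
    (hm : ∀ i, Module.finrank F (P i) ≤ m i) (hV : ∑ i, m i ≤ Module.finrank F V) :
    iSupIndep P ∧ ∀ i, Module.finrank F (P i) = m i := by
  classical
  let φ : (Π₀ i, P i) →ₗ[F] V := DFinsupp.lsum ℕ fun i => (P i).subtype
  have hφ : Function.Surjective φ := by
    rw [← LinearMap.range_eq_top, ← Submodule.iSup_eq_range_dfinsupp_lsum, hP]
  have hD : Module.finrank F (Π₀ i, P i) = ∑ i, Module.finrank F (P i) :=
    Module.finrank_directSum F fun i => P i
  have hfd : FiniteDimensional F (Π₀ i, P i) :=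
    Module.Finite.equiv (DFinsupp.linearEquivFunOnFintype (R := F) (M := fun i => P i)).symm
  have h1 : Module.finrank F V ≤ Module.finrank F (Π₀ i, P i) :=
    LinearMap.finrank_le_finrank_of_surjective hφ
  have h2 : ∑ i, Module.finrank F (P i) ≤ ∑ i, m i := Finset.sum_le_sum fun i _ => hm i
  refine ⟨iSupIndep_of_dfinsupp_lsum_injective P
    ((LinearMap.injective_iff_surjective_of_finrank_eq_finrank (by omega)).2 hφ), fun i => ?_⟩
  exact (Finset.sum_eq_sum_iff_of_le fun i _ => hm i).1 (by omega) i (Finset.mem_univ i)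

theorem exists_equiv_of_le_finrank {V W : Type*} [AddCommGroup V] [Module F V] [AddCommGroup W]
    [Module F W] [FiniteDimensional F V] {P : Submodule F W} (φ : V →ₗ[F] W)
    (hP : P = LinearMap.range φ) (hd : Module.finrank F V ≤ Module.finrank F P) :
    ∃ θ : P ≃ₗ[F] V, ∀ (v : V) (s : P), (s : W) = φ v → θ s = v := by
  subst hP
  have hs : Function.Surjective φ.rangeRestrict := φ.surjective_rangeRestrict
  have hi : Function.Injective φ.rangeRestrict :=
    (LinearMap.injective_iff_surjective_of_finrank_eq_finrank
      (le_antisymm hd (LinearMap.finrank_range_le φ))).2 hs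
  refine ⟨(LinearEquiv.ofBijective _ ⟨hi, hs⟩).symm, fun v s e => ?_⟩
  rw [LinearEquiv.symm_apply_eq]
  exact Subtype.ext e

/-- The numerical data making `R` free over `A` with a prescribed decomposition. -/
structure CountData {R A B : Type} [Ring R] [Algebra F R] [Ring A] [Algebra F A] [Ring B]
    [Algebra F B] (en : A →ₐ[F] R) (en0 : B →ₐ[F] A) {ι ι' κ : Type} [Fintype ι] [Fintype ι']
    [Fintype κ] (s : ι → R) (s' : ι' → A) (τ : R) (e : κ → R) : Prop where
  finA : FiniteDimensional F A
  finR : FiniteDimensional F R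
  span_s : ∀ r : R, r ∈ Submodule.span F {r | ∃ p, ∃ a : A, r = s p * en a}
  span_s' : ∀ a : A, a ∈ Submodule.span F {a | ∃ p, ∃ b : B, a = s' p * en0 b}
  comm : ∀ b : B, en (en0 b) * τ = τ * en (en0 b)
  cover : ∀ r : R, r ∈ Submodule.span F {r | ∃ u v : A, r = en u * τ * en v} ⊔
    ⨆ p, Submodule.span F {r | ∃ v : A, r = e p * en v}
  dim : Fintype.card ι * Module.finrank F A ≤ Module.finrank F R
  card : Fintype.card ι' + Fintype.card κ ≤ Fintype.card ι

namespace CountData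

variable {R A B : Type} [Ring R] [Algebra F R] [Ring A] [Algebra F A] [Ring B]
    [Algebra F B] {en : A →ₐ[F] R} {en0 : B →ₐ[F] A} {ι ι' κ : Type} [Fintype ι] [Fintype ι']
    [Fintype κ] {s : ι → R} {s' : ι' → A} {τ : R} {e : κ → R}

theorem existsUnique_sum (D : CountData en en0 s s' τ e) (r : R) :
    ∃! c : ι →₀ A, r = c.sum fun p b => s p * en b := by
  classical
  have := D.finA
  have := D.finR
  let φ : (ι →₀ A) →ₗ[F] R :=
    Finsupp.lsum ℕ fun p => LinearMap.mulLeft F (s p) ∘ₗ en.toLinearMap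
  have hφ : ∀ c, φ c = c.sum fun p b => s p * en b := fun c => rfl
  have hs : Function.Surjective φ := by
    rw [← LinearMap.range_eq_top, eq_top_iff]
    rintro r -
    refine Submodule.span_le.2 ?_ (D.span_s r)
    rintro _ ⟨p, a, rfl⟩
    exact ⟨Finsupp.single p a, by rw [hφ, Finsupp.sum_single_index (by simp)]⟩
  have hfr : Module.finrank F (ι →₀ A) = Fintype.card ι * Module.finrank F A := by
    rw [Module.finrank_finsupp]
  have hle := LinearMap.finrank_le_finrank_of_surjective hs
  have hi : Function.Injective φ := (LinearMap.injective_iff_surjective_of_finrank_eq_finrank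
    (le_antisymm (hfr.trans_le D.dim) hle)).2 hs
  obtain ⟨c, hc⟩ := hs r
  exact ⟨c, hc.symm, fun c' hc' => hi (hc'.symm.trans hc.symm)⟩

theorem span_balanced (D : CountData en en0 s s' τ e) {V : Type*} [AddCommGroup V] [Module F V]
    (β : A →ₗ[F] A →ₗ[F] V) (hβ : ∀ u v b, β (u * en0 b) v = β u (en0 b * v)) :
    ∃ ψ : (ι' → A) →ₗ[F] V,
      Submodule.span F {w | ∃ u v, w = β u v} ≤ LinearMap.range ψ := by
  classical
  let ψ : (ι' → A) →ₗ[F] V := LinearMap.lsum F (fun _ => A) F fun p => β (s' p)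
  have hψ : ∀ p v, ψ (Pi.single p v) = β (s' p) v := fun p v => by
    simp only [ψ, LinearMap.lsum_apply, LinearMap.sum_apply, LinearMap.comp_apply,
      LinearMap.proj_apply]
    rw [Finset.sum_eq_single p]
    · rw [Pi.single_eq_same]
    · intro j _ hj
      rw [Pi.single_eq_of_ne hj, map_zero]
    · exact fun h => absurd (Finset.mem_univ p) h
  refine ⟨ψ, Submodule.span_le.2 ?_⟩
  rintro _ ⟨u, v, rfl⟩
  have hle : Submodule.span F {a | ∃ p, ∃ b : B, a = s' p * en0 b} ≤
      (LinearMap.range ψ).comap (β.flip v) := by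
    refine Submodule.span_le.2 ?_
    rintro _ ⟨p, b, rfl⟩
    exact ⟨Pi.single p (en0 b * v), by rw [hψ, ← hβ]; rfl⟩
  exact hle (D.span_s' u)

/-- The bilinear map `(u, v) ↦ en u * τ * en v`. -/
noncomputable def sandwich (en : A →ₐ[F] R) (τ : R) : A →ₗ[F] A →ₗ[F] R :=
  LinearMap.mk₂ F (fun u v => en u * τ * en v)
    (fun u u' v => by simp only [map_add, add_mul]) (fun c u v => by simp)
    (fun u v v' => by simp only [map_add, mul_add]) (fun c u v => by simp)

theorem sandwich_balanced (D : CountData en en0 s s' τ e) (u v : A) (b : B) :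
    sandwich en τ (u * en0 b) v = sandwich en τ u (en0 b * v) := by
  simp only [sandwich, LinearMap.mk₂_apply, map_mul]
  rw [mul_assoc _ _ τ, D.comm b]
  simp only [mul_assoc]

/-- The pieces of the decomposition. -/
def part (en : A →ₐ[F] R) (τ : R) (e : κ → R) : Option κ → Submodule F R
  | none => Submodule.span F {r | ∃ u v : A, r = en u * τ * en v}
  | some p => Submodule.span F {r | ∃ v : A, r = e p * en v}

theorem part_some (en : A →ₐ[F] R) (τ : R) (e : κ → R) (p : κ) :
    part en τ e (some p) = LinearMap.range (LinearMap.mulLeft F (e p) ∘ₗ en.toLinearMap) := by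
  refine le_antisymm (Submodule.span_le.2 ?_) ?_
  · rintro _ ⟨v, rfl⟩
    exact ⟨v, rfl⟩
  · rintro _ ⟨v, rfl⟩
    exact Submodule.subset_span ⟨v, rfl⟩

theorem iSup_part (D : CountData en en0 s s' τ e) : ⨆ t, part en τ e t = ⊤ := by
  refine eq_top_iff.2 fun r _ => ?_
  refine sup_le (le_iSup (part en τ e) none) (iSup_le fun p => ?_) (D.cover r)
  exact le_iSup (part en τ e) (some p)

theorem decomposition (D : CountData en en0 s s' τ e) : iSupIndep (part en τ e) ∧
    Module.finrank F (part en τ e none) = Fintype.card ι' * Module.finrank F A ∧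
    ∀ p, Module.finrank F (part en τ e (some p)) = Module.finrank F A := by
  have := D.finA
  have := D.finR
  let m : Option κ → ℕ
    | none => Fintype.card ι' * Module.finrank F A
    | some _ => Module.finrank F A
  have hm : ∀ t, Module.finrank F (part en τ e t) ≤ m t := by
    rintro (_ | p)
    · obtain ⟨ψ, hψ⟩ := D.span_balanced (sandwich en τ) D.sandwich_balanced
      calc Module.finrank F (part en τ e none) ≤ Module.finrank F (LinearMap.range ψ) :=
            Submodule.finrank_mono hψ
        _ ≤ Module.finrank F (ι' → A) := ψ.finrank_range_le
        _ = _ := by rw [Module.finrank_pi_fintype, Finset.sum_const, Finset.card_univ, smul_eq_mul]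
    · rw [part_some]
      exact LinearMap.finrank_range_le _
  have hV : ∑ t, m t ≤ Module.finrank F R := by
    rw [Fintype.sum_option]
    simp only [m, Finset.sum_const, Finset.card_univ, smul_eq_mul]
    rw [← add_mul]
    exact (Nat.mul_le_mul_right _ D.card).trans D.dim
  obtain ⟨h1, h2⟩ := iSupIndep_of_sum_le D.iSup_part hm hV
  exact ⟨h1, h2 none, fun p => h2 (some p)⟩

theorem exists_equiv_some (D : CountData en en0 s s' τ e) (p : κ) :
    ∃ θ : part en τ e (some p) ≃ₗ[F] A, ∀ (v : A) (w : part en τ e (some p)),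
      (w : R) = e p * en v → θ w = v := by
  have := D.finA
  exact exists_equiv_of_le_finrank (LinearMap.mulLeft F (e p) ∘ₗ en.toLinearMap)
    (part_some en τ e p) (D.decomposition.2.2 p).ge

theorem exists_equiv_none (D : CountData en en0 s s' τ e) {W : Type} [AddCommGroup W] [Module F W]
    (bil : A →ₗ[F] A →ₗ[F] W) (hbil : ∀ u v b, bil (u * en0 b) v = bil u (en0 b * v))
    (huniv : ∀ (W' : Type) [AddCommGroup W'] [Module F W'] (bil' : A →ₗ[F] A →ₗ[F] W'),
      (∀ u v b, bil' (u * en0 b) v = bil' u (en0 b * v)) →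
      ∃! g : W →ₗ[F] W', ∀ u v, g (bil u v) = bil' u v) :
    ∃ θ : part en τ e none ≃ₗ[F] W, ∀ (u v : A) (w : part en τ e none),
      (w : R) = en u * τ * en v → θ w = bil u v := by
  have := D.finA
  have := D.finR
  have htop : Submodule.span F {w | ∃ u v, w = bil u v} = ⊤ := by
    let W₀ := Submodule.span F {w | ∃ u v, w = bil u v}
    have hu := huniv (W ⧸ W₀) 0 (fun _ _ _ => rfl)
    have h0 : W₀.mkQ = 0 := hu.unique
      (fun u v => (Submodule.Quotient.mk_eq_zero W₀).2 (Submodule.subset_span ⟨u, v, rfl⟩))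
      (fun _ _ => rfl)
    exact (Submodule.ker_mkQ W₀).symm.trans (by rw [h0, LinearMap.ker_zero])
  obtain ⟨ψ, hψ⟩ := D.span_balanced bil hbil
  have hψs : Function.Surjective ψ := by
    rw [← LinearMap.range_eq_top, eq_top_iff, ← htop]
    exact hψ
  have hfd : FiniteDimensional F W := Module.Finite.of_surjective ψ hψs
  have hW : Module.finrank F W ≤ Module.finrank F (part en τ e none) := by
    rw [D.decomposition.2.1]
    refine (LinearMap.finrank_le_finrank_of_surjective hψs).trans_eq ?_
    rw [Module.finrank_pi_fintype, Finset.sum_const, Finset.card_univ, smul_eq_mul]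
  obtain ⟨g, hg, -⟩ := huniv R (sandwich en τ) D.sandwich_balanced
  have hrange : part en τ e none = LinearMap.range g := by
    rw [LinearMap.range_eq_map, ← htop, Submodule.map_span]
    refine congrArg (Submodule.span F) (Set.ext fun r => ⟨?_, ?_⟩)
    · rintro ⟨u, v, rfl⟩
      exact ⟨_, ⟨u, v, rfl⟩, hg u v⟩
    · rintro ⟨_, ⟨u, v, rfl⟩, rfl⟩
      exact ⟨u, v, hg u v⟩
  obtain ⟨θ, hθ⟩ := exists_equiv_of_le_finrank g hrange hW
  exact ⟨θ, fun u v w hw => hθ _ w (hw.trans (hg u v).symm)⟩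

end CountData

end Counting

section Assembly

variable {F}

section Generic

variable {R A : Type} [Ring R] [Algebra F R] [Ring A] [Algebra F A] {ξ : F} {N d k : ℕ}
    {aa : ℕ → F} {T C X Y : ℕ → R} {en : A →ₐ[F] R}

theorem Fwd.mem_span_std_range (h : Fwd ξ N T C X Y) (hf : GoodPoly F d aa)
    (hX : fev d aa (X 0) = 0) (hk : k < N) (htop : lower F T C X Y (k + 1) = ⊤)
    (hr : en.range = lower F T C X Y k) (r : R) :
    r ∈ Submodule.span F {r | ∃ p : Fin d × Bool × Fin (k + 1), ∃ a : A,
      r = std T C X k p.1 p.2.1 p.2.2 * en a} := by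
  refine Submodule.span_mono ?_ (h.mem_span_std hf hX hk (w := r) (htop ▸ Algebra.mem_top))
  rintro _ ⟨a, ha, b, j, hj, m, hm, rfl⟩
  rw [← hr] at hm
  obtain ⟨v, rfl⟩ := hm
  exact ⟨(⟨a, ha⟩, b, ⟨j, by omega⟩), v, rfl⟩

theorem Fwd.mem_sup_of_range (h : Fwd ξ N T C X Y) (hf : GoodPoly F d aa)
    (hX : fev d aa (X 0) = 0) (hk : k < N) (htop : lower F T C X Y (k + 1) = ⊤)
    (hr : en.range = lower F T C X Y k) (r : R) :
    r ∈ Submodule.span F {r | ∃ u v : A, r = en u * linkT T k * en v} ⊔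
      ⨆ p : Fin d × Bool, Submodule.span F {r | ∃ v : A,
        r = X k ^ (p.1 : ℕ) * (if p.2 then C k else 1) * en v} := by
  have hp : ∀ (p : Fin d × Bool) (v : A), X k ^ (p.1 : ℕ) * (if p.2 then C k else 1) * en v ∈
      ⨆ p : Fin d × Bool, Submodule.span F {r | ∃ v : A,
        r = X k ^ (p.1 : ℕ) * (if p.2 then C k else 1) * en v} := fun p v =>
    Submodule.mem_iSup_of_mem p (Submodule.subset_span ⟨v, rfl⟩)
  refine layer_map LinearMap.id ?_ ?_ ?_
    ((h.lower_succ_le_layer hf hX hk).2 (show r ∈ lower F T C X Y (k + 1) from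
      htop ▸ Algebra.mem_top)) <;> rw [← hr]
  · rintro _ ⟨u, rfl⟩ _ ⟨v, rfl⟩
    exact Submodule.mem_sup_left (Submodule.subset_span ⟨u, v, rfl⟩)
  · rintro i hi _ ⟨v, rfl⟩
    refine Submodule.mem_sup_right ?_
    simpa using hp (⟨i, hi⟩, false) v
  · rintro i hi _ ⟨v, rfl⟩
    refine Submodule.mem_sup_right ?_
    simpa using hp (⟨i, hi⟩, true) v

theorem Fwd.countData {B : Type} [Ring B] [Algebra F B] {n : ℕ} {T' C' X' Y' : ℕ → A}
    {en0 : B →ₐ[F] A} (hn : 0 < n) (h : Fwd ξ (n + 1) T C X Y) (h' : Fwd ξ n T' C' X' Y')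
    (hf : GoodPoly F d aa) (hX : fev d aa (X 0) = 0) (hX' : fev d aa (X' 0) = 0)
    (htop : lower F T C X Y (n + 1) = ⊤) (htop' : lower F T' C' X' Y' n = ⊤)
    (hr : en.range = lower F T C X Y n) (hr' : en0.range = lower F T' C' X' Y' (n - 1))
    (hc : (en.comp en0).range = lower F T C X Y (n - 1)) (finA : FiniteDimensional F A)
    (finR : FiniteDimensional F R)
    (hdim : 2 * d * (n + 1) * Module.finrank F A ≤ Module.finrank F R) :
    CountData en en0 (fun p : Fin d × Bool × Fin (n + 1) => std T C X n p.1 p.2.1 p.2.2)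
      (fun p : Fin d × Bool × Fin (n - 1 + 1) => std T' C' X' (n - 1) p.1 p.2.1 p.2.2)
      (T (n - 1)) (fun p : Fin d × Bool => X n ^ (p.1 : ℕ) * (if p.2 then C n else 1)) := by
  obtain ⟨m, rfl⟩ := Nat.exists_eq_add_one_of_ne_zero hn.ne'
  refine ⟨finA, finR, h.mem_span_std_range hf hX (by omega) htop hr,
    h'.mem_span_std_range hf hX' (by omega) htop' hr', fun b => ?_,
    fun r => ?_, ?_, ?_⟩
  · have hb : en (en0 b) ∈ lower F T C X Y m := hc ▸ ⟨b, rfl⟩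
    exact (h.commute_T_lower (by omega) hb).symm
  · exact h.mem_sup_of_range (k := m + 1) hf hX (Nat.lt_succ_self _) htop hr r
  · refine le_trans (le_of_eq ?_) hdim
    simp only [Fintype.card_prod, Fintype.card_fin, Fintype.card_bool]
    ring
  · simp only [Fintype.card_prod, Fintype.card_fin, Fintype.card_bool, Nat.add_sub_cancel]
    exact le_of_eq (by ring)

end Generic

variable {q : F} {n d : ℕ} {aa : ℕ → F}

theorem IsCycEmb.comp {k m N : ℕ} (hm : k ≤ m) {e : Hf F q m d aa →ₐ[F] Hf F q N d aa}
    {e0 : Hf F q k d aa →ₐ[F] Hf F q m d aa} (he : IsCycEmb F q m N d aa 0 e)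
    (he0 : IsCycEmb F q k m d aa 0 e0) : IsCycEmb F q k N d aa 0 (e.comp e0) := by
  refine ⟨fun i i' h => ?_, fun i i' h => ?_, fun i i' h => ?_, fun i i' h => ?_⟩
  · rw [AlgHom.comp_apply, he0.1 i ⟨i, by omega⟩ (Nat.zero_add _).symm, he.1 _ i' h]
  · rw [AlgHom.comp_apply, he0.2.1 i ⟨i, by omega⟩ (Nat.zero_add _).symm, he.2.1 _ i' h]
  · rw [AlgHom.comp_apply, he0.2.2.1 i ⟨i, by omega⟩ (Nat.zero_add _).symm, he.2.2.1 _ i' h]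
  · rw [AlgHom.comp_apply, he0.2.2.2 i ⟨i, by omega⟩ (Nat.zero_add _).symm, he.2.2.2 _ i' h]

theorem stdElt_eq (p : Fin d × Bool × Fin (n + 1)) :
    stdElt F q n d aa p = std (nT q (n + 1) d aa) (nC q (n + 1) d aa) (nX q (n + 1) d aa) n
      p.1 p.2.1 p.2.2 := by
  have hT : ((List.finRange n).filter fun k : Fin n => (p.2.2 : ℕ) ≤ (k : ℕ)).map
      (fun k => Tf F q (n + 1) d aa k) =
      ((List.range n).filter fun i => (p.2.2 : ℕ) ≤ i).map (nT q (n + 1) d aa) := by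
    rw [← List.map_coe_finRange_eq_range, List.filter_map, List.map_map]
    exact List.map_congr_left fun k _ => (ext0_val (Tf F q (n + 1) d aa) k).symm
  rw [stdElt, std, hT, nX, nC, ext0_val, ext0_val]

/-- The generators of the summands `X̃_{n+1}^a C̃_{n+1}^b H_n^f`. -/
noncomputable def topElt (q : F) (n d : ℕ) (aa : ℕ → F) (p : Fin d × Bool) :
    Hf F q (n + 1) d aa :=
  Xf F q (n + 1) d aa ⟨n, n.lt_succ_self⟩ ^ (p.1 : ℕ) *
    (if p.2 then Cf F q (n + 1) d aa ⟨n, n.lt_succ_self⟩ else 1)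

theorem countData_hf (hn : 0 < n) (hf : GoodPoly F d aa)
    {en : Hf F q n d aa →ₐ[F] Hf F q (n + 1) d aa} (hen : IsCycEmb F q n (n + 1) d aa 0 en)
    {en0 : Hf F q (n - 1) d aa →ₐ[F] Hf F q n d aa} (hen0 : IsCycEmb F q (n - 1) n d aa 0 en0) :
    CountData (R := Hf F q (n + 1) d aa) (A := Hf F q n d aa) (B := Hf F q (n - 1) d aa) en en0
      (stdElt F q n d aa)
      (fun p : Fin d × Bool × Fin (n - 1 + 1) => std (nT q n d aa) (nC q n d aa) (nX q n d aa)
        (n - 1) p.1 p.2.1 p.2.2)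
      (Tf F q (n + 1) d aa ⟨n - 1, Nat.sub_lt hn one_pos⟩) (topElt q n d aa) := by
  have hs : stdElt F q n d aa = fun p => std (nT q (n + 1) d aa) (nC q (n + 1) d aa)
      (nX q (n + 1) d aa) n p.1 p.2.1 p.2.2 := funext stdElt_eq
  have hτ : Tf F q (n + 1) d aa ⟨n - 1, Nat.sub_lt hn one_pos⟩ = nT q (n + 1) d aa (n - 1) :=
    (ext0_of_lt (Tf F q (n + 1) d aa) _).symm
  have he : topElt q n d aa = fun p : Fin d × Bool => nX q (n + 1) d aa n ^ (p.1 : ℕ) *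
      (if p.2 then nC q (n + 1) d aa n else 1) := by
    rw [nX, nC, ext0_of_lt _ n.lt_succ_self, ext0_of_lt _ n.lt_succ_self]
    rfl
  rw [hs, hτ, he]
  exact Fwd.countData hn (fwd_hf q (n + 1) d aa) (fwd_hf q n d aa) hf
    (fev_nX q (n + 1) d aa n.succ_pos) (fev_nX q n d aa hn) (lower_hf_eq_top q (n + 1) d aa)
    (lower_hf_eq_top q n d aa) (range_emb n.le_succ hen) (range_emb (n.sub_le 1) hen0)
    (range_emb (by omega) (hen.comp (n.sub_le 1) hen0)) (finiteDimensional_hf q n hf)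
    (finiteDimensional_hf q (n + 1) hf) (le_finrank_hf hn hf)

theorem piece_eq_part (hn : 0 < n) (en : Hf F q n d aa →ₐ[F] Hf F q (n + 1) d aa) :
    piece F q n d hn aa en = CountData.part (A := Hf F q n d aa) en
      (Tf F q (n + 1) d aa ⟨n - 1, Nat.sub_lt hn one_pos⟩) (topElt q n d aa) := by
  funext t
  cases t <;> rfl

end Assembly

/-- **Structure of `H_{n+1}^f` over `H_n^f`** (Lemma `list` of Brundan–Kleshchev):
(i) `H_{n+1}^f` is a free right `H_n^f`-module with basis
`{X̃_j^a C̃_j^b T̃_j ⋯ T̃_n : 0 ≤ a < d, b ∈ {0,1}, 1 ≤ j ≤ n+1}`;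
(ii) as an `(H_n^f, H_n^f)`-bimodule,
`H_{n+1}^f = H_n^f T̃_n H_n^f ⊕ ⊕_{a,b} X̃_{n+1}^a C̃_{n+1}^b H_n^f`;
(iii) for each `0 ≤ a < d` there are even bimodule isomorphisms
`X̃_{n+1}^a H_n^f ≅ H_n^f`, `X̃_{n+1}^a C̃_{n+1} H_n^f ≅ Π H_n^f` (an even isomorphism
onto the parity-changed bimodule, i.e. determined by `X̃_{n+1}^a C̃_{n+1} · en v ↦ v`),
and `H_n^f T̃_n H_n^f ≅ H_n^f ⊗_{H_{n-1}^f} H_n^f` (characterized against any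
realization of the balanced tensor product by its universal property). -/
theorem cyclotomic_structure_over_subalgebra
    (F : Type) [Field F] [IsAlgClosed F] (h2 : (2 : F) ≠ 0)
    (q : F) (hq : GoodParam F q) (n : ℕ) (hn : 0 < n)
    (d : ℕ) (aa : ℕ → F) (hf : GoodPoly F d aa)
    (en : Hf F q n d aa →ₐ[F] Hf F q (n + 1) d aa)
    (hen : IsCycEmb F q n (n + 1) d aa 0 en)
    (en0 : Hf F q (n - 1) d aa →ₐ[F] Hf F q n d aa)
    (hen0 : IsCycEmb F q (n - 1) n d aa 0 en0) :
    -- (i) freeness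
    (∀ h : Hf F q (n + 1) d aa,
      ∃! c : (Fin d × Bool × Fin (n + 1)) →₀ Hf F q n d aa,
        h = c.sum fun p b => stdElt F q n d aa p * en b) ∧
    -- (ii) bimodule decomposition
    ((⨆ t : Option (Fin d × Bool), piece F q n d hn aa en t) = ⊤ ∧
      ∀ t : Option (Fin d × Bool),
        Disjoint (piece F q n d hn aa en t)
          (⨆ t' ∈ {t' : Option (Fin d × Bool) | t' ≠ t}, piece F q n d hn aa en t')) ∧
    -- (iii)(a)
    ((∀ a' : Fin d,
      ∃ θ : ↥(piece F q n d hn aa en (some (a', false))) ≃ₗ[F] Hf F q n d aa,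
        ∀ (v : Hf F q n d aa) (sEl : ↥(piece F q n d hn aa en (some (a', false)))),
          (sEl : Hf F q (n + 1) d aa) =
              Xf F q (n + 1) d aa ⟨n, n.lt_succ_self⟩ ^ (a' : ℕ) * en v →
            θ sEl = v) ∧
    -- (iii)(b)
    (∀ a' : Fin d,
      ∃ θ : ↥(piece F q n d hn aa en (some (a', true))) ≃ₗ[F] Hf F q n d aa,
        ∀ (v : Hf F q n d aa) (sEl : ↥(piece F q n d hn aa en (some (a', true)))),
          (sEl : Hf F q (n + 1) d aa) =
              Xf F q (n + 1) d aa ⟨n, n.lt_succ_self⟩ ^ (a' : ℕ) *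
                Cf F q (n + 1) d aa ⟨n, n.lt_succ_self⟩ * en v →
            θ sEl = v) ∧
    -- (iii)(c)
    ∀ (W : Type) [AddCommGroup W] [Module F W],
      ∀ bil : Hf F q n d aa →ₗ[F] Hf F q n d aa →ₗ[F] W,
        (∀ (u v : Hf F q n d aa) (w : Hf F q (n - 1) d aa),
          bil (u * en0 w) v = bil u (en0 w * v)) →
        (∀ (W' : Type) [AddCommGroup W'] [Module F W'],
          ∀ bil' : Hf F q n d aa →ₗ[F] Hf F q n d aa →ₗ[F] W',
            (∀ (u v : Hf F q n d aa) (w : Hf F q (n - 1) d aa),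
              bil' (u * en0 w) v = bil' u (en0 w * v)) →
            ∃! g : W →ₗ[F] W', ∀ u v : Hf F q n d aa, g (bil u v) = bil' u v) →
        ∃ θ : ↥(piece F q n d hn aa en none) ≃ₗ[F] W,
          ∀ (u v : Hf F q n d aa) (sEl : ↥(piece F q n d hn aa en none)),
            (sEl : Hf F q (n + 1) d aa) =
                en u * Tf F q (n + 1) d aa ⟨n - 1, Nat.sub_lt hn one_pos⟩ * en v →
              θ sEl = bil u v) := by
  have D := countData_hf hn hf hen hen0
  simp only [piece_eq_part]
  refine ⟨D.existsUnique_sum, ⟨D.iSup_part, fun t => D.decomposition.1 t⟩, fun a' => ?_, fun a' => ?_,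
    fun W _ _ bil hbil huniv => D.exists_equiv_none bil hbil huniv⟩
  · obtain ⟨θ, hθ⟩ := D.exists_equiv_some (a', false)
    refine ⟨θ, fun v w hw => hθ v w ?_⟩
    rw [hw, topElt, if_neg Bool.false_ne_true, mul_one]
  · obtain ⟨θ, hθ⟩ := D.exists_equiv_some (a', true)
    exact ⟨θ, fun v w hw => hθ v w hw⟩

end HC
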